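/- Let f = (f_1,…,f_s) ⊂ ℚ[y][x] satisfy Assumptions A and B. There exists a dense Zariski open subset 𝒪 of GL(n,t,ℂ) such that for every A ∈ 𝒪 ∩ GL(n,t,ℚ) there exists a dense Zariski open subset 𝒴_A of ℂ^t with the following properties: 𝒴_A is contained in the Zariski open set ℬ of Lemma (B-param) (so f(η,·) generates a radical equidimensional ideal with smooth zero set of dimension d for η ∈ 𝒴_A), and for every η ∈ 𝒴_A and every 1 ≤ i ≤ d+1, the restriction of the projection φ_{i−1} to crit(φ_i, V(f^A(η,·))) is proper and crit(φ_i, V(f^A(η,·))) is either empty or of dimension i−1. -/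

import Mathlib

open MvPolynomial

noncomputable section

/-- The common zero locus in `F^σ` of a set of polynomials. -/
def zLocus {σ F : Type*} [CommSemiring F] (S : Set (MvPolynomial σ F)) : Set (σ → F) :=
  {x | ∀ p ∈ S, eval x p = 0}

/-- The vanishing ideal of a subset of `F^σ`. -/
def vIdeal {σ F : Type*} [CommRing F] (V : Set (σ → F)) : Ideal (MvPolynomial σ F) where
  carrier := {p | ∀ x ∈ V, eval x p = 0}
  add_mem' := by
    intro p q hp hq x hx
    simp [hp x hx, hq x hx]
  zero_mem' := by intro x hx; simp
  smul_mem' := by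
    intro c p hp x hx
    simp [smul_eq_mul, hp x hx]

/-- The dimension of an algebraic set, as the Krull dimension of its coordinate ring. -/
def setDim {σ : Type*} (V : Set (σ → ℂ)) : WithBot (WithTop ℕ) :=
  ringKrullDim (MvPolynomial σ ℂ ⧸ vIdeal V)

/-- An ideal is equidimensional of dimension `d` if every minimal prime over it has
quotient of Krull dimension `d`. -/
def EquidimIdeal {R : Type*} [CommRing R] (I : Ideal R) (d : ℕ) : Prop :=
  ∀ P ∈ I.minimalPrimes, ringKrullDim (R ⧸ P) = (d : WithBot (WithTop ℕ))

/-- Differential at a point `p₀` of the polynomial `g`, applied to the vector `v`. -/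
def polyDiff {σ : Type*} [Fintype σ] [DecidableEq σ] (p₀ : σ → ℂ) (g : MvPolynomial σ ℂ)
    (v : σ → ℂ) : ℂ :=
  ∑ j, v j * eval p₀ (pderiv j g)

/-- The Zariski tangent space of `V` at `p₀`. -/
def tangentAt {σ : Type*} [Fintype σ] [DecidableEq σ] (V : Set (σ → ℂ)) (p₀ : σ → ℂ) :
    Submodule ℂ (σ → ℂ) where
  carrier := {v | ∀ g ∈ vIdeal V, polyDiff p₀ g v = 0}
  add_mem' := by
    intro a b ha hb g hg
    have h1 := ha g hg
    have h2 := hb g hg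
    simp only [polyDiff, Pi.add_apply, add_mul, Finset.sum_add_distrib] at *
    simp [h1, h2]
  zero_mem' := by intro g hg; simp [polyDiff]
  smul_mem' := by
    intro c a ha g hg
    have h1 := ha g hg
    simp only [polyDiff, Pi.smul_apply, smul_eq_mul, mul_assoc, ← Finset.mul_sum] at *
    simp [h1]

/-- The singular locus of `V`, relative to the expected dimension `d`:
points of `V` where the Zariski tangent space does not have dimension `d`. -/
def singLocus {σ : Type*} [Fintype σ] [DecidableEq σ] (V : Set (σ → ℂ)) (d : ℕ) :
    Set (σ → ℂ) :=
  {p | p ∈ V ∧ Module.finrank ℂ (tangentAt V p) ≠ d}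

/-- Critical points of the polynomial map with components `φ` restricted to the
nonsingular locus of `V` (`V` of expected dimension `d`). -/
def critMap {σ : Type*} [Fintype σ] [DecidableEq σ] {ι : Type*}
    (V : Set (σ → ℂ)) (d : ℕ) (φ : ι → MvPolynomial σ ℂ) : Set (σ → ℂ) :=
  {p | p ∈ V ∧ p ∉ singLocus V d ∧
    ¬ Function.Surjective (fun v : tangentAt V p => fun k : ι => polyDiff p (φ k) v)}

/-- The components of the projection on the first `i` coordinates, as polynomials. -/
def projPoly (n i : ℕ) : Fin i → MvPolynomial (Fin n) ℂ :=
  fun k => if h : (k : ℕ) < n then X ⟨k, h⟩ else 0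

/-- Critical locus of the projection to the first `i` coordinates restricted to `V`,
with the convention that for `i = d+1` it is all of `V`. -/
def critProj {n : ℕ} (V : Set (Fin n → ℂ)) (d i : ℕ) : Set (Fin n → ℂ) :=
  if i = d + 1 then V else critMap V d (projPoly n i)

/-- Projection of `ℂ^n` to the first `i` coordinates. -/
def projMap (n i : ℕ) (x : Fin n → ℂ) : Fin i → ℂ :=
  fun k => if h : (k : ℕ) < n then x ⟨k, h⟩ else 0

/-- `φ` restricted to `V` is proper at `β` (Euclidean topology). -/
def ProperAt {n i : ℕ} (φ : (Fin n → ℂ) → Fin i → ℂ) (V : Set (Fin n → ℂ))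
    (β : Fin i → ℂ) : Prop :=
  ∃ O : Set (Fin i → ℂ), IsOpen O ∧ β ∈ O ∧ IsCompact {x | x ∈ V ∧ φ x ∈ closure O}

/-- `φ` restricted to `V` is a proper map (onto its image). -/
def ProperOn {n i : ℕ} (φ : (Fin n → ℂ) → Fin i → ℂ) (V : Set (Fin n → ℂ)) : Prop :=
  ∀ β ∈ φ '' V, ProperAt φ V β

/-- Zariski open subsets of `F^k`: complements of zero loci of sets of polynomials. -/
def IsZariskiOpen {k : ℕ} {F : Type*} [CommSemiring F] (U : Set (Fin k → F)) : Prop :=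
  ∃ S : Set (MvPolynomial (Fin k) F), U = {x | ∃ p ∈ S, eval x p ≠ 0}

/-- Zariski open subsets of the space of `n × n` matrices over `F`. -/
def IsZariskiOpenMat {n : ℕ} {F : Type*} [CommSemiring F]
    (U : Set (Matrix (Fin n) (Fin n) F)) : Prop :=
  ∃ S : Set (MvPolynomial (Fin n × Fin n) F),
    U = {A | ∃ p ∈ S, eval (fun q => A q.1 q.2) p ≠ 0}

/-- Complexification of a rational polynomial. -/
def toC {σ : Type*} (p : MvPolynomial σ ℚ) : MvPolynomial σ ℂ :=
  MvPolynomial.map (algebraMap ℚ ℂ) p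

/-- The change of variables `x ↦ A·x` acting on the `x`-variables only
(the `y`-variables are left invariant). -/
def chgX {n t : ℕ} {F : Type*} [CommRing F] (A : Matrix (Fin n) (Fin n) F)
    (p : MvPolynomial (Fin n ⊕ Fin t) F) : MvPolynomial (Fin n ⊕ Fin t) F :=
  aeval (Sum.elim (fun j => ∑ k, C (A j k) * X (Sum.inl k)) (fun l => X (Sum.inr l))) p

/-- Specialization of the `y`-variables at the point `η`. -/
def specY {n t : ℕ} {F : Type*} [CommRing F] (η : Fin t → F)
    (p : MvPolynomial (Fin n ⊕ Fin t) F) : MvPolynomial (Fin n) F :=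
  aeval (Sum.elim X (fun l => C (η l))) p

/-- Jacobian matrix w.r.t. the `x`-variables, evaluated at a point `z ∈ ℂ^{n+t}`. -/
def jacXAt {n t s : ℕ} (f : Fin s → MvPolynomial (Fin n ⊕ Fin t) ℂ)
    (z : (Fin n ⊕ Fin t) → ℂ) : Matrix (Fin s) (Fin n) ℂ :=
  Matrix.of fun i j => eval z (pderiv (Sum.inl j) (f i))

/-- Symbolic Jacobian matrix of a polynomial system in the variables `x`. -/
def jacPoly {n s : ℕ} {F : Type*} [CommRing F] (g : Fin s → MvPolynomial (Fin n) F) :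
    Matrix (Fin s) (Fin n) (MvPolynomial (Fin n) F) :=
  Matrix.of fun i j => pderiv j (g i)

/-- Symbolic Jacobian matrix w.r.t. the `x`-variables of a system in variables `(x,y)`. -/
def jacPolyX {n t s : ℕ} {F : Type*} [CommRing F]
    (f : Fin s → MvPolynomial (Fin n ⊕ Fin t) F) :
    Matrix (Fin s) (Fin n) (MvPolynomial (Fin n ⊕ Fin t) F) :=
  Matrix.of fun i j => pderiv (Sum.inl j) (f i)

/-- The set of `k`-minors of `M` using only columns of index `≥ i` (0-indexed). -/
def minorsGE {s n : ℕ} {R : Type*} [CommRing R] (M : Matrix (Fin s) (Fin n) R)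
    (k i : ℕ) : Set R :=
  {q | ∃ (r : Fin k → Fin s) (c : Fin k → Fin n), Function.Injective r ∧
        Function.Injective c ∧ (∀ l, i ≤ (c l : ℕ)) ∧ q = (M.submatrix r c).det}

/-- Semi-algebraic formulas over `ℚ[y_1,…,y_t]`: boolean combinations of polynomial
sign conditions. -/
inductive SAForm (t : ℕ) : Type
  | eq (p : MvPolynomial (Fin t) ℚ) : SAForm t
  | pos (p : MvPolynomial (Fin t) ℚ) : SAForm t
  | nonneg (p : MvPolynomial (Fin t) ℚ) : SAForm t
  | ne (p : MvPolynomial (Fin t) ℚ) : SAForm t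
  | conj (φ ψ : SAForm t) : SAForm t
  | disj (φ ψ : SAForm t) : SAForm t
  | neg (φ : SAForm t) : SAForm t

/-- Truth value of a semi-algebraic formula at a point of `ℝ^t`. -/
def SAForm.holds {t : ℕ} : SAForm t → (Fin t → ℝ) → Prop
  | eq p, y => aeval y p = 0
  | pos p, y => 0 < aeval y p
  | nonneg p, y => 0 ≤ aeval y p
  | ne p, y => aeval y p ≠ 0
  | conj φ ψ, y => φ.holds y ∧ ψ.holds y
  | disj φ ψ, y => φ.holds y ∨ ψ.holds y
  | neg φ, y => ¬ φ.holds y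

/-- The maximal total degree of the polynomials involved in a semi-algebraic formula. -/
def SAForm.deg {t : ℕ} : SAForm t → ℕ
  | eq p => p.totalDegree
  | pos p => p.totalDegree
  | nonneg p => p.totalDegree
  | ne p => p.totalDegree
  | conj φ ψ => max φ.deg ψ.deg
  | disj φ ψ => max φ.deg ψ.deg
  | neg φ => φ.deg

/-- The solution set `Z(Φ) ⊆ ℝ^t` of a semi-algebraic formula. -/
def SAForm.zset {t : ℕ} (φ : SAForm t) : Set (Fin t → ℝ) := {y | φ.holds y}

/-- The real points of the variety defined by a rational system in variables `(x, y)`. -/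
def realPts {n t s : ℕ} (f : Fin s → MvPolynomial (Fin n ⊕ Fin t) ℚ) :
    Set ((Fin n ⊕ Fin t) → ℝ) :=
  {z | ∀ i, aeval z (f i) = 0}

/-- The real zero set of a set of rational polynomials. -/
def realZeros {σ : Type*} (S : Set (MvPolynomial σ ℚ)) : Set (σ → ℝ) :=
  {z | ∀ p ∈ S, aeval z p = 0}

/-- The projection `(x, y) ↦ y` on real points. -/
def projY {n t : ℕ} (z : (Fin n ⊕ Fin t) → ℝ) : Fin t → ℝ := z ∘ Sum.inr

/-- The projection `(x, y) ↦ y` on complex points. -/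
def projYC {n t : ℕ} (z : (Fin n ⊕ Fin t) → ℂ) : Fin t → ℂ := z ∘ Sum.inr

/-- The complex algebraic set defined by a rational polynomial system. -/
def VC {n t s : ℕ} (f : Fin s → MvPolynomial (Fin n ⊕ Fin t) ℚ) :
    Set ((Fin n ⊕ Fin t) → ℂ) :=
  zLocus (Set.range fun i => toC (f i))

/-- Assumption A: the ideal generated by `f` is radical, and its algebraic set is
(nonempty) equidimensional of dimension `d + t` with singular locus of dimension `< t`. -/
def AssumpA {n t s : ℕ} (f : Fin s → MvPolynomial (Fin n ⊕ Fin t) ℚ) (d : ℕ) : Prop :=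
  (Ideal.span (Set.range f)).IsRadical ∧
  (VC f).Nonempty ∧
  EquidimIdeal (vIdeal (VC f)) (d + t) ∧
  setDim (singLocus (VC f) (d + t)) < (t : WithBot (WithTop ℕ))

/-- Assumption B: the Zariski closure of `π(V)` is all of `ℂ^t` (no nonzero polynomial
vanishes on `π(V)`), and `π(V ∩ ℝ^{t+n})` has nonzero Lebesgue measure. -/
def AssumpB {n t s : ℕ} (f : Fin s → MvPolynomial (Fin n ⊕ Fin t) ℚ) : Prop :=
  (∀ p : MvPolynomial (Fin t) ℂ, (∀ z ∈ VC f, eval (projYC z) p = 0) → p = 0) ∧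
  MeasureTheory.volume (projY '' realPts f) ≠ 0

/-- The conclusion of Lemma (B-param): the system `g` generates a radical
equidimensional ideal whose algebraic set is either empty or smooth of dimension `d`. -/
def GoodSpec {n s : ℕ} (g : Fin s → MvPolynomial (Fin n) ℂ) (d : ℕ) : Prop :=
  (Ideal.span (Set.range g)).IsRadical ∧
  (zLocus (Set.range g) = ∅ ∨
    (EquidimIdeal (Ideal.span (Set.range g)) d ∧ singLocus (zLocus (Set.range g)) d = ∅))

/-- The field `ℚ(y_1, …, y_t)` of rational fractions. -/
abbrev RatFunc' (t : ℕ) : Type := FractionRing (MvPolynomial (Fin t) ℚ)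

/-- View a polynomial of `ℚ[x, y]` as a polynomial of `ℚ(y)[x]`. -/
def toKx {n t : ℕ} (p : MvPolynomial (Fin n ⊕ Fin t) ℚ) :
    MvPolynomial (Fin n) (RatFunc' t) :=
  eval₂ ((C : RatFunc' t →+* MvPolynomial (Fin n) (RatFunc' t)).comp
      ((algebraMap (MvPolynomial (Fin t) ℚ) (RatFunc' t)).comp (C : ℚ →+* MvPolynomial (Fin t) ℚ)))
    (Sum.elim X (fun l => C (algebraMap (MvPolynomial (Fin t) ℚ) (RatFunc' t) (X l)))) p

/-- Extension of a vector of `Fin d` to a function on `ℕ` (by zero). -/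
def extFun {d : ℕ} {F : Type*} [Zero F] (α : Fin d → F) : ℕ → F :=
  fun k => if h : k < d then α ⟨k, h⟩ else 0

/-- The polynomial system `W_i^{A,α}` (over the ground field `F`, the change of
variables being already performed): the input equations, the `(n-d)`-minors of the
truncated Jacobian (except when `i = d+1`), and the equations `x_k = α_k`, `k ≤ i-1`. -/
def Wsys {n s : ℕ} {F : Type*} [CommRing F] (g : Fin s → MvPolynomial (Fin n) F)
    (d i : ℕ) (a : ℕ → F) : Set (MvPolynomial (Fin n) F) :=
  Set.range g ∪ (if i = d + 1 then ∅ else minorsGE (jacPoly g) (n - d) i) ∪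
  {q | ∃ k : Fin n, (k : ℕ) < i - 1 ∧ q = X k - C (a k)}

/-- The polynomial system `W_i^{A,α}` viewed in `ℚ[y][x]` (variables `(x,y)`). -/
def WsysXY {n t s : ℕ} (f : Fin s → MvPolynomial (Fin n ⊕ Fin t) ℚ)
    (d i : ℕ) (a : ℕ → ℚ) : Set (MvPolynomial (Fin n ⊕ Fin t) ℚ) :=
  Set.range f ∪ (if i = d + 1 then ∅ else minorsGE (jacPolyX f) (n - d) i) ∪
  {q | ∃ k : Fin n, (k : ℕ) < i - 1 ∧ q = X (Sum.inl k) - C (a k)}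

/-- A commutative ring is Cohen–Macaulay if, for every maximal ideal `m`, there is a
regular sequence contained in `m` of length the height of `m`. -/
def IsCMRing (R : Type*) [CommRing R] : Prop :=
  ∀ m : Ideal R, ∀ hm : m.IsMaximal, ∃ rs : List R,
    (∀ r ∈ rs, r ∈ m) ∧ RingTheory.Sequence.IsRegular R rs ∧
    (rs.length : WithBot (WithTop ℕ)) = ringKrullDim (@Localization.AtPrime R _ m hm.isPrime)

/-- Homogenization of a polynomial w.r.t. all its variables, using a fresh variable. -/
def homog {σ : Type*} {F : Type*} [CommSemiring F] [DecidableEq σ] (p : MvPolynomial σ F) :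
    MvPolynomial (σ ⊕ Unit) F :=
  p.support.sum fun m =>
    monomial (m.mapDomain Sum.inl +
        Finsupp.single (Sum.inr ()) (p.totalDegree - m.sum fun _ e => e)) (coeff m p)

/-- Zariski open subsets of the space `ℂ[x,y]^s_{≤D}` of `s`-tuples of polynomials of
total degree at most `D`, described by polynomial conditions on the coefficients. -/
def IsZariskiOpenTuple {n t : ℕ} (s D : ℕ)
    (U : Set (Fin s → MvPolynomial (Fin n ⊕ Fin t) ℂ)) : Prop :=
  ∃ S : Set (MvPolynomial (Fin s × ((Fin n ⊕ Fin t) →₀ ℕ)) ℂ),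
    U = {f | (∀ i, (f i).totalDegree ≤ D) ∧
          ∃ p ∈ S, eval (fun im => coeff im.2 (f im.1)) p ≠ 0}

/-- Zariski open subsets of the product of the space of `n×n` complex matrices with `ℂ^n`. -/
def IsZariskiOpenMatVec {n : ℕ}
    (U : Set (Matrix (Fin n) (Fin n) ℂ × (Fin n → ℂ))) : Prop :=
  ∃ S : Set (MvPolynomial ((Fin n × Fin n) ⊕ Fin n) ℂ),
    U = {Aα | ∃ p ∈ S, eval (Sum.elim (fun q => Aα.1 q.1 q.2) Aα.2) p ≠ 0}



theorem dim_le_of_integral (R S : Type*) [CommRing R] [CommRing S] [Algebra R S]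
    [Algebra.IsIntegral R S] : ringKrullDim S ≤ ringKrullDim R := by
  refine Order.krullDim_le_of_strictMono (PrimeSpectrum.comap (algebraMap R S)) ?_
  intro p q hpq
  have h : p.asIdeal < q.asIdeal := hpq
  exact Ideal.IsIntegral.comap_lt_comap (R := R) h

theorem dim_ge_of_integral (R S : Type*) [CommRing R] [CommRing S] [Algebra R S]
    [Algebra.IsIntegral R S] (hinj : Function.Injective (algebraMap R S)) :
    ringKrullDim R ≤ ringKrullDim S := by
  unfold ringKrullDim Order.krullDim
  refine iSup_le fun l => ?_
  obtain ⟨Q, _, hQ, hQl⟩ := Ideal.exists_ideal_over_prime_of_isIntegral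
    (S := S) (RelSeries.head l).asIdeal ⊥ (by
      rw [← RingHom.ker_eq_comap_bot, (RingHom.injective_iff_ker_eq_bot _).1 hinj]; exact bot_le)
  haveI : Q.LiesOver (RelSeries.head l).asIdeal := ⟨hQl.symm⟩
  obtain ⟨L, hL, _⟩ := Ideal.exists_ltSeries_of_hasGoingUp (S := S) l Q
  rw [← hL]
  exact le_iSup (fun p : LTSeries (PrimeSpectrum S) => (p.length : WithBot ℕ∞)) L

theorem dim_mvPoly (k σ : Type*) [Field k] [Finite σ] :
    ringKrullDim (MvPolynomial σ k) = (Nat.card σ : WithBot ℕ∞) := by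
  rw [MvPolynomial.ringKrullDim_of_isNoetherianRing, ringKrullDim_eq_zero_of_field]; simp

/-- Noether normalization with dimension. -/
theorem exists_noether (k S : Type*) [Field k] [CommRing S] [Nontrivial S] [Algebra k S]
    [Algebra.FiniteType k S] : ∃ (m : ℕ) (g : MvPolynomial (Fin m) k →ₐ[k] S),
      Function.Injective g ∧ g.IsIntegral ∧ ringKrullDim S = (m : WithBot ℕ∞) := by
  obtain ⟨m, g, hg, hi⟩ := exists_integral_inj_algHom_of_fg k S
  refine ⟨m, g, hg, hi, ?_⟩
  letI := g.toRingHom.toAlgebra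
  haveI : Algebra.IsIntegral (MvPolynomial (Fin m) k) S := ⟨hi⟩
  refine le_antisymm ((dim_le_of_integral (MvPolynomial (Fin m) k) S).trans ?_)
    (le_trans ?_ (dim_ge_of_integral (MvPolynomial (Fin m) k) S hg))
  · rw [dim_mvPoly]; simp
  · rw [dim_mvPoly]; simp

theorem algIndep_of_inj {k S σ : Type*} [Field k] [CommRing S] [Algebra k S]
    (φ : MvPolynomial σ k →ₐ[k] S) (hφ : Function.Injective φ) :
    AlgebraicIndependent k (fun i => φ (X i)) := by
  have : aeval (fun i => φ (X i)) = φ := by ext i; simp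
  rw [AlgebraicIndependent, this]; exact hφ

theorem dim_eq_trdeg (k : Type*) (S : Type*) [Field k] [CommRing S] [IsDomain S] [Algebra k S]
    [Algebra.FiniteType k S] : ∃ m : ℕ, ringKrullDim S = (m : WithBot ℕ∞) ∧
      Algebra.trdeg k S = m := by
  obtain ⟨m, g, hg, hi, hd⟩ := exists_noether k S
  refine ⟨m, hd, ?_⟩
  have hai := algIndep_of_inj g hg
  have h1 := hai.lift_cardinalMk_le_trdeg
  have hr : (Algebra.adjoin k (Set.range fun i => g (X i))) = g.range := by
    rw [Algebra.adjoin_range_eq_range_aeval]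
    congr 1; ext i; simp
  haveI : Algebra.IsAlgebraic (Algebra.adjoin k (Set.range fun i => g (X i))) S := by
    suffices h : Algebra.IsIntegral (Algebra.adjoin k (Set.range fun i => g (X i))) S from
      Algebra.IsIntegral.isAlgebraic
    rw [hr]
    constructor
    intro x
    obtain ⟨p, hp, hx⟩ := hi x
    refine ⟨p.map g.rangeRestrict.toRingHom, hp.map _, ?_⟩
    rw [Polynomial.eval₂_map]
    exact hx
  have h2 := Algebra.IsAlgebraic.trdeg_le_cardinalMk k (A := S) (Set.range fun i => g (X i))
  have h3 : Cardinal.mk (Set.range fun i => g (X i)) ≤ m := by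
    have := Cardinal.mk_range_le_lift (f := fun i : Fin m => g (X i))
    simpa using this
  apply le_antisymm (h2.trans h3)
  simpa using h1

theorem card_le_of_inj_domain {k S σ : Type*} [Field k] [CommRing S] [IsDomain S] [Algebra k S]
    [Algebra.FiniteType k S] [Finite σ] (φ : MvPolynomial σ k →ₐ[k] S)
    (hφ : Function.Injective φ) : (Nat.card σ : WithBot ℕ∞) ≤ ringKrullDim S := by
  obtain ⟨m, hm, ht⟩ := dim_eq_trdeg k S
  have h1 := (algIndep_of_inj φ hφ).lift_cardinalMk_le_trdeg
  rw [ht, hm] at *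
  haveI := Fintype.ofFinite σ
  simp only [Cardinal.mk_fintype, Cardinal.lift_natCast, Nat.cast_le] at h1
  rw [Nat.card_eq_fintype_card]
  exact_mod_cast h1

theorem exists_prime_disjoint {R S : Type*} [CommRing R] [IsDomain R] [CommRing S]
    (φ : R →+* S) (I : Ideal S) (h : ∀ r, φ r ∈ I → r = 0) :
    ∃ P : Ideal S, P.IsPrime ∧ I ≤ P ∧ ∀ r, φ r ∈ P → r = 0 := by
  obtain ⟨P, hP, hIP, hd⟩ := Ideal.exists_le_prime_disjoint I
    ((nonZeroDivisors R).map φ) (by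
      rw [Set.disjoint_left]
      rintro x hx ⟨r, hr, rfl⟩
      exact nonZeroDivisors.ne_zero hr (h r hx))
  refine ⟨P, hP, hIP, fun r hr => ?_⟩
  by_contra hne
  exact Set.disjoint_left.1 hd hr ⟨r, mem_nonZeroDivisors_of_ne_zero hne, rfl⟩

theorem card_le_of_inj {k S σ : Type*} [Field k] [CommRing S] [Algebra k S]
    [Algebra.FiniteType k S] [Finite σ] (φ : MvPolynomial σ k →ₐ[k] S)
    (hφ : Function.Injective φ) : (Nat.card σ : WithBot ℕ∞) ≤ ringKrullDim S := by
  obtain ⟨P, hP, -, hPd⟩ := exists_prime_disjoint φ.toRingHom ⊥ (by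
    intro r hr; exact hφ (by simpa using hr))
  have := card_le_of_inj_domain ((Ideal.Quotient.mkₐ k P).comp φ) (by
    rw [injective_iff_map_eq_zero]
    intro a ha
    exact hPd a (Ideal.Quotient.eq_zero_iff_mem.1 ha))
  exact this.trans (ringKrullDim_quotient_le P)

/-- rows lin. indep. implies a nonzero maximal minor -/
theorem exists_minor {K : Type*} [Field K] {ρ κ : Type*} [Fintype ρ] [DecidableEq ρ] [Finite κ]
    (v : ρ → κ → K) (hv : LinearIndependent K v) :
    ∃ c : ρ → κ, (Matrix.of fun a b => v a (c b)).det ≠ 0 := by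
  haveI := Fintype.ofFinite κ
  let M : Matrix ρ κ K := Matrix.of v
  have hr : M.rank = Fintype.card ρ := LinearIndependent.rank_matrix hv
  have hs : Submodule.span K (Set.range M.col) = ⊤ := by
    apply Submodule.eq_top_of_finrank_eq
    rw [← Matrix.rank_eq_finrank_span_cols, hr]; simp
  obtain ⟨κ', a, ha, hsp, hli⟩ := exists_linearIndependent' K M.col
  have hb : Module.Basis κ' K (ρ → K) := Module.Basis.mk hli (by rw [hsp, hs])
  haveI : Finite κ' := Finite.of_injective a ha
  haveI := Fintype.ofFinite κ'
  have hc : Fintype.card κ' = Fintype.card ρ := by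
    rw [← Module.finrank_eq_card_basis hb]; simp
  let e : ρ ≃ κ' := (Fintype.equivOfCardEq hc).symm
  refine ⟨a ∘ e, ?_⟩
  have h2 : LinearIndependent K (fun b : ρ => M.col (a (e b))) := hli.comp e e.injective
  have h3 : IsUnit (Matrix.of fun a' b => v a' ((a ∘ e) b)) := by
    rw [← Matrix.linearIndependent_cols_iff_isUnit]
    exact h2
  exact ((Matrix.isUnit_iff_isUnit_det _).1 h3).ne_zero


theorem exists_algHom_complex (T : Type*) [CommRing T] [Nontrivial T] [Algebra ℂ T]
    [Algebra.FiniteType ℂ T] : Nonempty (T →ₐ[ℂ] ℂ) := by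
  obtain ⟨m, hm⟩ := Ideal.exists_maximal T
  letI := Ideal.Quotient.field m
  haveI : Module.Finite ℂ (T ⧸ m) := finite_of_finite_type_of_isJacobsonRing ℂ (T ⧸ m)
  haveI : Algebra.IsAlgebraic ℂ (T ⧸ m) := Algebra.IsAlgebraic.of_finite _ _
  exact ⟨(IsAlgClosed.lift (R := ℂ) (S := T ⧸ m) (M := ℂ)).comp (Ideal.Quotient.mkₐ ℂ m)⟩

theorem exists_generic_lift {σ S : Type*} [Finite σ] [CommRing S] [IsDomain S] [Algebra ℂ S]
    [Algebra.FiniteType ℂ S] (φ : MvPolynomial σ ℂ →ₐ[ℂ] S) (hφ : Function.Injective φ) :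
    ∃ h : MvPolynomial σ ℂ, h ≠ 0 ∧ ∀ p : σ → ℂ, eval p h ≠ 0 →
      ∃ ψ : S →ₐ[ℂ] ℂ, ∀ i, ψ (φ (X i)) = p i := by
  have hft : φ.toRingHom.FiniteType := by
    have : (φ.toRingHom.comp (algebraMap ℂ (MvPolynomial σ ℂ))).FiniteType := by
      have h := RingHom.finiteType_algebraMap.mpr (inferInstance : Algebra.FiniteType ℂ S)
      rwa [← φ.comp_algebraMap] at h
    exact this.of_comp_finiteType
  have hfp : φ.toRingHom.FinitePresentation := RingHom.FinitePresentation.of_finiteType.1 hft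
  obtain ⟨D, hD⟩ := PrimeSpectrum.exists_constructibleSetData_iff.2
    (PrimeSpectrum.isConstructible_range_comap hfp)
  have hbot : (⟨⊥, Ideal.isPrime_bot⟩ : PrimeSpectrum (MvPolynomial σ ℂ)) ∈ D.toSet := by
    rw [hD]
    refine ⟨⟨⊥, Ideal.isPrime_bot⟩, ?_⟩
    ext1
    simp only [PrimeSpectrum.comap_asIdeal]
    rw [← RingHom.ker_eq_comap_bot]
    exact (RingHom.injective_iff_ker_eq_bot _).1 hφ
  simp only [PrimeSpectrum.ConstructibleSetData.toSet, Set.mem_iUnion] at hbot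
  obtain ⟨c, hc, hmem⟩ := hbot
  simp only [PrimeSpectrum.BasicConstructibleSetData.toSet, Set.mem_sdiff,
    PrimeSpectrum.mem_zeroLocus, Set.singleton_subset_iff, Set.range_subset_iff,
    SetLike.mem_coe, Ideal.mem_bot] at hmem
  refine ⟨c.f, hmem.2, fun p hp => ?_⟩
  let mp : PrimeSpectrum (MvPolynomial σ ℂ) :=
    ⟨RingHom.ker (eval p), RingHom.ker_isPrime _⟩
  have hmp : mp ∈ D.toSet := by
    simp only [PrimeSpectrum.ConstructibleSetData.toSet, Set.mem_iUnion]
    refine ⟨c, hc, ?_⟩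
    simp only [PrimeSpectrum.BasicConstructibleSetData.toSet, Set.mem_sdiff,
      PrimeSpectrum.mem_zeroLocus, Set.singleton_subset_iff, Set.range_subset_iff,
      SetLike.mem_coe]
    refine ⟨fun y => ?_, ?_⟩
    · rw [hmem.1 y]; exact Ideal.zero_mem _
    · exact fun h => hp h
  rw [hD] at hmp
  obtain ⟨q, hq⟩ := hmp
  have hq' : Ideal.comap φ.toRingHom q.asIdeal = RingHom.ker (eval p) :=
    congrArg PrimeSpectrum.asIdeal hq
  haveI := q.isPrime
  obtain ⟨ψ⟩ := exists_algHom_complex (S ⧸ q.asIdeal)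
  refine ⟨ψ.comp (Ideal.Quotient.mkₐ ℂ _), fun i => ?_⟩
  have h1 : X i - C (p i) ∈ Ideal.comap φ.toRingHom q.asIdeal := by
    rw [hq', RingHom.mem_ker]; simp
  have h2 : Ideal.Quotient.mkₐ ℂ q.asIdeal (φ (X i - C (p i))) = 0 :=
    Ideal.Quotient.eq_zero_iff_mem.2 h1
  have h3 : φ (C (p i)) = algebraMap ℂ S (p i) := φ.commutes (p i)
  rw [map_sub, map_sub, sub_eq_zero, h3, AlgHom.commutes] at h2
  rw [AlgHom.comp_apply, h2, AlgHom.commutes]; rfl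

theorem derivation_aeval {k F σ : Type*} [Field k] [Field F] [Algebra k F] [Fintype σ]
    [DecidableEq σ] (D : Derivation k F F) (x : σ → F) (p : MvPolynomial σ k) :
    D (aeval x p) = ∑ j, aeval x (pderiv j p) * D (x j) := by
  induction p using MvPolynomial.induction_on with
  | C a => simp
  | add p q hp hq => simp [hp, hq, add_mul, Finset.sum_add_distrib]
  | mul_X p i hp =>
    simp only [map_mul, aeval_X, Derivation.leibniz, smul_eq_mul, hp, pderiv_X, map_add,
      add_mul, Finset.sum_add_distrib]
    congr 1
    · rw [Finset.sum_eq_single i] <;> simp +contextual [Pi.single_apply]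
    · rw [Finset.mul_sum]
      refine Finset.sum_congr rfl fun j _ => ?_
      ring

theorem exists_derivation_basis {k F τ : Type*} [Field k] [CharZero k] [Field F] [Algebra k F]
    (y : τ → F) (hy : IsTranscendenceBasis k y) (w : τ → F) :
    ∃ D : Derivation k F F, ∀ l, D (y l) = w l := by
  letI : Algebra (MvPolynomial τ k) F := (aeval y).toRingHom.toAlgebra
  haveI : IsScalarTower k (MvPolynomial τ k) F := IsScalarTower.of_algebraMap_eq' (by
    ext a; exact ((aeval y).commutes a).symm)
  have hinj : Function.Injective (algebraMap (MvPolynomial τ k) F) := hy.1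
  haveI : FaithfulSMul (MvPolynomial τ k) F := (faithfulSMul_iff_algebraMap_injective _ _).2 hinj
  let K := FractionRing (MvPolynomial τ k)
  letI : Algebra K F := FractionRing.liftAlgebra (MvPolynomial τ k) F
  haveI : IsScalarTower (MvPolynomial τ k) K F := inferInstance
  haveI h0 : Algebra.IsAlgebraic (MvPolynomial τ k) F := by
    have h := hy.isAlgebraic
    constructor
    intro x
    obtain ⟨p, hp, hx⟩ := h.isAlgebraic x
    have he := hy.1.aevalEquiv
    refine ⟨p.map (hy.1.aevalEquiv.symm : _ ≃ₐ[k] MvPolynomial τ k).toAlgHom.toRingHom, ?_, ?_⟩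
    · intro h0
      exact hp (Polynomial.map_injective _ (hy.1.aevalEquiv.symm.injective) (by simpa using h0))
    · rw [← hx, Polynomial.aeval_def, Polynomial.eval₂_map, Polynomial.aeval_def]
      congr 1
      ext a
      obtain ⟨b, rfl⟩ := hy.1.aevalEquiv.surjective a
      simp
      rfl
  haveI : Algebra.IsAlgebraic K F :=
    (IsFractionRing.comap_isAlgebraic_iff (A := MvPolynomial τ k) (K := K) (C := F)).1 h0
  haveI : CharZero K := charZero_of_injective_algebraMap
    (FaithfulSMul.algebraMap_injective k K)
  haveI : Algebra.FormallyEtale K F := Algebra.FormallyEtale.of_isSeparable K F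
  haveI : Algebra.FormallyEtale (MvPolynomial τ k) K :=
    Algebra.FormallyEtale.of_isLocalization (nonZeroDivisors _)
  haveI : Algebra.FormallyEtale (MvPolynomial τ k) F := Algebra.FormallyEtale.comp _ K _
  let d0 : Derivation k (MvPolynomial τ k) F := mkDerivation k w
  let L : F →ₗ[F] _ := LinearMap.id
  let e := KaehlerDifferential.tensorKaehlerEquivOfFormallyEtale k (MvPolynomial τ k) F
  let lin : TensorProduct (MvPolynomial τ k) F (Ω[MvPolynomial τ k⁄k]) →ₗ[F] F :=
    d0.liftKaehlerDifferential.liftBaseChange F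
  refine ⟨(lin.comp e.symm.toLinearMap).compDer (KaehlerDifferential.D k F), fun l => ?_⟩
  have h1 : y l = algebraMap (MvPolynomial τ k) F (X l) := (aeval_X y l).symm
  have h2 := KaehlerDifferential.tensorKaehlerEquivOfFormallyEtale_symm_D_algebraMap k
    (MvPolynomial τ k) F (X l)
  have h3 : d0 (X l) = w l := mkDerivation_X _ _ _
  simp only [LinearMap.compDer, Derivation.coe_mk', LinearMap.coe_mk]
  change lin (e.symm (KaehlerDifferential.D k F (y l))) = w l
  rw [h1]
  erw [h2]
  simp [lin, h3]

theorem exists_derivation {k F τ : Type*} [Field k] [CharZero k] [Field F] [Algebra k F]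
    (y : τ → F) (hy : AlgebraicIndependent k y) (w : τ → F) :
    ∃ D : Derivation k F F, ∀ l, D (y l) = w l := by
  classical
  have hr : AlgebraicIndepOn k id (Set.range y) := hy.coe_range
  obtain ⟨s, hs, hb⟩ := exists_isTranscendenceBasis_superset hr
  have hyi : Function.Injective y := hy.injective
  obtain ⟨D, hD⟩ := exists_derivation_basis ((↑) : s → F) hb
    (fun b => if h : ∃ l, y l = b then w h.choose else 0)
  refine ⟨D, fun l => ?_⟩
  have h := hD ⟨y l, hs ⟨l, rfl⟩⟩
  have hex : ∃ l', y l' = y l := ⟨l, rfl⟩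
  rw [h]
  simp only [hex, dif_pos]
  congr 1
  exact hyi hex.choose_spec

/-- Jacobian criterion, upper bound on the dimension. -/
theorem dim_add_le_of_minor {k σ ρ : Type*} [Field k] [CharZero k] [Fintype σ] [DecidableEq σ]
    [Fintype ρ] [DecidableEq ρ] (P : Ideal (MvPolynomial σ k)) [hP : P.IsPrime]
    (g : ρ → MvPolynomial σ k) (hg : ∀ a, g a ∈ P) (c : ρ → σ)
    (hc : (Matrix.of fun a b => pderiv (c b) (g a)).det ∉ P) :
    ∃ m : ℕ, ringKrullDim (MvPolynomial σ k ⧸ P) = (m : WithBot ℕ∞) ∧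
      m + Fintype.card ρ ≤ Fintype.card σ := by
  obtain ⟨m, φ, hφ, -, hm⟩ := exists_noether k (MvPolynomial σ k ⧸ P)
  refine ⟨m, hm, ?_⟩
  let F := FractionRing (MvPolynomial σ k ⧸ P)
  let ι : (MvPolynomial σ k ⧸ P) →ₐ[k] F := IsScalarTower.toAlgHom k _ F
  have hι : Function.Injective ι := IsFractionRing.injective _ F
  let x : σ → F := fun j => ι (Ideal.Quotient.mkₐ k P (X j))
  have hx : ∀ p, aeval x p = ι (Ideal.Quotient.mkₐ k P p) := by
    intro p
    have : aeval x = ι.comp (Ideal.Quotient.mkₐ k P) := by ext j; simp [x]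
    rw [this]; rfl
  have hx0 : ∀ p, aeval x p = 0 ↔ p ∈ P := by
    intro p
    rw [hx, map_eq_zero_iff _ hι]
    exact Ideal.Quotient.eq_zero_iff_mem
  let y : Fin m → F := fun l => ι (φ (X l))
  have hy : AlgebraicIndependent k y := algIndep_of_inj (ι.comp φ) (hι.comp hφ)
  choose D hD using fun l : Fin m => exists_derivation y hy (Pi.single l 1)
  let u : Fin m → σ → F := fun l j => D l (x j)
  have hu : LinearIndependent F u := by
    rw [Fintype.linearIndependent_iff]
    intro a ha l
    have h1 : ∀ p : MvPolynomial σ k, ∑ l, a l * D l (aeval x p) = 0 := by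
      intro p
      have h0 : ∀ l, a l * D l (aeval x p) = ∑ j, a l * (aeval x (pderiv j p) * D l (x j)) := by
        intro l; rw [derivation_aeval, Finset.mul_sum]
      rw [Finset.sum_congr rfl fun l _ => h0 l, Finset.sum_comm]
      refine Finset.sum_eq_zero fun j _ => ?_
      have h2 := congrFun ha j
      simp only [Finset.sum_apply, Pi.smul_apply, smul_eq_mul, Pi.zero_apply, u] at h2
      calc _ = aeval x (pderiv j p) * ∑ l, a l * D l (x j) := by
            rw [Finset.mul_sum]; refine Finset.sum_congr rfl fun _ _ => by ring
        _ = 0 := by rw [h2, mul_zero]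
    obtain ⟨p, hp⟩ := Ideal.Quotient.mkₐ_surjective k P (φ (X l))
    have h3 := h1 p
    rw [hx, hp] at h3
    change ∑ l', a l' * D l' (y l) = 0 at h3
    simp only [hD] at h3
    simpa [Pi.single_apply] using h3
  let J : Matrix ρ σ F := Matrix.of fun a j => aeval x (pderiv j (g a))
  have hker : ∀ l, u l ∈ LinearMap.ker J.mulVecLin := by
    intro l
    rw [LinearMap.mem_ker]
    ext a
    have := derivation_aeval (D l) x (g a)
    rw [(hx0 _).2 (hg a), map_zero] at this
    simp only [Matrix.mulVecLin_apply, Matrix.mulVec, dotProduct, J, Matrix.of_apply, u,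
      Pi.zero_apply]
    exact this.symm
  have hdet : (J.submatrix id c).det ≠ 0 := by
    have : J.submatrix id c = (Matrix.of fun a b => pderiv (c b) (g a)).map (aeval x) := by
      ext a b; simp [J]
    rw [this]
    have h2 := (AlgHom.map_det (aeval x : MvPolynomial σ k →ₐ[k] F)
      (Matrix.of fun a b => pderiv (c b) (g a))).symm
    rw [AlgHom.mapMatrix_apply] at h2
    rw [h2]
    exact fun h => hc ((hx0 _).1 h)
  have hrank : J.rank = Fintype.card ρ := by
    apply LinearIndependent.rank_matrix
    have h1 : LinearIndependent F (J.submatrix id c).row :=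
      Matrix.linearIndependent_rows_iff_isUnit.2
        ((Matrix.isUnit_iff_isUnit_det _).2 (isUnit_iff_ne_zero.2 hdet))
    exact LinearIndependent.of_comp (LinearMap.funLeft F F c) h1
  have hrn := LinearMap.finrank_range_add_finrank_ker J.mulVecLin
  have hr2 : Module.finrank F (LinearMap.range J.mulVecLin) = Fintype.card ρ := hrank
  rw [hr2, Module.finrank_fintype_fun_eq_card] at hrn
  have hm2 : m ≤ Module.finrank F (LinearMap.ker J.mulVecLin) := by
    have : LinearIndependent F (fun l => (⟨u l, hker l⟩ : LinearMap.ker J.mulVecLin)) := by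
      exact LinearIndependent.of_comp (LinearMap.ker J.mulVecLin).subtype hu
    simpa using this.fintype_card_le_finrank
  omega


theorem exists_decomp {K L σ ι : Type*} [Field K] [Field L] [Algebra K L]
    (b : Module.Basis ι K L) (g : MvPolynomial σ L) :
    ∃ s : ι →₀ MvPolynomial σ K, g = s.sum fun i p => C (b i) * map (algebraMap K L) p := by
  classical
  induction g using MvPolynomial.induction_on' with
  | monomial u a =>
    refine ⟨(b.repr a).mapRange (monomial u) (by simp), ?_⟩
    rw [Finsupp.sum_mapRange_index (by simp)]
    simp only [map_monomial, C_mul_monomial]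
    conv_lhs => rw [← b.linearCombination_repr a, Finsupp.linearCombination_apply]
    rw [Finsupp.sum, Finsupp.sum, map_sum]
    refine Finset.sum_congr rfl fun i _ => ?_
    rw [Algebra.smul_def, mul_comm]
  | add p q hp hq =>
    obtain ⟨s, rfl⟩ := hp
    obtain ⟨s', rfl⟩ := hq
    refine ⟨s + s', ?_⟩
    rw [Finsupp.sum_add_index' (by simp) (by simp [mul_add])]

theorem galois_indep {k K ι : Type*} [Field k] [Field K] [Algebra k K] [IsGalois k K]
    (c : ι → K) (hc : LinearIndependent k c) (s : Finset ι) (a : ι → K)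
    (h : ∀ τ : K ≃ₐ[k] K, ∑ i ∈ s, a i * τ (c i) = 0) : ∀ i ∈ s, a i = 0 := by
  classical
  have hinj := hc.injective
  have hli : LinearIndepOn (FixedPoints.subfield (K ≃ₐ[k] K) K) id (↑(s.image c) : Set K) := by
    have h1 : LinearIndepOn k id (Set.range c) := hc.linearIndepOn_id
    have h2 : LinearIndepOn k id (↑(s.image c) : Set K) := h1.mono (by simp)
    rw [linearIndepOn_finset_iff] at h2 ⊢
    intro g hg i hi
    have hg' : ∀ x, ∃ y : k, algebraMap k K y = g x := by
      intro x
      have : (g x : K) ∈ (⊥ : IntermediateField k K) := by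
        rw [InfiniteGalois.mem_bot_iff_fixed]
        intro τ
        exact (g x).2 τ
      rwa [IntermediateField.mem_bot] at this
    choose g' hg' using hg'
    have h3 := h2 g' (by
      rw [← hg]
      refine Finset.sum_congr rfl fun x _ => ?_
      rw [Algebra.smul_def, hg']; rfl) i hi
    have := hg' i
    rw [h3, map_zero] at this
    exact Subtype.ext this.symm
  have h4 := FixedPoints.linearIndependent_smul_of_linearIndependent (K ≃ₐ[k] K) K hli
  rw [linearIndepOn_finset_iff] at h4
  have h5 := h4 (fun x => if hx : ∃ i, c i = x then a hx.choose else 0) (by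
    rw [Finset.sum_image (fun _ _ _ _ h => hinj h)]
    ext τ
    rw [Finset.sum_apply]
    simp only [Pi.smul_apply, smul_eq_mul, Pi.zero_apply]
    rw [← h τ]
    refine Finset.sum_congr rfl fun i _ => ?_
    have hex : ∃ i', c i' = c i := ⟨i, rfl⟩
    rw [dif_pos hex, hinj hex.choose_spec]
    rfl)
  intro i hi
  have hex : ∃ i', c i' = c i := ⟨i, rfl⟩
  have := h5 (c i) (Finset.mem_image_of_mem _ hi)
  rwa [dif_pos hex, hinj hex.choose_spec] at this

theorem mem_span_map_of_vanish {σ K : Type*} [Finite σ] [Field K] [Algebra ℚ K] [Algebra K ℂ]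
    [IsAlgClosure ℚ K] (I : Ideal (MvPolynomial σ ℚ)) (hI : I.IsRadical)
    (g : MvPolynomial σ ℂ)
    (hg : ∀ x : σ → ℂ, (∀ p ∈ I, aeval x p = 0) → eval x g = 0) :
    g ∈ I.map (map (algebraMap ℚ ℂ)) := by
  haveI : IsScalarTower ℚ K ℂ := IsScalarTower.of_algebraMap_eq' (Subsingleton.elim _ _)
  haveI : IsAlgClosed K := IsAlgClosure.isAlgClosed ℚ
  haveI : IsGalois ℚ K := IsAlgClosure.isGalois ℚ K
  obtain ⟨s, rfl⟩ := exists_decomp (Module.Basis.ofVectorSpace K ℂ) g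
  refine Ideal.sum_mem _ fun i hi => Ideal.mul_mem_left _ _ ?_
  have h1 : ∀ v : σ → K, (∀ p ∈ I, aeval v p = 0) → eval v (s i) = 0 := by
    intro v hv
    have h2 := hg (fun j => algebraMap K ℂ (v j)) (by
      intro p hp
      have := MvPolynomial.aeval_algebraMap_apply ℂ v p
      rw [hv p hp, map_zero] at this
      exact this)
    rw [Finsupp.sum, map_sum] at h2
    have h3 := linearIndependent_iff'.1 (Module.Basis.ofVectorSpace K ℂ).linearIndependent
      s.support (fun i => eval v (s i)) (by
        rw [← h2]
        refine Finset.sum_congr rfl fun i _ => ?_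
        rw [map_mul, eval_C, Algebra.smul_def, mul_comm]
        congr 1
        rw [eval_map, ← aeval_def]
        have := MvPolynomial.aeval_algebraMap_apply ℂ v (s i)
        rw [aeval_eq_eval] at this
        exact this.symm)
    exact h3 i hi
  obtain ⟨s', hs'⟩ := exists_decomp (Module.Basis.ofVectorSpace ℚ K) (s i)
  rw [hs', Finsupp.sum, map_sum]
  refine Ideal.sum_mem _ fun k hk => ?_
  rw [map_mul, MvPolynomial.map_map, ← IsScalarTower.algebraMap_eq]
  refine Ideal.mul_mem_left _ _ (Ideal.mem_map_of_mem _ ?_)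
  rw [← hI.radical, ← MvPolynomial.vanishingIdeal_zeroLocus_eq_radical (K := K),
    mem_vanishingIdeal_iff]
  intro v hv
  rw [mem_zeroLocus_iff] at hv
  refine galois_indep (k := ℚ) _ (Module.Basis.ofVectorSpace ℚ K).linearIndependent s'.support
    (fun k => aeval v (s' k)) ?_ k hk
  intro τ
  have hc : ∀ p : MvPolynomial σ ℚ, aeval (fun j => τ.symm (v j)) p = τ.symm (aeval v p) := by
    intro p
    exact (MvPolynomial.comp_aeval_apply (v) (τ.symm : K →ₐ[ℚ] K) p).symm
  have h2 := h1 (fun j => τ.symm (v j)) (by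
    intro p hp
    rw [hc, hv p hp, map_zero])
  rw [hs', Finsupp.sum, map_sum] at h2
  have h3 := congrArg τ h2
  rw [map_sum, map_zero] at h3
  rw [← h3]
  refine Finset.sum_congr rfl fun i _ => ?_
  rw [map_mul, eval_C, map_mul, mul_comm]
  congr 1
  rw [eval_map, ← aeval_def, hc]
  simp

theorem eval_toC {σ : Type*} (x : σ → ℂ) (p : MvPolynomial σ ℚ) :
    eval x (toC p) = aeval x p := by
  rw [toC, eval_map, aeval_def]

theorem vIdeal_VC {n t s : ℕ} (f : Fin s → MvPolynomial (Fin n ⊕ Fin t) ℚ)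
    (h : (Ideal.span (Set.range f)).IsRadical) :
    vIdeal (VC f) = Ideal.span (Set.range fun i => toC (f i)) := by
  apply le_antisymm
  · intro g hg
    haveI : IsAlgClosure ℚ (algebraicClosure ℚ ℂ) := by
      convert! algebraicClosure.isAlgClosure ℚ ℂ
    have := mem_span_map_of_vanish (K := algebraicClosure ℚ ℂ) _ h g (by
      intro x hx
      refine hg x ?_
      rintro _ ⟨i, rfl⟩
      rw [eval_toC]
      exact hx _ (Ideal.subset_span ⟨i, rfl⟩))
    rw [Ideal.map_span, ← Set.range_comp] at this
    exact this
  · rw [Ideal.span_le]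
    rintro _ ⟨i, rfl⟩ x hx
    exact hx _ ⟨i, rfl⟩

theorem mem_zLocus_range {σ ι : Type*} (g : ι → MvPolynomial σ ℂ) (x : σ → ℂ) :
    x ∈ zLocus (Set.range g) ↔ ∀ j, eval x (g j) = 0 := by
  simp [zLocus]

theorem mem_tangentAt_iff {σ ι : Type*} [Fintype σ] [DecidableEq σ] {V : Set (σ → ℂ)}
    {g : ι → MvPolynomial σ ℂ} (hV : vIdeal V = Ideal.span (Set.range g)) {x : σ → ℂ}
    (hx : ∀ j, eval x (g j) = 0) (v : σ → ℂ) :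
    v ∈ tangentAt V x ↔ ∀ j, polyDiff x (g j) v = 0 := by
  constructor
  · intro h j
    exact h _ (by rw [hV]; exact Ideal.subset_span ⟨j, rfl⟩)
  · intro h p hp
    rw [hV] at hp
    suffices hh : eval x p = 0 ∧ polyDiff x p v = 0 from hh.2
    refine Submodule.span_induction (p := fun p _ => eval x p = 0 ∧ polyDiff x p v = 0)
      ?_ ?_ ?_ ?_ hp
    · rintro _ ⟨j, rfl⟩; exact ⟨hx j, h j⟩
    · simp [polyDiff]
    · rintro p q _ _ ⟨h1, h2⟩ ⟨h3, h4⟩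
      refine ⟨by simp [h1, h3], ?_⟩
      simp only [polyDiff, map_add, mul_add, Finset.sum_add_distrib] at *
      rw [h2, h4, add_zero]
    · rintro a p _ ⟨h1, h2⟩
      refine ⟨by simp [h1], ?_⟩
      simp only [polyDiff, smul_eq_mul, Derivation.leibniz, map_add, map_mul, h1,
        zero_mul, add_zero] at *
      rw [show (0:ℂ) = eval x a * ∑ j, v j * eval x (pderiv j p) by rw [h2, mul_zero],
        Finset.mul_sum]
      exact Finset.sum_congr rfl fun j _ => by ring


theorem isDomain_of_regular : ∀ (r : ℕ) (O : Type) [CommRing O] [IsLocalRing O]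
    [IsNoetherianRing O] (a : Fin r → O)
    (_ : Ideal.span (Set.range a) = IsLocalRing.maximalIdeal O)
    (_ : (r : WithBot ℕ∞) ≤ ringKrullDim O), IsDomain O := by
  intro r
  induction r with
  | zero =>
    intro O _ _ _ a ha hd
    have hm : IsLocalRing.maximalIdeal O = ⊥ := by
      rw [← ha]; simp
    have := (IsLocalRing.isField_iff_maximalIdeal_eq (R := O)).2 hm
    exact this.isDomain
  | succ r ih =>
    intro O _ _ _ a ha hd
    set m := IsLocalRing.maximalIdeal O with hmdef
    have hfin := minimalPrimes.finite_of_isNoetherianRing O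
    have hmnot : m ∉ minimalPrimes O := by
      intro h
      have h0 : m.height = 0 := Ideal.height_eq_zero_iff.2 h
      have h1 := IsLocalRing.maximalIdeal_height_eq_ringKrullDim (R := O)
      rw [← hmdef, h0] at h1
      rw [← h1] at hd
      norm_cast at hd
    have hx : ∃ x ∈ m, x ∉ m ^ 2 ∧ ∀ q ∈ minimalPrimes O, x ∉ q := by
      by_contra hcon
      push Not at hcon
      have h1 : (m : Set O) ⊆ ⋃ i ∈ (insert (m ^ 2) (minimalPrimes O)), ((id i : Ideal O) : Set O) := by
        intro x hx
        by_cases hx2 : x ∈ m ^ 2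
        · exact Set.mem_biUnion (Set.mem_insert _ _) hx2
        · obtain ⟨q, hq, hxq⟩ := hcon x hx hx2
          exact Set.mem_biUnion (Set.mem_insert_of_mem _ hq) hxq
      rw [Ideal.subset_union_prime_finite (hfin.insert _) (m ^ 2) (m ^ 2)] at h1
      · obtain ⟨i, hi, hmi⟩ := h1
        rcases hi with rfl | hi
        · have : m = ⊥ := by
            apply Submodule.eq_bot_of_le_smul_of_le_jacobson_bot m m (IsNoetherian.noetherian _)
            · rw [smul_eq_mul, ← pow_two]; exact hmi
            · rw [IsLocalRing.jacobson_eq_maximalIdeal _ bot_ne_top]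
          apply hmnot
          obtain ⟨q, hq⟩ := (Ideal.nonempty_minimalPrimes (I := (⊥ : Ideal O)) bot_ne_top)
          have hqm : q ≤ m := IsLocalRing.le_maximalIdeal hq.1.1.ne_top
          have : q = m := le_antisymm hqm (this ▸ bot_le)
          exact this ▸ hq
        · apply hmnot
          have hi' := hi.1.1
          have : i = m := le_antisymm (IsLocalRing.le_maximalIdeal hi'.ne_top) hmi
          exact this ▸ hi
      · rintro i (rfl | hi) h2 _
        · exact absurd rfl h2
        · exact hi.1.1
    obtain ⟨x, hxm, hxm2, hxq⟩ := hx
    have hxs : x ∈ Ideal.span (Set.range a) := ha ▸ hxm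
    obtain ⟨c, hc⟩ := (Ideal.mem_span_range_iff_exists_fun).1 hxs
    have ham : ∀ i, a i ∈ m := fun i => ha ▸ Ideal.subset_span ⟨i, rfl⟩
    obtain ⟨i0, hi0⟩ : ∃ i, IsUnit (c i) := by
      by_contra hcon
      push Not at hcon
      apply hxm2
      rw [← hc, pow_two]
      exact Ideal.sum_mem _ fun i _ => Ideal.mul_mem_mul ((IsLocalRing.mem_maximalIdeal _).2 (hcon i)) (ham i)
    set I : Ideal O := Ideal.span {x} with hI
    have hIm : I ≤ m := by rw [hI, Ideal.span_singleton_le_iff_mem]; exact hxm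
    have hInt : I ≠ ⊤ := fun h => (IsLocalRing.maximalIdeal.isMaximal O).ne_top (top_le_iff.1 (h ▸ hIm))
    haveI : Nontrivial (O ⧸ I) := Ideal.Quotient.nontrivial_iff.2 hInt
    haveI : IsLocalRing (O ⧸ I) := IsLocalRing.of_surjective' (Ideal.Quotient.mk I) Ideal.Quotient.mk_surjective
    have hdom : IsDomain (O ⧸ I) := by
      refine ih (O ⧸ I) (fun j => Ideal.Quotient.mk I (a (i0.succAbove j))) ?_ ?_
      · apply le_antisymm
        · rw [Ideal.span_le]
          rintro _ ⟨j, rfl⟩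
          rw [SetLike.mem_coe, IsLocalRing.mem_maximalIdeal, mem_nonunits_iff]
          intro hu
          have h1 : Ideal.map (Ideal.Quotient.mk I) m = ⊤ :=
            Ideal.eq_top_of_isUnit_mem _ (Ideal.mem_map_of_mem _ (ham _)) hu
          have h2 : (⊤ : Ideal O) ≤ m := by
            have := congrArg (Ideal.comap (Ideal.Quotient.mk I)) h1
            rw [Ideal.comap_map_of_surjective _ Ideal.Quotient.mk_surjective, Ideal.comap_top] at this
            rw [← this]
            refine sup_le le_rfl ?_
            rw [← RingHom.ker_eq_comap_bot, Ideal.mk_ker]; exact hIm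
          exact (IsLocalRing.maximalIdeal.isMaximal O).ne_top (top_le_iff.1 h2)
        · intro y hy
          obtain ⟨z, rfl⟩ := Ideal.Quotient.mk_surjective y
          have hz : z ∈ m := by
            rw [IsLocalRing.mem_maximalIdeal, mem_nonunits_iff] at hy ⊢
            exact fun h => hy (h.map _)
          rw [← ha] at hz
          have h1 := Ideal.mem_map_of_mem (Ideal.Quotient.mk I) hz
          rw [Ideal.map_span] at h1
          refine (Ideal.span_le.2 ?_) h1
          rintro _ ⟨_, ⟨i, rfl⟩, rfl⟩
          rcases Fin.eq_self_or_eq_succAbove i0 i with rfl | ⟨j, rfl⟩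
          · have h2 : Ideal.Quotient.mk I x = 0 := Ideal.Quotient.eq_zero_iff_mem.2 (Ideal.subset_span rfl)
            rw [← hc, Fin.sum_univ_succAbove _ i, map_add, map_mul, map_sum] at h2
            have hu := hi0.map (Ideal.Quotient.mk I)
            have h3 : Ideal.Quotient.mk I (c i) * Ideal.Quotient.mk I (a i) ∈ Ideal.span (Set.range fun j => Ideal.Quotient.mk I (a (i.succAbove j))) := by
              rw [eq_neg_of_add_eq_zero_left h2]
              refine Ideal.neg_mem_iff _ |>.2 (Ideal.sum_mem _ fun j _ => ?_)
              rw [map_mul]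
              exact Ideal.mul_mem_left _ _ (Ideal.subset_span ⟨j, rfl⟩)
            exact (Ideal.unit_mul_mem_iff_mem _ hu).1 h3
          · exact Ideal.subset_span ⟨j, rfl⟩
      · have h1 := ringKrullDim_le_ringKrullDim_quotient_add_encard ({x} : Set O) (by
          rw [IsLocalRing.ringJacobson_eq_maximalIdeal]
          rintro z rfl; exact hxm)
        rw [Set.encard_singleton] at h1
        have h2 := hd.trans h1
        push_cast at h2
        have h3 : ringKrullDim (O ⧸ I) ≠ ⊥ := ringKrullDim_ne_bot
        change (r : WithBot ℕ∞) + 1 ≤ ringKrullDim (O ⧸ I) + 1 at h2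
        revert h2 h3
        generalize ringKrullDim (O ⧸ I) = D
        intro h3 h2
        induction D with
        | bot => exact absurd rfl h3
        | coe D =>
          norm_cast at h2 ⊢
          exact (ENat.add_le_add_iff_right ENat.one_ne_top).1 h2
    have hIp : I.IsPrime := (Ideal.Quotient.isDomain_iff_prime I).1 hdom
    obtain ⟨q, hq, hqI⟩ := Ideal.exists_minimalPrimes_le (I := (⊥ : Ideal O)) (J := I) bot_le
    have hqp := hq.1.1
    have hxq' : x ∉ q := hxq q hq
    have hq0 : q = ⊥ := by
      apply Submodule.eq_bot_of_le_smul_of_le_jacobson_bot m q (IsNoetherian.noetherian _)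
      · intro z hz
        obtain ⟨w, hw⟩ := Ideal.mem_span_singleton'.1 (hqI hz)
        rw [← hw] at hz ⊢
        have := (hqp.mem_or_mem hz).resolve_right hxq'
        rw [smul_eq_mul, mul_comm w]
        exact Ideal.mul_mem_mul hxm this
      · rw [IsLocalRing.jacobson_eq_maximalIdeal _ bot_ne_top]
    rw [hq0] at hqp
    exact (IsDomain.of_bot_isPrime O)


/-- maximal ideal of a point -/
def mPt {σ : Type} (p : σ → ℂ) : Ideal (MvPolynomial σ ℂ) := RingHom.ker (eval p)

theorem mem_mPt {σ : Type} (p : σ → ℂ) (g : MvPolynomial σ ℂ) : g ∈ mPt p ↔ eval p g = 0 :=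
  RingHom.mem_ker

instance mPt_max {σ : Type} (p : σ → ℂ) : (mPt p).IsMaximal :=
  RingHom.ker_isMaximal_of_surjective _ (fun c => ⟨C c, by simp⟩)

theorem mPt_eq_span {σ : Type} (p : σ → ℂ) :
    mPt p = Ideal.span (Set.range fun j => (X j - C (p j) : MvPolynomial σ ℂ)) := by
  apply le_antisymm
  · have key : ∀ g : MvPolynomial σ ℂ, g - C (eval p g) ∈
        Ideal.span (Set.range fun j => (X j - C (p j) : MvPolynomial σ ℂ)) := by
      intro g
      induction g using MvPolynomial.induction_on with
      | C a => simp
      | add g h hg hh =>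
        have := Ideal.add_mem _ hg hh
        convert! this using 1
        simp only [map_add]; ring
      | mul_X g j hg =>
        have h1 := Ideal.mul_mem_left _ (X j) hg
        have h2 := Ideal.mul_mem_left _ (C (eval p g)) (Ideal.subset_span (Set.mem_range_self (f := fun j => (X j - C (p j) : MvPolynomial σ ℂ)) j))
        convert! Ideal.add_mem _ h1 h2 using 1
        simp only [map_mul, eval_X]; ring
    intro g hg
    have := key g
    rw [(mem_mPt p g).1 hg] at this
    simpa using this
  · rw [Ideal.span_le]
    rintro _ ⟨j, rfl⟩
    rw [SetLike.mem_coe, mem_mPt]; simp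

theorem X_sub_mem {σ : Type} (p : σ → ℂ) (j : σ) : (X j - C (p j) : MvPolynomial σ ℂ) ∈ mPt p := by
  rw [mem_mPt]; simp

theorem taylor_mem {σ : Type} [Fintype σ] [DecidableEq σ] (p : σ → ℂ) (g : MvPolynomial σ ℂ) :
    g - C (eval p g) - ∑ j, C (eval p (pderiv j g)) * (X j - C (p j)) ∈ mPt p * mPt p := by
  induction g using MvPolynomial.induction_on with
  | C a => simp
  | add g h hg hh =>
    convert! Ideal.add_mem _ hg hh using 1
    simp only [map_add, add_mul, Finset.sum_add_distrib]; ring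
  | mul_X g i hg =>
    have h1 := Ideal.mul_mem_left _ (X i) hg
    have h2 : ∑ j, C (eval p (pderiv j g)) * ((X j - C (p j)) * (X i - C (p i))) ∈ mPt p * mPt p :=
      Ideal.sum_mem _ fun j _ => Ideal.mul_mem_left _ _
        (Ideal.mul_mem_mul (X_sub_mem p j) (X_sub_mem p i))
    have h3 := Ideal.add_mem _ h1 h2
    have e1 : ∀ j, C (eval p (pderiv j (g * X i))) * (X j - C (p j) : MvPolynomial σ ℂ)
        = C (p i) * (C (eval p (pderiv j g)) * (X j - C (p j))) + (if j = i then C (eval p g) * (X i - C (p i)) else 0) := by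
      intro j
      rw [Derivation.leibniz]
      by_cases h : j = i
      · subst h; simp [pderiv_X_self]; ring
      · simp [pderiv_X_of_ne (Ne.symm h), h]; ring
    have e2 : ∀ j, C (eval p (pderiv j g)) * ((X j - C (p j)) * (X i - C (p i)) : MvPolynomial σ ℂ) =
      (X i - C (p i)) * (C (eval p (pderiv j g)) * (X j - C (p j))) := fun j => by ring
    have e3 : g * X i - C (eval p (g * X i)) - ∑ j, C (eval p (pderiv j (g * X i))) * (X j - C (p j)) =
      X i * (g - C (eval p g) - ∑ j, C (eval p (pderiv j g)) * (X j - C (p j))) +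
        ∑ j, C (eval p (pderiv j g)) * ((X j - C (p j)) * (X i - C (p i))) := by
      rw [Finset.sum_congr rfl fun j _ => e1 j, Finset.sum_congr rfl fun j _ => e2 j,
        Finset.sum_add_distrib, ← Finset.mul_sum, ← Finset.mul_sum]
      simp only [Finset.sum_ite_eq', Finset.mem_univ, if_true, map_mul, eval_X]
      ring
    rw [e3]; exact h3

theorem height_mPt {σ : Type} [Finite σ] (p : σ → ℂ) : ((mPt p).height : WithBot ℕ∞) = (Nat.card σ : WithBot ℕ∞) := by
  have hfin : FiniteRingKrullDim (MvPolynomial σ ℂ) := by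
    rw [finiteRingKrullDim_iff_ne_bot_and_top, dim_mvPoly]
    exact ⟨by exact WithBot.coe_ne_bot, by
      intro h
      have : ((Nat.card σ : ℕ∞) : WithBot ℕ∞) = ((⊤ : ℕ∞) : WithBot ℕ∞) := h
      exact ENat.natCast_ne_top _ (WithBot.coe_injective this)⟩
  obtain ⟨M, hM, hMh⟩ := Ideal.exists_isMaximal_height (R := MvPolynomial σ ℂ)
  rw [dim_mvPoly] at hMh
  obtain ⟨q, hq⟩ := (MvPolynomial.isMaximal_iff_eq_vanishingIdeal_singleton (I := M)).1 hM
  have hMq : M = mPt q := by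
    ext g; rw [hq, mem_mPt, MvPolynomial.mem_vanishingIdeal_iff]; simp [aeval_eq_eval]
  let e : MvPolynomial σ ℂ ≃ₐ[ℂ] MvPolynomial σ ℂ := AlgEquiv.ofAlgHom
    (aeval fun i => X i + C (p i - q i)) (aeval fun i => X i - C (p i - q i))
    (by ext i : 1; simp) (by ext i : 1; simp)
  have he : ∀ g, eval q (e g) = eval p g := by
    intro g
    change eval q (aeval (fun i => X i + C (p i - q i)) g) = eval p g
    induction g using MvPolynomial.induction_on with
    | C a => simp
    | add g h hg hh => rw [map_add, map_add, map_add, hg, hh]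
    | mul_X g i hg => rw [map_mul, map_mul, hg]; simp
  have hc : Ideal.comap e.toRingEquiv (mPt q) = mPt p := by
    ext g; rw [Ideal.mem_comap, mem_mPt, mem_mPt]
    exact Iff.of_eq (congrArg (· = 0) (he g))
  have := RingEquiv.height_comap e.toRingEquiv (mPt q)
  rw [hc] at this
  rw [this, ← hMq, hMh]

theorem mPt_le_sup {σ : Type} [Fintype σ] [DecidableEq σ] {r : ℕ} (p : σ → ℂ)
    (g : Fin r → MvPolynomial σ ℂ) (hg : ∀ a, eval p (g a) = 0) (c : Fin r → σ)
    (hc : (Matrix.of fun a b => eval p (pderiv (c b) (g a))).det ≠ 0) :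
    mPt p ≤ (Ideal.span (Set.range g) ⊔ Ideal.span (Set.range fun j : {j // j ∉ Set.range c} =>
      (X j.1 - C (p j.1) : MvPolynomial σ ℂ))) ⊔ mPt p * mPt p := by
  classical
  set M : Matrix (Fin r) (Fin r) ℂ := Matrix.of fun a b => eval p (pderiv (c b) (g a)) with hM
  set I := (Ideal.span (Set.range g) ⊔ Ideal.span (Set.range fun j : {j // j ∉ Set.range c} =>
      (X j.1 - C (p j.1) : MvPolynomial σ ℂ))) ⊔ mPt p * mPt p with hI
  have hcinj : Function.Injective c := by
    intro b b' hbb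
    by_contra hne
    apply hc
    exact Matrix.det_zero_of_column_eq hne (fun a => by simp [hM, hbb])
  have h1 : ∀ a, ∑ b, C (M a b) * (X (c b) - C (p (c b))) ∈ I := by
    intro a
    have t := taylor_mem p (g a)
    rw [hg a] at t
    have e : ∑ j, C (eval p (pderiv j (g a))) * (X j - C (p j) : MvPolynomial σ ℂ)
        = ∑ b, C (M a b) * (X (c b) - C (p (c b))) +
          ∑ j : {j // j ∉ Set.range c}, C (eval p (pderiv j.1 (g a))) * (X j.1 - C (p j.1)) := by
      rw [← Fintype.sum_subtype_add_sum_subtype (fun j => j ∈ Set.range c)]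
      congr 1
      symm
      exact Finset.sum_bij (fun b _ => ⟨c b, Set.mem_range_self b⟩) (fun b _ => by simp)
        (fun b _ b' _ h => hcinj (congrArg Subtype.val h))
        (by rintro ⟨_, b, rfl⟩ _; exact ⟨b, by simp, rfl⟩) (fun b _ => rfl)
    rw [e] at t
    have t1 : g a ∈ I := (le_sup_left.trans le_sup_left : Ideal.span (Set.range g) ≤ I) (Ideal.subset_span ⟨a, rfl⟩)
    have t2 : ∑ j : {j // j ∉ Set.range c}, C (eval p (pderiv j.1 (g a))) * (X j.1 - C (p j.1)) ∈ I := by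
      refine Ideal.sum_mem _ fun j _ => Ideal.mul_mem_left _ _ ?_
      exact (le_sup_right.trans le_sup_left : Ideal.span (Set.range fun j : {j // j ∉ Set.range c} =>
        (X j.1 - C (p j.1) : MvPolynomial σ ℂ)) ≤ I) (Ideal.subset_span ⟨j, rfl⟩)
    have t3 := (le_sup_right : mPt p * mPt p ≤ I) t
    have t4 := I.sub_mem (I.sub_mem t1 t2) t3
    convert! t4 using 1
    simp only [map_zero]; ring
  rw [mPt_eq_span, Ideal.span_le]
  rintro _ ⟨j, rfl⟩
  by_cases hj : j ∈ Set.range c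
  · obtain ⟨b, rfl⟩ := hj
    have hinv : M⁻¹ * M = 1 := Matrix.nonsing_inv_mul _ (isUnit_iff_ne_zero.2 hc)
    have h2 : ∑ a, C (M⁻¹ b a) * ∑ b', C (M a b') * (X (c b') - C (p (c b'))) = (X (c b) - C (p (c b)) : MvPolynomial σ ℂ) := by
      simp_rw [Finset.mul_sum]
      rw [Finset.sum_comm]
      have h3 : ∀ b', ∑ a, C (M⁻¹ b a) * (C (M a b') * (X (c b') - C (p (c b')) : MvPolynomial σ ℂ)) =
          C ((1 : Matrix (Fin r) (Fin r) ℂ) b b') * (X (c b') - C (p (c b'))) := by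
        intro b'
        rw [← hinv, Matrix.mul_apply, map_sum, Finset.sum_mul]
        exact Finset.sum_congr rfl fun a _ => by rw [map_mul]; ring
      rw [Finset.sum_congr rfl fun b' _ => h3 b']
      rw [Finset.sum_eq_single b]
      · simp
      · intro b' _ hb; simp [Matrix.one_apply_ne (Ne.symm hb)]
      · simp
    change (X (c b) - C (p (c b)) : MvPolynomial σ ℂ) ∈ I
    rw [← h2]
    exact Ideal.sum_mem _ fun a _ => Ideal.mul_mem_left _ _ (h1 a)
  · exact (le_sup_right.trans le_sup_left : Ideal.span (Set.range fun j : {j // j ∉ Set.range c} =>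
        (X j.1 - C (p j.1) : MvPolynomial σ ℂ)) ≤ I) (Ideal.subset_span ⟨⟨j, hj⟩, rfl⟩)

theorem exists_local_prime {σ : Type} [Fintype σ] [DecidableEq σ] {r : ℕ} (p : σ → ℂ)
    (g : Fin r → MvPolynomial σ ℂ) (hg : ∀ a, eval p (g a) = 0)
    (hind : LinearIndependent ℂ (fun a j => eval p (pderiv j (g a)))) :
    ∃ Q : Ideal (MvPolynomial σ ℂ), Q.IsPrime ∧ (∀ h ∈ Q, eval p h = 0) ∧ (∀ a, g a ∈ Q) ∧
      (∀ h ∈ Q, ∃ b, eval p b ≠ 0 ∧ b * h ∈ Ideal.span (Set.range g)) ∧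
      ∃ k : ℕ, ringKrullDim (MvPolynomial σ ℂ ⧸ Q) = (k : WithBot ℕ∞) ∧ k + r = Fintype.card σ := by
  classical
  obtain ⟨c, hc⟩ := exists_minor _ hind
  have hcinj : Function.Injective c := by
    intro b b' hbb
    by_contra hne
    apply hc
    exact Matrix.det_zero_of_column_eq hne (fun a => by simp [hbb])
  let R := MvPolynomial σ ℂ
  let m := mPt p
  let O := Localization.AtPrime m
  let al : R →+* O := algebraMap R O
  let J : Ideal O := Ideal.map al (Ideal.span (Set.range g))
  let K : Ideal R := Ideal.span (Set.range fun j : {j // j ∉ Set.range c} =>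
      (X j.1 - C (p j.1) : MvPolynomial σ ℂ))
  have hgm : Ideal.span (Set.range g) ≤ m := by
    rw [Ideal.span_le]; rintro _ ⟨a, rfl⟩; exact (mem_mPt _ _).2 (hg a)
  have hKm : K ≤ m := by
    rw [Ideal.span_le]; rintro _ ⟨a, rfl⟩; exact X_sub_mem _ _
  have hmO : Ideal.map al m = IsLocalRing.maximalIdeal O := Localization.AtPrime.map_eq_maximalIdeal
  have hJK : J ⊔ Ideal.map al K = IsLocalRing.maximalIdeal O := by
    apply le_antisymm
    · rw [← hmO]; exact sup_le (Ideal.map_mono hgm) (Ideal.map_mono hKm)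
    · have h1 := Ideal.map_mono (f := al) (mPt_le_sup p g hg c hc)
      rw [Ideal.map_sup, Ideal.map_sup, Ideal.map_mul] at h1
      change Ideal.map al m ≤ (J ⊔ Ideal.map al K) ⊔ Ideal.map al m * Ideal.map al m at h1
      rw [hmO] at h1
      refine Submodule.le_of_le_smul_of_le_jacobson_bot (I := IsLocalRing.maximalIdeal O) (IsNoetherian.noetherian _) ?_ h1
      rw [IsLocalRing.jacobson_eq_maximalIdeal _ bot_ne_top]
  have hJm : J ≤ IsLocalRing.maximalIdeal O := hJK ▸ le_sup_left
  have hJt : J ≠ ⊤ := fun h => (IsLocalRing.maximalIdeal.isMaximal O).ne_top (top_le_iff.1 (h ▸ hJm))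
  haveI : Nontrivial (O ⧸ J) := Ideal.Quotient.nontrivial_iff.2 hJt
  haveI : IsLocalRing (O ⧸ J) := IsLocalRing.of_surjective' (Ideal.Quotient.mk J) Ideal.Quotient.mk_surjective
  have hmax : IsLocalRing.maximalIdeal (O ⧸ J) = Ideal.map (Ideal.Quotient.mk J) (Ideal.map al K) := by
    have h2 : Ideal.map (Ideal.Quotient.mk J) (IsLocalRing.maximalIdeal O) = Ideal.map (Ideal.Quotient.mk J) (Ideal.map al K) := by
      rw [← hJK, Ideal.map_sup, Ideal.map_quotient_self, bot_sup_eq]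
    rw [← h2]
    rcases Ideal.map_eq_top_or_isMaximal_of_surjective (Ideal.Quotient.mk J) Ideal.Quotient.mk_surjective
      (IsLocalRing.maximalIdeal.isMaximal O) with h | h
    · exfalso
      have := congrArg (Ideal.comap (Ideal.Quotient.mk J)) h
      rw [Ideal.comap_map_of_surjective _ Ideal.Quotient.mk_surjective, Ideal.comap_top,
        ← RingHom.ker_eq_comap_bot, Ideal.mk_ker, sup_eq_left.2 hJm] at this
      exact (IsLocalRing.maximalIdeal.isMaximal O).ne_top this
    · exact (IsLocalRing.eq_maximalIdeal h).symm
  have hcardκ : Fintype.card {j // j ∉ Set.range c} + r = Fintype.card σ := by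
    have h1 := Fintype.card_subtype_compl (fun j => j ∈ Set.range c)
    have h2 : Fintype.card {j // j ∈ Set.range c} = r := by
      rw [← Fintype.card_congr (Equiv.ofInjective c hcinj)]; simp
    have h3 := Fintype.card_subtype_le (fun j => j ∈ Set.range c)
    rw [h1]
    omega
  have hdimO : ringKrullDim O = (Fintype.card σ : WithBot ℕ∞) := by
    rw [IsLocalization.AtPrime.ringKrullDim_eq_height m O, height_mPt, Nat.card_eq_fintype_card]
  have hdim : (Fintype.card {j // j ∉ Set.range c} : WithBot ℕ∞) ≤ ringKrullDim (O ⧸ J) := by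
    have h1 := ringKrullDim_le_ringKrullDim_quotient_add_encard (al '' Set.range g) (by
      rw [IsLocalRing.ringJacobson_eq_maximalIdeal]
      exact Set.Subset.trans (by rw [← Ideal.span_le, ← Ideal.map_span]) hJm)
    have h2 : (al '' Set.range g).encard ≤ r := by
      refine (Set.encard_image_le _ _).trans ?_
      rw [← Set.image_univ]
      refine (Set.encard_image_le _ _).trans ?_
      simp
    have h3 : Ideal.span (al '' Set.range g) = J := (Ideal.map_span _ _).symm
    rw [h3, hdimO, ← hcardκ] at h1
    have h4 := h1.trans (add_le_add_right (WithBot.coe_le_coe.2 h2) _)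
    have h5 : ringKrullDim (O ⧸ J) ≠ ⊥ := by
      have h6 : (0 : WithBot ℕ∞) ≤ ringKrullDim (O ⧸ J) := ringKrullDim_nonneg_of_nontrivial
      intro h7; rw [h7] at h6; exact absurd h6 (by simp)
    revert h4 h5
    generalize ringKrullDim (O ⧸ J) = D
    intro h5 h4
    induction D with
    | bot => exact absurd rfl h4
    | coe D =>
      norm_cast at h5 ⊢
      exact (ENat.add_le_add_iff_right (ENat.natCast_ne_top r)).1 h5
  have hdom : IsDomain (O ⧸ J) := by
    let e := Fintype.equivFin {j // j ∉ Set.range c}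
    refine isDomain_of_regular _ (O ⧸ J) (fun a => Ideal.Quotient.mk J (al (X (e.symm a).1 - C (p (e.symm a).1)))) ?_ hdim
    rw [hmax, Ideal.map_span, Ideal.map_span]
    congr 1
    ext z
    constructor
    · rintro ⟨a, rfl⟩
      exact ⟨_, ⟨_, ⟨e.symm a, rfl⟩, rfl⟩, rfl⟩
    · rintro ⟨_, ⟨_, ⟨j, rfl⟩, rfl⟩, rfl⟩
      exact ⟨e j, by simp⟩
  have hJp : J.IsPrime := (Ideal.Quotient.isDomain_iff_prime J).1 hdom
  let Q : Ideal R := J.comap al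
  have hQp : Q.IsPrime := Ideal.IsPrime.comap al
  have hQm : Q ≤ m := by
    have h1 : Q ≤ (IsLocalRing.maximalIdeal O).comap al := Ideal.comap_mono hJm
    have h2 : (IsLocalRing.maximalIdeal O).comap al = m := Localization.AtPrime.under_maximalIdeal
    exact h2 ▸ h1
  refine ⟨Q, hQp, fun h hh => (mem_mPt _ _).1 (hQm hh), fun a => ?_, fun h hh => ?_, ?_⟩
  · exact Ideal.mem_map_of_mem al (Ideal.subset_span ⟨a, rfl⟩)
  · have h1 : al h ∈ J := hh
    obtain ⟨⟨⟨x, hx⟩, ⟨b, hb⟩⟩, hxb⟩ := (IsLocalization.mem_map_algebraMap_iff m.primeCompl O).1 h1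
    rw [← map_mul, IsLocalization.eq_iff_exists m.primeCompl O] at hxb
    obtain ⟨⟨b', hb'⟩, he⟩ := hxb
    refine ⟨b' * b, ?_, ?_⟩
    · rw [map_mul]
      exact mul_ne_zero (fun h => hb' ((mem_mPt _ _).2 h)) (fun h => hb ((mem_mPt _ _).2 h))
    · have : b' * b * h = b' * x := by
        rw [← he]; simp only; ring
      rw [this]
      exact Ideal.mul_mem_left _ _ hx
  · obtain ⟨k, hk, hk2⟩ := dim_add_le_of_minor Q g (fun a => Ideal.mem_map_of_mem al (Ideal.subset_span ⟨a, rfl⟩)) c (by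
      intro hQ
      have := (mem_mPt _ _).1 (hQm hQ)
      apply hc
      rw [RingHom.map_det] at this
      exact this)
    refine ⟨k, hk, ?_⟩
    rw [Fintype.card_fin] at hk2
    have h1 : ringKrullDim (O ⧸ J) ≤ ringKrullDim (R ⧸ Q) := by
      let φ : R ⧸ Q →+* O ⧸ J := Ideal.quotientMap J al le_rfl
      let ψ : PrimeSpectrum (O ⧸ J) → PrimeSpectrum (R ⧸ Q) := PrimeSpectrum.comap φ
      have hinj : Function.Injective ψ := by
        have h3 : (PrimeSpectrum.comap (Ideal.Quotient.mk Q)) ∘ ψ =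
            (PrimeSpectrum.comap al) ∘ (PrimeSpectrum.comap (Ideal.Quotient.mk J)) := by
          funext P
          ext z
          simp [φ, ψ]
        apply Function.Injective.of_comp (f := PrimeSpectrum.comap (Ideal.Quotient.mk Q))
        rw [h3]
        exact (PrimeSpectrum.localization_comap_injective O m.primeCompl).comp
          (PrimeSpectrum.comap_injective_of_surjective _ Ideal.Quotient.mk_surjective)
      exact Order.krullDim_le_of_strictMono ψ
        (Monotone.strictMono_of_injective (fun a b hab => Ideal.comap_mono hab) hinj)
    have h2 := hdim.trans h1
    change ringKrullDim (R ⧸ Q) = _ at hk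
    rw [hk] at h2
    have h4 : Fintype.card {j // j ∉ Set.range c} ≤ k := by exact_mod_cast h2
    omega


/-- x-gradient -/
def gx {n t s : ℕ} (F : Fin s → MvPolynomial (Fin n ⊕ Fin t) ℂ) (z : Fin n ⊕ Fin t → ℂ) (j : Fin s) :
    Fin n → ℂ := fun k => eval z (pderiv (Sum.inl k) (F j))

/-- rank condition at all points of the fiber -/
def RankCond {n t s : ℕ} (F : Fin s → MvPolynomial (Fin n ⊕ Fin t) ℂ) (d : ℕ) (η : Fin t → ℂ) : Prop :=
  ∀ x : Fin n → ℂ, (∀ j, eval (Sum.elim x η) (F j) = 0) →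
    Module.finrank ℂ (Submodule.span ℂ (Set.range (gx F (Sum.elim x η)))) + d = n

theorem eq_of_le_of_dim {R : Type*} [CommRing R] [IsNoetherianRing R] {Q P : Ideal R} [Q.IsPrime] [P.IsPrime]
    (h : Q ≤ P) (m : ℕ) (h1 : ringKrullDim (R ⧸ Q) ≤ (m : WithBot ℕ∞))
    (h2 : (m : WithBot ℕ∞) ≤ ringKrullDim (R ⧸ P)) : Q = P := by
  by_contra hne
  obtain ⟨x, hxP, hxQ⟩ := SetLike.exists_of_lt (lt_of_le_of_ne h hne)
  have hx0 : Ideal.Quotient.mk Q x ∈ nonZeroDivisors (R ⧸ Q) := by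
    rw [mem_nonZeroDivisors_iff_ne_zero]
    exact fun h => hxQ (Ideal.Quotient.eq_zero_iff_mem.1 h)
  have h3 := ringKrullDim_quotient_succ_le_of_nonZeroDivisor hx0
  have h4 : ringKrullDim (R ⧸ P) ≤ ringKrullDim ((R ⧸ Q) ⧸ Ideal.span {Ideal.Quotient.mk Q x}) := by
    let φ : (R ⧸ Q) ⧸ Ideal.span {Ideal.Quotient.mk Q x} →+* R ⧸ P :=
      Ideal.Quotient.lift _ (Ideal.Quotient.factor h) (by
        intro a ha
        rw [Ideal.mem_span_singleton'] at ha
        obtain ⟨b, rfl⟩ := ha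
        rw [map_mul, Ideal.Quotient.factor_mk, Ideal.Quotient.eq_zero_iff_mem.2 hxP, mul_zero])
    apply ringKrullDim_le_of_surjective φ
    apply Ideal.Quotient.lift_surjective_of_surjective
    exact Ideal.Quotient.factor_surjective h
  have h5 := (add_le_add_left (h2.trans h4) 1).trans (h3.trans h1)
  have : m + 1 ≤ m := by exact_mod_cast h5
  omega

theorem finrank_ker_add' {ι : Type*} [Fintype ι] {σ : Type*} [Fintype σ] [DecidableEq σ] (g : ι → σ → ℂ) (T : Submodule ℂ (σ → ℂ))
    (hT : ∀ v, v ∈ T ↔ ∀ j, ∑ k, v k * g j k = 0) :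
    Module.finrank ℂ T + Module.finrank ℂ (Submodule.span ℂ (Set.range g)) = Fintype.card σ := by
  let G : Matrix ι (σ) ℂ := Matrix.of g
  have h1 := LinearMap.finrank_range_add_finrank_ker G.mulVecLin
  have h2 : LinearMap.ker G.mulVecLin = T := by
    ext v
    rw [hT, LinearMap.mem_ker, Matrix.mulVecLin_apply, funext_iff]
    refine forall_congr' fun j => ?_
    simp [Matrix.mulVec, dotProduct, G, mul_comm]
  have h3 : Module.finrank ℂ (LinearMap.range G.mulVecLin) = Module.finrank ℂ (Submodule.span ℂ (Set.range g)) := by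
    have := Matrix.rank_eq_finrank_span_row G
    exact this
  rw [h2, h3] at h1
  simpa [add_comm] using h1

theorem finrank_ker_add {ι : Type*} [Fintype ι] {n : ℕ} (g : ι → Fin n → ℂ) (T : Submodule ℂ (Fin n → ℂ))
    (hT : ∀ v, v ∈ T ↔ ∀ j, ∑ k, v k * g j k = 0) :
    Module.finrank ℂ T + Module.finrank ℂ (Submodule.span ℂ (Set.range g)) = n := by
  simpa using finrank_ker_add' g T hT

theorem exists_indep_rows {ι : Type*} [Finite ι] {V : Type*} [AddCommGroup V] [Module ℂ V] [FiniteDimensional ℂ V] (g : ι → V) (r : ℕ)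
    (h : Module.finrank ℂ (Submodule.span ℂ (Set.range g)) = r) :
    ∃ J : Fin r → ι, LinearIndependent ℂ (fun a => g (J a)) ∧
      Submodule.span ℂ (Set.range fun a => g (J a)) = Submodule.span ℂ (Set.range g) := by
  obtain ⟨κ, a, ha, hsp, hli⟩ := exists_linearIndependent' ℂ g
  haveI : Finite κ := Finite.of_injective a ha
  haveI := Fintype.ofFinite κ
  have hc : Fintype.card κ = r := by
    rw [← h, ← hsp, finrank_span_eq_card hli]
  let e : Fin r ≃ κ := (Fintype.equivFinOfCardEq hc).symm
  refine ⟨a ∘ e, hli.comp e e.injective, ?_⟩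
  rw [← hsp]
  congr 1
  exact Set.range_comp' (f := e) (g := g ∘ a) ▸ by rw [e.range_eq_univ, Set.image_univ]

theorem eval_specY {n t : ℕ} (η : Fin t → ℂ) (x : Fin n → ℂ) (p : MvPolynomial (Fin n ⊕ Fin t) ℂ) :
    eval x (specY η p) = eval (Sum.elim x η) p := by
  unfold specY
  induction p using MvPolynomial.induction_on with
  | C a => simp
  | add p q hp hq => rw [map_add, map_add, map_add, hp, hq]
  | mul_X p i hp => rw [map_mul, map_mul, map_mul, hp]; rcases i with i | i <;> simp

theorem pderiv_specY {n t : ℕ} (η : Fin t → ℂ) (k : Fin n) (p : MvPolynomial (Fin n ⊕ Fin t) ℂ) :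
    pderiv k (specY η p) = specY η (pderiv (Sum.inl k) p) := by
  unfold specY
  induction p using MvPolynomial.induction_on with
  | C a => simp
  | add p q hp hq => rw [map_add, map_add, map_add, map_add, hp, hq]
  | mul_X p i hp =>
    rw [map_mul, Derivation.leibniz, hp, Derivation.leibniz]
    simp only [map_add, smul_eq_mul, map_mul]
    rcases i with i | i
    · simp only [aeval_X, Sum.elim_inl]
      by_cases h : i = k
      · subst h; simp
      · rw [pderiv_X_of_ne h, pderiv_X_of_ne (by simpa using h)]; simp
    · simp only [aeval_X, Sum.elim_inr]
      rw [pderiv_X_of_ne (by simp)]; simp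

theorem specY_span {n t : ℕ} {ι : Type*} (η : Fin t → ℂ) (F : ι → MvPolynomial (Fin n ⊕ Fin t) ℂ) (h)
    (hh : h ∈ Ideal.span (Set.range F)) : specY η h ∈ Ideal.span (Set.range fun j => specY η (F j)) := by
  have := Ideal.mem_map_of_mem (aeval (Sum.elim X (fun l => C (η l))) : MvPolynomial (Fin n ⊕ Fin t) ℂ →ₐ[ℂ] MvPolynomial (Fin n) ℂ) hh
  rw [Ideal.map_span, ← Set.range_comp] at this
  exact this


theorem exists_point {σ : Type} [Finite σ] {I : Ideal (MvPolynomial σ ℂ)} (h : I ≠ ⊤) :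
    ∃ p : σ → ℂ, I ≤ mPt p := by
  obtain ⟨M, hM, hIM⟩ := Ideal.exists_le_maximal I h
  obtain ⟨q, hq⟩ := (MvPolynomial.isMaximal_iff_eq_vanishingIdeal_singleton (I := M)).1 hM
  refine ⟨q, hIM.trans ?_⟩
  intro g hg
  rw [hq, MvPolynomial.mem_vanishingIdeal_iff] at hg
  rw [mem_mPt]
  simpa [aeval_eq_eval] using hg

theorem fiber_local_prime {n t s d : ℕ} (F : Fin s → MvPolynomial (Fin n ⊕ Fin t) ℂ)
    (hE : EquidimIdeal (Ideal.span (Set.range F)) (d + t)) (η : Fin t → ℂ) (hr : RankCond F d η)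
    (p : Fin n → ℂ) (hp : ∀ j, eval (Sum.elim p η) (F j) = 0) :
    ∃ Q : Ideal (MvPolynomial (Fin n) ℂ), Q.IsPrime ∧ (∀ h ∈ Q, eval p h = 0) ∧
      (∀ j, specY η (F j) ∈ Q) ∧
      (∀ h ∈ Q, ∃ b, eval p b ≠ 0 ∧ b * h ∈ Ideal.span (Set.range fun j => specY η (F j))) ∧
      ringKrullDim (MvPolynomial (Fin n) ℂ ⧸ Q) = (d : WithBot ℕ∞) := by
  obtain ⟨r, hrr⟩ : ∃ r, Module.finrank ℂ (Submodule.span ℂ (Set.range (gx F (Sum.elim p η)))) = r := ⟨_, rfl⟩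
  have hrd := hr p hp
  rw [hrr] at hrd
  obtain ⟨J, hJ, -⟩ := exists_indep_rows _ r hrr
  have hJ' : LinearIndependent ℂ (fun a j => eval (Sum.elim p η) (pderiv j (F (J a)))) := by
    let L : (Fin n ⊕ Fin t → ℂ) →ₗ[ℂ] (Fin n → ℂ) := LinearMap.funLeft ℂ ℂ Sum.inl
    exact LinearIndependent.of_comp L hJ
  obtain ⟨Q', hQ'p, hQ'0, hQ'g, hQ'b, k, hk, hkr⟩ := exists_local_prime (Sum.elim p η) (fun a => F (J a))
    (fun a => hp _) hJ'
  have hk' : k = d + t := by simp at hkr; omega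
  subst hk'
  have hle : Ideal.span (Set.range F) ≤ mPt (Sum.elim p η) := by
    rw [Ideal.span_le]; rintro _ ⟨j, rfl⟩; exact (mem_mPt _ _).2 (hp j)
  obtain ⟨P, hP, hPm⟩ := Ideal.exists_minimalPrimes_le hle
  haveI := hP.1.1
  have hPF : Ideal.span (Set.range F) ≤ P := hP.1.2
  have hQP : Q' ≤ P := by
    intro h hh
    obtain ⟨b, hb, hbh⟩ := hQ'b h hh
    have h1 : Ideal.span (Set.range fun a => F (J a)) ≤ P := by
      rw [Ideal.span_le]; rintro _ ⟨j, rfl⟩; exact hPF (Ideal.subset_span ⟨_, rfl⟩)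
    refine (hP.1.1.mem_or_mem (h1 hbh)).resolve_left fun h2 => hb ((mem_mPt _ _).1 (hPm h2))
  have hQeq : Q' = P := by
    refine eq_of_le_of_dim hQP (d + t) hk.le ?_
    rw [hE P hP]; exact le_of_eq (by push_cast; rfl)
  have hJη : LinearIndependent ℂ (fun a j => eval p (pderiv j (specY η (F (J a))))) := by
    convert! hJ using 1
    funext a j
    rw [pderiv_specY, eval_specY]; rfl
  obtain ⟨Q, hQp, hQ0, hQg, hQb, k, hk2, hkr⟩ := exists_local_prime p (fun a => specY η (F (J a)))
    (fun a => by rw [eval_specY]; exact hp _) hJη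
  have hk' : k = d := by simp at hkr; omega
  subst hk'
  refine ⟨Q, hQp, hQ0, fun l => ?_, fun h hh => ?_, hk2⟩
  · obtain ⟨b, hb, hbF⟩ := hQ'b (F l) (hQeq ▸ hPF (Ideal.subset_span ⟨_, rfl⟩))
    have h1 := specY_span η _ _ hbF
    have h2 : specY η (b * F l) ∈ Q := (Ideal.span_le.2 (by rintro _ ⟨a, rfl⟩; exact hQg a)) h1
    have h3 : specY η (b * F l) = specY η b * specY η (F l) := map_mul _ _ _
    rw [h3] at h2
    refine (hQp.mem_or_mem h2).resolve_left fun h4 => hb ?_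
    rw [← eval_specY]; exact hQ0 _ h4
  · obtain ⟨b, hb, hbF⟩ := hQb h hh
    refine ⟨b, hb, (Ideal.span_le.2 ?_) hbF⟩
    rintro _ ⟨a, rfl⟩
    exact Ideal.subset_span ⟨J a, rfl⟩

theorem vIdeal_zLocus_of_radical {σ ι : Type*} [Finite σ] (g : ι → MvPolynomial σ ℂ)
    (h : (Ideal.span (Set.range g)).IsRadical) :
    vIdeal (zLocus (Set.range g)) = Ideal.span (Set.range g) := by
  have h1 := MvPolynomial.vanishingIdeal_zeroLocus_eq_radical (k := ℂ) (K := ℂ) (Ideal.span (Set.range g))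
  rw [h.radical] at h1
  rw [← h1]
  ext q
  rw [MvPolynomial.mem_vanishingIdeal_iff]
  have h2 : ∀ x, x ∈ zeroLocus ℂ (Ideal.span (Set.range g)) ↔ x ∈ zLocus (Set.range g) := by
    intro x
    rw [mem_zLocus_range, MvPolynomial.mem_zeroLocus_iff]
    constructor
    · intro h j; simpa [aeval_eq_eval] using h _ (Ideal.subset_span ⟨j, rfl⟩)
    · intro h q hq
      have : Ideal.span (Set.range g) ≤ RingHom.ker (eval x) := by
        rw [Ideal.span_le]; rintro _ ⟨j, rfl⟩; exact h j
      simpa [aeval_eq_eval] using this hq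
  constructor
  · intro hq x hx; simpa [aeval_eq_eval] using hq x ((h2 x).1 hx)
  · intro hq x hx; simpa [aeval_eq_eval] using hq x ((h2 x).2 hx)

theorem fiber_radical {n t s d : ℕ} (F : Fin s → MvPolynomial (Fin n ⊕ Fin t) ℂ)
    (hE : EquidimIdeal (Ideal.span (Set.range F)) (d + t)) (η : Fin t → ℂ) (hr : RankCond F d η) :
    (Ideal.span (Set.range fun j => specY η (F j))).IsRadical := by
  set I := Ideal.span (Set.range fun j => specY η (F j)) with hI
  rintro h ⟨k, hk⟩
  by_contra hcon
  let Cn : Ideal (MvPolynomial (Fin n) ℂ) := Submodule.comap (LinearMap.toSpanSingleton _ _ h) I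
  have hmem : ∀ b, b ∈ Cn ↔ b * h ∈ I := fun b => by
    change (LinearMap.toSpanSingleton _ _ h) b ∈ I ↔ _
    rw [LinearMap.toSpanSingleton_apply, smul_eq_mul]
  have hC : Cn ≠ ⊤ := by
    intro hC
    have := (hmem 1).1 (hC ▸ Submodule.mem_top)
    rw [one_mul] at this
    exact hcon this
  obtain ⟨p, hp⟩ := exists_point hC
  have hpV : ∀ j, eval (Sum.elim p η) (F j) = 0 := by
    intro j
    rw [← eval_specY, ← mem_mPt]
    apply hp
    rw [hmem]
    exact Ideal.mul_mem_right _ _ (Ideal.subset_span ⟨j, rfl⟩)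
  obtain ⟨Q, hQp, hQ0, hQg, hQb, -⟩ := fiber_local_prime F hE η hr p hpV
  have h1 : h ^ k ∈ Q := (Ideal.span_le.2 (by rintro _ ⟨a, rfl⟩; exact hQg a) : I ≤ Q) hk
  obtain ⟨b, hb, hbh⟩ := hQb h (hQp.mem_of_pow_mem _ h1)
  exact hb ((mem_mPt _ _).1 (hp ((hmem b).2 hbh)))

theorem goodSpec_of_rank {n t s d : ℕ} (F : Fin s → MvPolynomial (Fin n ⊕ Fin t) ℂ)
    (hE : EquidimIdeal (Ideal.span (Set.range F)) (d + t)) (η : Fin t → ℂ) (hr : RankCond F d η) :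
    GoodSpec (fun j => specY η (F j)) d := by
  have hrad := fiber_radical F hE η hr
  refine ⟨hrad, Or.inr ⟨?_, ?_⟩⟩
  · intro P hP
    have hPp := hP.1.1
    obtain ⟨p, hp⟩ := exists_point hPp.ne_top
    have hpV : ∀ j, eval (Sum.elim p η) (F j) = 0 := by
      intro j
      rw [← eval_specY, ← mem_mPt]
      exact hp (hP.1.2 (Ideal.subset_span ⟨j, rfl⟩))
    obtain ⟨Q, hQp, hQ0, hQg, hQb, hd⟩ := fiber_local_prime F hE η hr p hpV
    have h1 : Q ≤ P := by
      intro h hh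
      obtain ⟨b, hb, hbh⟩ := hQb h hh
      exact (hPp.mem_or_mem (hP.1.2 hbh)).resolve_left fun h2 => hb ((mem_mPt _ _).1 (hp h2))
    have h2 : Q = P := le_antisymm h1 (hP.2 ⟨hQp, Ideal.span_le.2 (by rintro _ ⟨a, rfl⟩; exact hQg a)⟩ h1)
    rw [← h2, hd]; rfl
  · rw [Set.eq_empty_iff_forall_notMem]
    rintro p ⟨hpV, hp2⟩
    apply hp2
    rw [mem_zLocus_range] at hpV
    have h1 := finrank_ker_add (gx F (Sum.elim p η)) (tangentAt (zLocus (Set.range fun j => specY η (F j))) p) (by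
      intro v
      rw [mem_tangentAt_iff (vIdeal_zLocus_of_radical _ hrad) hpV]
      refine forall_congr' fun j => ?_
      simp only [polyDiff, pderiv_specY, eval_specY, gx])
    have h2 := hr p (fun j => by rw [← eval_specY]; exact hpV j)
    omega


set_option maxHeartbeats 1000000 in
/-- if `ℂ[y] ∩ P = 0` and some `r`-minor of the full jacobian is not in `P`, then some `r`-minor of
the `x`-jacobian is not in `P` -/
theorem exists_x_minor {n t s r : ℕ} (F : Fin s → MvPolynomial (Fin n ⊕ Fin t) ℂ)
    (P : Ideal (MvPolynomial (Fin n ⊕ Fin t) ℂ)) [hPp : P.IsPrime] (hF : ∀ j, F j ∈ P)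
    (hy : ∀ q : MvPolynomial (Fin t) ℂ, rename Sum.inr q ∈ P → q = 0)
    (J : Fin r → Fin s) (c : Fin r → Fin n ⊕ Fin t)
    (hc : (Matrix.of fun a b => pderiv (c b) (F (J a))).det ∉ P) :
    ∃ c' : Fin r → Fin n, (Matrix.of fun a b => pderiv (Sum.inl (c' b)) (F (J a))).det ∉ P := by
  let σ := Fin n ⊕ Fin t
  let K := FractionRing (MvPolynomial σ ℂ ⧸ P)
  let ι : (MvPolynomial σ ℂ ⧸ P) →ₐ[ℂ] K := IsScalarTower.toAlgHom ℂ _ K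
  have hι : Function.Injective ι := IsFractionRing.injective _ K
  let x : σ → K := fun j => ι (Ideal.Quotient.mkₐ ℂ P (X j))
  have hxe : aeval x = ι.comp (Ideal.Quotient.mkₐ ℂ P) := by ext j; simp [x]
  have hx : ∀ p, aeval x p = ι (Ideal.Quotient.mkₐ ℂ P p) := by
    intro p
    rw [hxe]; rfl
  have hx0 : ∀ p, aeval x p = 0 ↔ p ∈ P := by
    intro p
    rw [hx, map_eq_zero_iff _ hι]
    exact Ideal.Quotient.eq_zero_iff_mem
  let φ : MvPolynomial (Fin t) ℂ →ₐ[ℂ] K := (aeval x).comp (rename Sum.inr)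
  have hφ : Function.Injective φ := by
    rw [injective_iff_map_eq_zero]
    intro q hq
    exact hy q ((hx0 _).1 hq)
  have hyind : AlgebraicIndependent ℂ (fun l => x (Sum.inr l)) := by
    have := algIndep_of_inj φ hφ
    convert! this using 2 with l
    simp [φ]
  have hdet : ∀ c : Fin r → σ, (Matrix.of fun a b => pderiv (c b) (F (J a))).det ∉ P ↔
      (Matrix.of fun a b => aeval x (pderiv (c b) (F (J a)))).det ≠ 0 := by
    intro c
    rw [← hx0, AlgHom.map_det]; rfl
  rw [hdet] at hc
  have hrow := Matrix.linearIndependent_rows_of_det_ne_zero hc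
  have hxrow : LinearIndependent K (fun a => fun k : Fin n => aeval x (pderiv (Sum.inl k) (F (J a)))) := by
    rw [Fintype.linearIndependent_iff] at hrow ⊢
    intro g hg
    apply hrow
    have hg' : ∀ k, ∑ a, g a * aeval x (pderiv (Sum.inl k) (F (J a))) = 0 := by
      intro k
      have := congrFun hg k
      simpa [Finset.sum_apply] using this
    have hall : ∀ i : σ, ∑ a, g a * aeval x (pderiv i (F (J a))) = 0 := by
      rintro (k | l)
      · exact hg' k
      · obtain ⟨D, hD⟩ := exists_derivation _ hyind (Pi.single l 1)
        have h1 : ∀ a, aeval x (pderiv (Sum.inr l) (F (J a))) =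
            - ∑ k, aeval x (pderiv (Sum.inl k) (F (J a))) * D (x (Sum.inl k)) := by
          intro a
          have h2 := derivation_aeval D x (F (J a))
          rw [(hx0 _).2 (hF _), map_zero, Fintype.sum_sum_type] at h2
          have h3 : ∑ l', aeval x (pderiv (Sum.inr l') (F (J a))) * D (x (Sum.inr l')) =
              aeval x (pderiv (Sum.inr l) (F (J a))) := by
            rw [Finset.sum_eq_single l]
            · rw [hD]; simp
            · intro b _ hb; rw [hD]; simp [hb]
            · simp
          rw [h3] at h2
          exact eq_neg_of_add_eq_zero_right h2.symm
        have h4 : ∀ a, g a * aeval x (pderiv (Sum.inr l) (F (J a))) =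
            - ∑ k, (g a * aeval x (pderiv (Sum.inl k) (F (J a)))) * D (x (Sum.inl k)) := by
          intro a
          rw [h1 a, mul_neg, Finset.mul_sum]
          congr 1
          exact Finset.sum_congr rfl fun k _ => by ring
        rw [Finset.sum_congr rfl fun a _ => h4 a, Finset.sum_neg_distrib, Finset.sum_comm]
        rw [neg_eq_zero]
        refine Finset.sum_eq_zero fun k _ => ?_
        rw [← Finset.sum_mul, hg' k, zero_mul]
    funext b
    have := hall (c b)
    simpa [Finset.sum_apply, Matrix.row] using this
  obtain ⟨c', hc'⟩ := exists_minor _ hxrow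
  exact ⟨c', (hdet (fun b => Sum.inl (c' b))).2 hc'⟩

theorem finrank_ge_of_minor {ι κ : Type*} [Finite ι] [Fintype κ] {r : ℕ} (g : ι → κ → ℂ) (J : Fin r → ι) (c : Fin r → κ)
    (h : (Matrix.of fun a b => g (J a) (c b)).det ≠ 0) :
    r ≤ Module.finrank ℂ (Submodule.span ℂ (Set.range g)) := by
  have h1 := Matrix.linearIndependent_rows_of_det_ne_zero h
  have h2 : LinearIndependent ℂ (fun a => g (J a)) := by
    let L : (κ → ℂ) →ₗ[ℂ] (Fin r → ℂ) := LinearMap.funLeft ℂ ℂ c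
    exact LinearIndependent.of_comp L h1
  have h3 := finrank_span_eq_card h2
  rw [Fintype.card_fin] at h3
  rw [← h3]
  refine Submodule.finrank_mono (Submodule.span_mono ?_)
  rintro _ ⟨a, rfl⟩
  exact ⟨J a, rfl⟩

theorem exists_minor_of_finrank {ι κ : Type*} [Finite ι] [Fintype κ] {r : ℕ} (g : ι → κ → ℂ)
    (h : r ≤ Module.finrank ℂ (Submodule.span ℂ (Set.range g))) :
    ∃ (J : Fin r → ι) (c : Fin r → κ), (Matrix.of fun a b => g (J a) (c b)).det ≠ 0 := by
  obtain ⟨J, hJ, -⟩ := exists_indep_rows g _ rfl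
  have h1 := hJ.comp (Fin.castLE h) (Fin.castLE_injective h)
  obtain ⟨c, hc⟩ := exists_minor _ h1
  exact ⟨J ∘ Fin.castLE h, c, hc⟩

theorem rank_generic {n t s d : ℕ} (F : Fin s → MvPolynomial (Fin n ⊕ Fin t) ℂ)
    (hdn : d ≤ n)
    (hI : vIdeal (zLocus (Set.range F)) = Ideal.span (Set.range F))
    (hS : setDim (singLocus (zLocus (Set.range F)) (d + t)) < (t : WithBot (WithTop ℕ))) :
    ∃ q : MvPolynomial (Fin t) ℂ, q ≠ 0 ∧ ∀ η, eval η q ≠ 0 → RankCond F d η := by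
  obtain ⟨r, hr⟩ : ∃ r, r + d = n := ⟨n - d, by omega⟩
  set V := zLocus (Set.range F) with hV
  set Sg := singLocus V (d + t) with hSg
  -- full gradient
  let gf : (Fin n ⊕ Fin t → ℂ) → Fin s → (Fin n ⊕ Fin t) → ℂ := fun z j i => eval z (pderiv i (F j))
  have hTan : ∀ z ∈ V, Module.finrank ℂ (tangentAt V z) +
      Module.finrank ℂ (Submodule.span ℂ (Set.range (gf z))) = n + t := by
    intro z hz
    have := finrank_ker_add' (gf z) (tangentAt V z) (by
      intro v
      rw [mem_tangentAt_iff hI ((mem_zLocus_range _ _).1 hz)]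
      rfl)
    simpa using this
  let φ : MvPolynomial (Fin t) ℂ →ₐ[ℂ] MvPolynomial (Fin n ⊕ Fin t) ℂ := rename Sum.inr
  have hφe : ∀ z q, eval z (φ q) = eval (fun l => z (Sum.inr l)) q := by
    intro z q; simp only [φ, eval_rename]; rfl
  -- q2
  obtain ⟨q2, hq20, hq2⟩ : ∃ q2 : MvPolynomial (Fin t) ℂ, q2 ≠ 0 ∧ φ q2 ∈ vIdeal Sg := by
    by_contra hcon
    push Not at hcon
    have := card_le_of_inj ((Ideal.Quotient.mkₐ ℂ (vIdeal Sg)).comp φ) (by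
      rw [injective_iff_map_eq_zero]
      intro q hq
      by_contra hq0
      exact hcon q hq0 (Ideal.Quotient.eq_zero_iff_mem.1 hq))
    rw [Nat.card_eq_fintype_card, Fintype.card_fin] at this
    exact absurd hS (not_lt.2 this)
  -- q1
  let mins : Set (MvPolynomial (Fin n ⊕ Fin t) ℂ) := Set.range fun Jc : (Fin r → Fin s) × (Fin r → Fin n) =>
    (Matrix.of fun a b => pderiv (Sum.inl (Jc.2 b)) (F (Jc.1 a))).det
  let I : Ideal (MvPolynomial (Fin n ⊕ Fin t) ℂ) := Ideal.span (Set.range F ∪ mins)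
  obtain ⟨q1, hq10, hq1⟩ : ∃ q1 : MvPolynomial (Fin t) ℂ, q1 ≠ 0 ∧ φ q1 ∈ I := by
    by_contra hcon
    push Not at hcon
    obtain ⟨P, hPp, hIP, hPd⟩ := exists_prime_disjoint φ.toRingHom I (by
      intro q hq; by_contra h; exact hcon q h hq)
    have hFP : ∀ j, F j ∈ P := fun j => hIP (Ideal.subset_span (Or.inl ⟨j, rfl⟩))
    have hall : ∀ (J : Fin r → Fin s) (c : Fin r → Fin n ⊕ Fin t),
        (Matrix.of fun a b => pderiv (c b) (F (J a))).det ∈ P := by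
      intro J c
      by_contra hc
      obtain ⟨c', hc'⟩ := exists_x_minor F P hFP hPd J c hc
      exact hc' (hIP (Ideal.subset_span (Or.inr ⟨(J, c'), rfl⟩)))
    have hsing : ∀ z, P ≤ mPt z → z ∈ Sg := by
      intro z hz
      have hzV : z ∈ V := (mem_zLocus_range _ _).2 fun j => (mem_mPt _ _).1 (hz (hFP j))
      refine ⟨hzV, fun hd => ?_⟩
      have h1 := hTan z hzV
      obtain ⟨J, c, hc⟩ := exists_minor_of_finrank (r := r) (gf z) (by omega)
      apply hc
      have h2 := (mem_mPt _ _).1 (hz (hall J c))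
      rw [RingHom.map_det] at h2
      exact h2
    have hle : vIdeal Sg ≤ P := by
      intro g hg
      have h1 := MvPolynomial.vanishingIdeal_zeroLocus_eq_radical (k := ℂ) (K := ℂ) P
      rw [hPp.isRadical.radical] at h1
      rw [← h1, MvPolynomial.mem_vanishingIdeal_iff]
      intro z hz
      rw [MvPolynomial.mem_zeroLocus_iff] at hz
      have := hg z (hsing z fun p hp => (mem_mPt _ _).2 (by simpa [aeval_eq_eval] using hz p hp))
      simpa [aeval_eq_eval] using this
    have h1 := card_le_of_inj ((Ideal.Quotient.mkₐ ℂ P).comp φ) (by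
      rw [injective_iff_map_eq_zero]
      intro q hq
      exact hPd q (Ideal.Quotient.eq_zero_iff_mem.1 hq))
    rw [Nat.card_eq_fintype_card, Fintype.card_fin] at h1
    have h2 : ringKrullDim (MvPolynomial (Fin n ⊕ Fin t) ℂ ⧸ P) ≤ setDim Sg :=
      ringKrullDim_le_of_surjective (Ideal.Quotient.factor hle) (Ideal.Quotient.factor_surjective hle)
    exact absurd hS (not_lt.2 (h1.trans h2))
  refine ⟨q1 * q2, mul_ne_zero hq10 hq20, fun η hη x hx => ?_⟩
  rw [map_mul] at hη
  have hη1 := left_ne_zero_of_mul hη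
  have hη2 := right_ne_zero_of_mul hη
  set z : Fin n ⊕ Fin t → ℂ := Sum.elim x η with hz
  have hzη : (fun l => z (Sum.inr l)) = η := rfl
  have hzV : z ∈ V := (mem_zLocus_range _ _).2 hx
  have hlow : r ≤ Module.finrank ℂ (Submodule.span ℂ (Set.range (gx F z))) := by
    by_contra hcon
    apply hη1
    rw [← hzη, ← hφe, ← mem_mPt]
    refine (Ideal.span_le.2 ?_ : I ≤ mPt z) hq1
    rintro _ (⟨j, rfl⟩ | ⟨⟨J, c⟩, rfl⟩)
    · exact (mem_mPt _ _).2 (hx j)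
    · rw [SetLike.mem_coe, mem_mPt]
      by_contra h
      rw [RingHom.map_det] at h
      exact hcon (finrank_ge_of_minor (gx F z) J c h)
  have hup : Module.finrank ℂ (Submodule.span ℂ (Set.range (gx F z))) ≤ r := by
    have h1 : z ∉ Sg := by
      intro h
      apply hη2
      rw [← hzη, ← hφe]
      exact hq2 z h
    have h2 : Module.finrank ℂ (tangentAt V z) = d + t := by
      by_contra h; exact h1 ⟨hzV, h⟩
    have h3 := hTan z hzV
    have h4 : Module.finrank ℂ (Submodule.span ℂ (Set.range (gf z))) = r := by omega
    rw [← h4]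
    let L : (Fin n ⊕ Fin t → ℂ) →ₗ[ℂ] (Fin n → ℂ) := LinearMap.funLeft ℂ ℂ Sum.inl
    have h5 : Submodule.span ℂ (Set.range (gx F z)) = (Submodule.span ℂ (Set.range (gf z))).map L := by
      rw [Submodule.map_span, ← Set.range_comp]; rfl
    rw [h5]
    exact Submodule.finrank_map_le L _
  omega


theorem coeff_lin_prod {S L : Type*} [CommRing S] [DecidableEq L] (b u : L → S) (m : L →₀ ℕ) (s : Finset L) :
    (∏ l ∈ s, (Polynomial.C (b l) + Polynomial.C (u l) * Polynomial.X) ^ m l).natDegree ≤ ∑ l ∈ s, m l ∧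
    (∏ l ∈ s, (Polynomial.C (b l) + Polynomial.C (u l) * Polynomial.X) ^ m l).coeff (∑ l ∈ s, m l) =
      ∏ l ∈ s, u l ^ m l := by
  induction s using Finset.induction_on with
  | empty => simp
  | insert a s ha ih =>
    rw [Finset.prod_insert ha, Finset.sum_insert ha, Finset.prod_insert ha]
    have h1 : (Polynomial.C (b a) + Polynomial.C (u a) * Polynomial.X).natDegree ≤ 1 := by
      compute_degree
    have h2 := Polynomial.natDegree_pow_le_of_le (m a) h1
    rw [mul_one] at h2
    have h3 := Polynomial.coeff_pow_of_natDegree_le (m := m a) h1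
    rw [mul_one] at h3
    refine ⟨Polynomial.natDegree_mul_le_of_le h2 ih.1, ?_⟩
    rw [Polynomial.coeff_mul_add_eq_of_natDegree_le h2 ih.1, h3, ih.2]
    simp

theorem isIntegral_of_top {A L : Type*} [CommRing A] [Algebra ℂ A] [Fintype L] (S : Subalgebra ℂ A)
    (b : L → A) (hb : ∀ l, b l ∈ S) (T : A) (u : L → ℂ) (G : MvPolynomial L ℂ) (D : ℕ)
    (hD : G.totalDegree ≤ D) (hu : eval u (homogeneousComponent D G) ≠ 0)
    (h0 : aeval (fun l => b l + u l • T) G = 0) : IsIntegral S T := by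
  classical
  let lin : L → Polynomial S := fun l => Polynomial.C (⟨b l, hb l⟩ : S) + Polynomial.C (algebraMap ℂ S (u l)) * Polynomial.X
  let p : Polynomial S := aeval lin G
  have hp : p = ∑ m ∈ G.support, Polynomial.C (algebraMap ℂ S (coeff m G)) * ∏ l, lin l ^ m l := by
    simp only [p]
    rw [aeval_def, eval₂_eq']
    rfl
  have hsum : ∀ m : L →₀ ℕ, ∑ l, m l = Finsupp.degree m := fun m => by
    rw [Finsupp.degree_eq_sum]
  have hterm : ∀ m ∈ G.support, (Polynomial.C (algebraMap ℂ S (coeff m G)) * ∏ l, lin l ^ m l).natDegree ≤ Finsupp.degree m := by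
    intro m _
    refine (Polynomial.natDegree_C_mul_le _ _).trans ?_
    rw [← hsum]
    exact (coeff_lin_prod _ _ m Finset.univ).1
  have hdeg : ∀ m ∈ G.support, Finsupp.degree m ≤ D := fun m hm => by
    refine le_trans ?_ hD
    have := le_totalDegree hm
    rwa [Finsupp.degree_eq_sum, ← Finsupp.sum_fintype m (fun _ e => e) (by simp)]
  have hpdeg : p.natDegree ≤ D := by
    rw [hp]
    exact Polynomial.natDegree_sum_le_of_forall_le _ _ fun m hm => (hterm m hm).trans (hdeg m hm)
  have hpc : p.coeff D = algebraMap ℂ S (eval u (homogeneousComponent D G)) := by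
    rw [hp, Polynomial.finset_sum_coeff, homogeneousComponent_apply, map_sum, map_sum, Finset.sum_filter]
    refine Finset.sum_congr rfl fun m hm => ?_
    by_cases hmD : Finsupp.degree m = D
    · rw [if_pos hmD, Polynomial.coeff_C_mul, ← hmD, ← hsum, (coeff_lin_prod _ _ m Finset.univ).2]
      rw [eval_monomial, map_mul, Finsupp.prod_fintype _ _ (by simp), map_prod]
      simp
    · rw [if_neg hmD]
      apply Polynomial.coeff_eq_zero_of_natDegree_lt
      exact lt_of_le_of_lt (hterm m hm) (lt_of_le_of_ne (hdeg m hm) hmD)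
  set c := eval u (homogeneousComponent D G) with hc
  let q : Polynomial S := Polynomial.C (algebraMap ℂ S c⁻¹) * p
  have hq : q.Monic := by
    apply Polynomial.monic_of_natDegree_le_of_coeff_eq_one D
    · exact (Polynomial.natDegree_C_mul_le _ _).trans hpdeg
    · rw [Polynomial.coeff_C_mul, hpc, ← map_mul, inv_mul_cancel₀ hu, map_one]
  refine ⟨q, hq, ?_⟩
  have hpe : Polynomial.aeval T p = aeval (fun l => b l + u l • T) G := by
    simp only [p]
    have : ((Polynomial.aeval (R := S) T).restrictScalars ℂ).comp (aeval lin) =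
        (aeval (fun l => b l + u l • T) : MvPolynomial L ℂ →ₐ[ℂ] A) := by
      ext l
      simp [lin, Algebra.smul_def]
    rw [← this]; rfl
  change Polynomial.eval₂ (algebraMap S A) T q = 0
  rw [← Polynomial.aeval_def, map_mul, hpe, h0, mul_zero]

/-- generic properties -/
def Gen {n t : ℕ} (Q : Matrix (Fin n) (Fin n) ℂ → (Fin t → ℂ) → Prop) : Prop :=
  ∃ G : MvPolynomial ((Fin n × Fin n) ⊕ Fin t) ℂ, G ≠ 0 ∧
    ∀ N η, eval (Sum.elim (fun q => N q.1 q.2) η) G ≠ 0 → Q N η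

theorem Gen.and {n t : ℕ} {Q Q' : Matrix (Fin n) (Fin n) ℂ → (Fin t → ℂ) → Prop} (h : Gen Q) (h' : Gen Q') :
    Gen (fun N η => Q N η ∧ Q' N η) := by
  obtain ⟨G, hG, h⟩ := h
  obtain ⟨G', hG', h'⟩ := h'
  refine ⟨G * G', mul_ne_zero hG hG', fun N η hN => ?_⟩
  rw [map_mul] at hN
  exact ⟨h _ _ (left_ne_zero_of_mul hN), h' _ _ (right_ne_zero_of_mul hN)⟩

theorem Gen.mono {n t : ℕ} {Q Q' : Matrix (Fin n) (Fin n) ℂ → (Fin t → ℂ) → Prop} (h : Gen Q)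
    (h' : ∀ N η, Q N η → Q' N η) : Gen Q' := by
  obtain ⟨G, hG, h⟩ := h
  exact ⟨G, hG, fun N η hN => h' _ _ (h _ _ hN)⟩

theorem Gen.of_y {n t : ℕ} {Q : (Fin t → ℂ) → Prop} (q : MvPolynomial (Fin t) ℂ) (hq : q ≠ 0)
    (h : ∀ η, eval η q ≠ 0 → Q η) : Gen (n := n) (fun _ η => Q η) := by
  refine ⟨rename Sum.inr q, fun h0 => hq ?_, fun N η hN => h η ?_⟩
  · exact rename_injective _ Sum.inr_injective (by rw [h0, map_zero])
  · rw [eval_rename] at hN; exact hN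

theorem Gen.det {n t : ℕ} : Gen (n := n) (t := t) (fun N _ => N.det ≠ 0) := by
  let M : Matrix (Fin n) (Fin n) (MvPolynomial ((Fin n × Fin n) ⊕ Fin t) ℂ) := Matrix.of fun i j => X (Sum.inl (i, j))
  have hM : ∀ (N : Matrix (Fin n) (Fin n) ℂ) (η : Fin t → ℂ), eval (Sum.elim (fun q => N q.1 q.2) η) M.det = N.det := by
    intro N η
    rw [RingHom.map_det]
    congr 1
    ext i j
    simp [M]
  refine ⟨M.det, fun h => ?_, fun N η hN => ?_⟩
  · have := hM 1 0
    rw [h] at this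
    simp at this
  · rwa [hM] at hN

theorem Gen.finite {n t : ℕ} {ι : Type*} (s : Finset ι) {Q : ι → Matrix (Fin n) (Fin n) ℂ → (Fin t → ℂ) → Prop}
    (h : ∀ i ∈ s, Gen (Q i)) : Gen (fun N η => ∀ i ∈ s, Q i N η) := by
  classical
  induction s using Finset.induction_on with
  | empty => exact ⟨1, one_ne_zero, fun N η _ i hi => absurd hi (by simp)⟩
  | insert a s ha ih =>
    have h1 := (h a (by simp)).and (ih fun i hi => h i (by simp [hi]))
    refine h1.mono fun N η hN i hi => ?_
    rcases Finset.mem_insert.1 hi with rfl | hi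
    · exact hN.1
    · exact hN.2 i hi

theorem Gen.shear {n t : ℕ} {Q : Matrix (Fin n) (Fin n) ℂ → (Fin t → ℂ) → Prop} (M0 M1 : Matrix (Fin n) (Fin n) ℂ)
    (h01 : M0 * M1 = 1) (h : Gen (fun N η => Q (M0 * N) η)) : Gen Q := by
  obtain ⟨G, hG, h⟩ := h
  let sub : Matrix (Fin n) (Fin n) ℂ → MvPolynomial ((Fin n × Fin n) ⊕ Fin t) ℂ →ₐ[ℂ] MvPolynomial ((Fin n × Fin n) ⊕ Fin t) ℂ :=
    fun M => aeval (Sum.elim (fun q => ∑ k, C (M q.1 k) * X (Sum.inl (k, q.2))) (fun l => X (Sum.inr l)))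
  have hsub : ∀ M (N : Matrix (Fin n) (Fin n) ℂ) (η : Fin t → ℂ) p, eval (Sum.elim (fun q => N q.1 q.2) η) (sub M p) =
      eval (Sum.elim (fun q => (M * N) q.1 q.2) η) p := by
    intro M N η p
    simp only [sub]
    induction p using MvPolynomial.induction_on with
    | C a => simp
    | add p q hp hq => rw [map_add, map_add, map_add, hp, hq]
    | mul_X p i hp =>
      rw [map_mul, map_mul, map_mul, hp]
      rcases i with ⟨i, j⟩ | i <;> simp [Matrix.mul_apply]
  refine ⟨sub M1 G, fun h0 => hG ?_, fun N η hN => ?_⟩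
  · apply MvPolynomial.funext
    intro v
    have h1 := hsub M1 (M0 * Matrix.of fun i j => v (Sum.inl (i, j))) (fun l => v (Sum.inr l)) G
    rw [h0, ← mul_assoc, mul_eq_one_comm.1 h01, one_mul, map_zero] at h1
    rw [map_zero, h1]
    congr 1
    congr 1
    funext i
    rcases i with ⟨i, j⟩ | i <;> simp
  · rw [hsub] at hN
    have : Q (M0 * (M1 * N)) η := h _ _ hN
    rwa [← mul_assoc, h01, one_mul] at this


/-- critical locus before the change of variables, with `N` the inverse matrix -/
def Kset {n t s : ℕ} (F : Fin s → MvPolynomial (Fin n ⊕ Fin t) ℂ) (d i : ℕ) (N : Matrix (Fin n) (Fin n) ℂ)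
    (η : Fin t → ℂ) : Set (Fin n → ℂ) :=
  {z | (∀ j, eval (Sum.elim z η) (F j) = 0) ∧ (i ≤ d → ∃ v : Fin n → ℂ, v ≠ 0 ∧ (∀ l : Fin n, i ≤ (l : ℕ) → v l = 0) ∧
    Matrix.vecMul v N ∈ Submodule.span ℂ (Set.range (gx F (Sum.elim z η))))}

theorem Kset_succ {n t s : ℕ} (F : Fin s → MvPolynomial (Fin n ⊕ Fin t) ℂ) (d i : ℕ) (N : Matrix (Fin n) (Fin n) ℂ)
    (η : Fin t → ℂ) : Kset F d i N η ⊆ Kset F d (i+1) N η := by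
  rintro z ⟨h1, h2⟩
  refine ⟨h1, fun h => ?_⟩
  obtain ⟨v, hv, hl, hs⟩ := h2 (by omega)
  exact ⟨v, hv, fun l hl' => hl l (by omega), hs⟩

theorem Kset_shear {n t s : ℕ} (F : Fin s → MvPolynomial (Fin n ⊕ Fin t) ℂ) (d i : ℕ) (N M0 M1 : Matrix (Fin n) (Fin n) ℂ)
    (h01 : M0 * M1 = 1) (hM : ∀ a b : Fin n, (a : ℕ) < i → i ≤ (b : ℕ) → M0 a b = 0)
    (η : Fin t → ℂ) : Kset F d i (M0 * N) η ⊆ Kset F d i N η := by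
  rintro z ⟨h1, h2⟩
  refine ⟨h1, fun h => ?_⟩
  obtain ⟨v, hv, hl, hs⟩ := h2 h
  refine ⟨Matrix.vecMul v M0, fun h0 => hv ?_, fun b hb => ?_, by rwa [Matrix.vecMul_vecMul]⟩
  · have : Matrix.vecMul (Matrix.vecMul v M0) M1 = 0 := by rw [h0, Matrix.zero_vecMul]
    rwa [Matrix.vecMul_vecMul, h01, Matrix.vecMul_one] at this
  · rw [Matrix.vecMul, dotProduct]
    refine Finset.sum_eq_zero fun a _ => ?_
    rcases lt_or_ge (a : ℕ) i with ha | ha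
    · rw [hM a b ha hb, mul_zero]
    · rw [hl a ha, zero_mul]

theorem eval_sumAlgEquiv {L B : Type*} (x : L → ℂ) (b : B → ℂ) (p : MvPolynomial (L ⊕ B) ℂ) :
    eval x (MvPolynomial.map (eval b) (sumAlgEquiv ℂ L B p)) = eval (Sum.elim x b) p := by
  induction p using MvPolynomial.induction_on with
  | C a => simp
  | add p q hp hq => rw [map_add, map_add, map_add, map_add, hp, hq]
  | mul_X p i hp =>
    rw [map_mul, map_mul, map_mul, map_mul, hp]
    rcases i with i | i <;> simp

theorem cover_rel {n t i : ℕ} (hi : i ≤ n) {ι : Type} [Finite ι] (S : ι → Type) [∀ c, CommRing (S c)] [∀ c, Algebra ℂ (S c)]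
    [∀ c, Algebra.FiniteType ℂ (S c)] (cN : ∀ c, Fin n → Fin n → S c) (cY : ∀ c, Fin t → S c) (cZ : ∀ c, Fin n → S c)
    (hdim : ∀ c, ringKrullDim (S c) < ((n * n + t + i : ℕ) : WithBot ℕ∞))
    (K : Matrix (Fin n) (Fin n) ℂ → (Fin t → ℂ) → Set (Fin n → ℂ)) (R : (Fin t → ℂ) → Prop)
    (hcov : ∀ N η, R η → ∀ z ∈ K N η, ∃ c, ∃ ψ : S c →ₐ[ℂ] ℂ, (∀ a b, ψ (cN c a b) = N a b) ∧
      (∀ l, ψ (cY c l) = η l) ∧ ∀ m, ψ (cZ c m) = z m) :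
    ∃ g : MvPolynomial {l : Fin n // (l : ℕ) < i} (MvPolynomial ((Fin n × Fin n) ⊕ Fin t) ℂ), g ≠ 0 ∧
      ∀ N η, R η → ∀ z ∈ K N η, eval (fun l : {l : Fin n // (l : ℕ) < i} => N.mulVec z l)
        (MvPolynomial.map (eval (Sum.elim (fun q : Fin n × Fin n => N q.1 q.2) η)) g) = 0 := by
  classical
  let Φ : ∀ c, MvPolynomial ({l : Fin n // (l : ℕ) < i} ⊕ ((Fin n × Fin n) ⊕ Fin t)) ℂ →ₐ[ℂ] S c := fun c =>
    aeval (Sum.elim (fun l => ∑ m, cN c l m * cZ c m) (Sum.elim (fun q => cN c q.1 q.2) (cY c)))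
  have hcard : Nat.card ({l : Fin n // (l : ℕ) < i} ⊕ ((Fin n × Fin n) ⊕ Fin t)) = n * n + t + i := by
    have : Nat.card {l : Fin n // (l : ℕ) < i} = i := by
      rw [Nat.card_congr (Fin.castLEquiv hi).symm]; simp
    rw [Nat.card_sum, this]
    simp
    ring
  have hker : ∀ c, ∃ g, g ≠ 0 ∧ Φ c g = 0 := by
    intro c
    by_contra! hcon
    have hinj : Function.Injective (Φ c) := by
      rw [injective_iff_map_eq_zero]
      intro a ha
      by_contra h
      exact hcon a h ha
    have := card_le_of_inj (Φ c) hinj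
    rw [hcard] at this
    exact absurd (hdim c) (not_lt.2 this)
  choose g hg0 hg using hker
  haveI := Fintype.ofFinite ι
  refine ⟨sumAlgEquiv ℂ _ _ (∏ c, g c), ?_, ?_⟩
  · rw [Ne, EmbeddingLike.map_eq_zero_iff]
    exact Finset.prod_ne_zero_iff.2 fun c _ => hg0 c
  · intro N η hη z hz
    rw [eval_sumAlgEquiv, map_prod]
    obtain ⟨c, ψ, h1, h2, h3⟩ := hcov N η hη z hz
    refine Finset.prod_eq_zero (Finset.mem_univ c) ?_
    have := congrArg ψ (hg c)
    rw [map_zero] at this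
    rw [← this, ← aeval_eq_eval]
    change _ = (ψ.comp (Φ c)) (g c)
    refine DFunLike.congr_fun ?_ _
    ext v
    rcases v with v | ⟨v, w⟩ | v <;> simp [Φ, h1, h2, h3, Matrix.mulVec, dotProduct]


abbrev chartT (n i r : ℕ) (k : Fin n) : Type := ({l : Fin n // l ≠ k} × Fin n) ⊕ ({l : Fin n // l ≠ k ∧ (l : ℕ) < i} ⊕ Fin r)

abbrev chartS {n t : ℕ} (P : Ideal (MvPolynomial (Fin n ⊕ Fin t) ℂ)) (k : Fin n) (i r : ℕ) : Type :=
  MvPolynomial (chartT n i r k) (MvPolynomial (Fin n ⊕ Fin t) ℂ ⧸ P)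

def chN {n t s : ℕ} (F : Fin s → MvPolynomial (Fin n ⊕ Fin t) ℂ) (P : Ideal (MvPolynomial (Fin n ⊕ Fin t) ℂ))
    (k : Fin n) (i r : ℕ) (J : Fin r → Fin s) (l m : Fin n) : chartS P k i r :=
  if h : l ≠ k then X (Sum.inl (⟨l, h⟩, m)) else
    (∑ j : Fin r, X (Sum.inr (Sum.inr j)) * C (Ideal.Quotient.mk P (pderiv (Sum.inl m) (F (J j))))) -
    ∑ l' : {l : Fin n // l ≠ k ∧ (l : ℕ) < i}, X (Sum.inr (Sum.inl l')) * X (Sum.inl (⟨l', l'.2.1⟩, m))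

def chY {n t : ℕ} (P : Ideal (MvPolynomial (Fin n ⊕ Fin t) ℂ))
    (k : Fin n) (i r : ℕ) (l : Fin t) : chartS P k i r := C (Ideal.Quotient.mk P (X (Sum.inr l)))

def chZ {n t : ℕ} (P : Ideal (MvPolynomial (Fin n ⊕ Fin t) ℂ))
    (k : Fin n) (i r : ℕ) (m : Fin n) : chartS P k i r := C (Ideal.Quotient.mk P (X (Sum.inl m)))

instance chartS_ft {n t : ℕ} (P : Ideal (MvPolynomial (Fin n ⊕ Fin t) ℂ)) (τ : Type) [Finite τ] :
    Algebra.FiniteType ℂ (MvPolynomial τ (MvPolynomial (Fin n ⊕ Fin t) ℂ ⧸ P)) :=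
  Algebra.FiniteType.trans (S := MvPolynomial (Fin n ⊕ Fin t) ℂ ⧸ P) inferInstance inferInstance

theorem card_chartT (n i r : ℕ) (k : Fin n) (hki : (k : ℕ) < i) (hi : i ≤ n) :
    Nat.card (chartT n i r k) + n + 1 = n * n + i + r := by
  have h1 : Nat.card {l : Fin n // l ≠ k} + 1 = n := by
    simp
    have := k.2
    omega
  have h2 : Nat.card {l : Fin n // l ≠ k ∧ (l : ℕ) < i} + 1 = i := by
    have e : Nat.card {l : Fin n // (l : ℕ) < i} = i := by
      rw [Nat.card_congr (Fin.castLEquiv hi).symm]; simp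
    rw [Nat.card_eq_fintype_card, Fintype.card_subtype] at e ⊢
    have : Finset.univ.filter (fun l : Fin n => l ≠ k ∧ (l : ℕ) < i) = (Finset.univ.filter (fun l : Fin n => (l : ℕ) < i)).erase k := by
      ext l; simp
    rw [this, Finset.card_erase_add_one (by simpa using hki), e]
  rw [Nat.card_sum, Nat.card_sum, Nat.card_prod, Nat.card_fin, Nat.card_fin]
  nlinarith

theorem dim_chart {n t : ℕ} (P : Ideal (MvPolynomial (Fin n ⊕ Fin t) ℂ)) (k : Fin n) (i d : ℕ) (hki : (k : ℕ) < i)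
    (hid : i ≤ d) (hdn : d ≤ n)
    (hP : ringKrullDim (MvPolynomial (Fin n ⊕ Fin t) ℂ ⧸ P) = ((d + t : ℕ) : WithBot ℕ∞)) :
    ringKrullDim (chartS P k i (n - d)) = ((n * n + t + i - 1 : ℕ) : WithBot ℕ∞) := by
  rw [MvPolynomial.ringKrullDim_of_isNoetherianRing, hP, ← Nat.cast_add]
  have := card_chartT n i (n - d) k hki (by omega)
  congr 1
  omega

theorem sum_split {n i : ℕ} {A : Type*} [AddCommMonoid A] (k : Fin n) (g : Fin n → A) (h : ∀ l : Fin n, l ≠ k → i ≤ (l : ℕ) → g l = 0) :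
    ∑ l, g l = g k + ∑ l' : {l : Fin n // l ≠ k ∧ (l : ℕ) < i}, g l' := by
  classical
  rw [Fintype.sum_eq_add_sum_compl k]
  congr 1
  rw [← Finset.sum_subtype (Finset.univ.filter (fun l : Fin n => l ≠ k ∧ (l : ℕ) < i)) (by simp) g]
  symm
  apply Finset.sum_subset
  · intro l; simp; tauto
  · intro l hl hl'
    simp at hl hl'
    exact h l hl (hl' hl)

theorem chart_pt {n t s : ℕ} (F : Fin s → MvPolynomial (Fin n ⊕ Fin t) ℂ) (P : Ideal (MvPolynomial (Fin n ⊕ Fin t) ℂ))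
    (hFP : ∀ j, F j ∈ P) (k : Fin n) (d i r : ℕ) (hki : (k : ℕ) < i) (J : Fin r → Fin s) (ψ : chartS P k i r →ₐ[ℂ] ℂ) :
    (fun m => ψ (chZ P k i r m)) ∈ Kset F d i (Matrix.of fun a b => ψ (chN F P k i r J a b)) (fun l => ψ (chY P k i r l)) := by
  classical
  have key : ∀ p : MvPolynomial (Fin n ⊕ Fin t) ℂ, ψ (C (Ideal.Quotient.mk P p)) =
      eval (Sum.elim (fun m => ψ (chZ P k i r m)) (fun l => ψ (chY P k i r l))) p := by
    intro p
    rw [← aeval_eq_eval]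
    change (ψ.comp ((IsScalarTower.toAlgHom ℂ (MvPolynomial (Fin n ⊕ Fin t) ℂ ⧸ P) (chartS P k i r)).comp (Ideal.Quotient.mkₐ ℂ P))) p = _
    refine DFunLike.congr_fun ?_ _
    ext v
    rcases v with v | v <;> simp [chZ, chY, algebraMap_eq]
  refine ⟨fun j => ?_, fun _ => ?_⟩
  · rw [← key, Ideal.Quotient.eq_zero_iff_mem.2 (hFP j), map_zero, map_zero]
  · refine ⟨fun l => if l = k then 1 else if h : l ≠ k ∧ (l : ℕ) < i then ψ (X (Sum.inr (Sum.inl ⟨l, h⟩))) else 0, ?_, ?_, ?_⟩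
    · intro h
      simpa using congrFun h k
    · intro l hl
      have : l ≠ k := by rintro rfl; omega
      simp [this, hl]
    · have : Matrix.vecMul (fun l => if l = k then 1 else if h : l ≠ k ∧ (l : ℕ) < i then ψ (X (Sum.inr (Sum.inl ⟨l, h⟩))) else 0)
          (Matrix.of fun a b => ψ (chN F P k i r J a b)) = ∑ j, ψ (X (Sum.inr (Sum.inr j))) •
            gx F (Sum.elim (fun m => ψ (chZ P k i r m)) (fun l => ψ (chY P k i r l))) (J j) := by
        funext m
        rw [Finset.sum_apply]
        simp only [Pi.smul_apply, gx, ← key, smul_eq_mul]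
        rw [Matrix.vecMul, dotProduct, sum_split (i := i) k _ (fun l hl hli => by simp [hl, not_lt.2 hli])]
        rw [if_pos rfl, one_mul]
        simp only [Matrix.of_apply]
        rw [show chN F P k i r J k m = _ from dif_neg (by simp)]
        rw [map_sub, map_sum, map_sum]
        simp only [map_mul]
        rw [sub_add, sub_eq_self, sub_eq_zero]
        refine Finset.sum_congr rfl fun l' _ => ?_
        rw [if_neg l'.2.1, dif_pos l'.2, show chN F P k i r J l' m = _ from dif_pos l'.2.1]
      rw [this]
      exact Submodule.sum_mem _ fun j _ => Submodule.smul_mem _ _ (Submodule.subset_span ⟨_, rfl⟩)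

theorem chart_cover {n t s : ℕ} (F : Fin s → MvPolynomial (Fin n ⊕ Fin t) ℂ) (d i : ℕ) (hid : i ≤ d) (hdn : d ≤ n)
    (N : Matrix (Fin n) (Fin n) ℂ) (η : Fin t → ℂ) (hR : RankCond F d η) (z : Fin n → ℂ) (hz : z ∈ Kset F d i N η) :
    ∃ (P : Ideal (MvPolynomial (Fin n ⊕ Fin t) ℂ)) (k : Fin n) (J : Fin (n - d) → Fin s),
      P ∈ (Ideal.span (Set.range F)).minimalPrimes ∧ (k : ℕ) < i ∧ P ≤ mPt (Sum.elim z η) ∧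
      LinearIndependent ℂ (fun j => gx F (Sum.elim z η) (J j)) ∧
      ∃ ψ : chartS P k i (n - d) →ₐ[ℂ] ℂ, (∀ a b, ψ (chN F P k i (n - d) J a b) = N a b) ∧
        (∀ l, ψ (chY P k i (n - d) l) = η l) ∧ (∀ m, ψ (chZ P k i (n - d) m) = z m) := by
  classical
  obtain ⟨hz0, hz⟩ := hz
  obtain ⟨v, hv, hl, hs⟩ := hz hid
  have hrk := hR z hz0
  obtain ⟨J, hJ, hJs⟩ := exists_indep_rows (gx F (Sum.elim z η)) (n - d) (by omega)
  obtain ⟨k, hk⟩ : ∃ k, v k ≠ 0 := by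
    by_contra! h
    exact hv (funext h)
  have hki : (k : ℕ) < i := by
    by_contra h
    exact hk (hl k (not_lt.1 h))
  have hle : Ideal.span (Set.range F) ≤ mPt (Sum.elim z η) := by
    rw [Ideal.span_le]
    rintro _ ⟨j, rfl⟩
    exact (mem_mPt _ _).2 (hz0 j)
  obtain ⟨P, hP, hPle⟩ := Ideal.exists_minimalPrimes_le hle
  rw [← hJs] at hs
  obtain ⟨μ, hμ⟩ := (Submodule.mem_span_range_iff_exists_fun ℂ).1 hs
  refine ⟨P, k, J, hP, hki, hPle, hJ, ?_⟩
  let ψ0 : (MvPolynomial (Fin n ⊕ Fin t) ℂ ⧸ P) →ₐ[ℂ] ℂ := Ideal.Quotient.liftₐ P (aeval (Sum.elim z η)) (fun a ha => by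
    rw [aeval_eq_eval]; exact (mem_mPt _ _).1 (hPle ha))
  have h0 : ∀ p, ψ0 (Ideal.Quotient.mk P p) = eval (Sum.elim z η) p := fun p => by
    simp [ψ0, aeval_eq_eval]
  let ψ : chartS P k i (n - d) →ₐ[ℂ] ℂ := aevalTower ψ0 (Sum.elim (fun q => N q.1 q.2) (Sum.elim (fun l => v l / v k) (fun j => μ j / v k)))
  refine ⟨ψ, fun a b => ?_, fun l => by simp [ψ, chY, h0], fun l => by simp [ψ, chZ, h0]⟩
  by_cases ha : a ≠ k
  · simp [chN, ha, ψ]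
  · push Not at ha
    subst ha
    rw [show chN F P a i (n - d) J a b = _ from dif_neg (by simp)]
    rw [map_sub, map_sum, map_sum]
    simp only [ψ, map_mul, aevalTower_X, aevalTower_C, Sum.elim_inl, Sum.elim_inr, h0]
    have h1 := congrFun hμ b
    rw [Finset.sum_apply] at h1
    rw [Matrix.vecMul, dotProduct, sum_split (i := i) a _ (fun l _ hli => by simp [hl l hli])] at h1
    have e1 : ∑ x, μ x / v a * eval (Sum.elim z η) (pderiv (Sum.inl b) (F (J x))) =
        (v a)⁻¹ * ∑ c, (μ c • gx F (Sum.elim z η) (J c)) b := by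
      rw [Finset.mul_sum]
      refine Finset.sum_congr rfl fun x _ => ?_
      simp [gx]
      ring
    have e2 : ∑ x : {l : Fin n // l ≠ a ∧ (l : ℕ) < i}, v x / v a * N x b =
        (v a)⁻¹ * ∑ x : {l : Fin n // l ≠ a ∧ (l : ℕ) < i}, v x * N x b := by
      rw [Finset.mul_sum]
      refine Finset.sum_congr rfl fun x _ => ?_
      ring
    rw [e1, h1, e2]
    field_simp
    ring


theorem exists_rel {n t s d : ℕ} (F : Fin s → MvPolynomial (Fin n ⊕ Fin t) ℂ)
    (hE : EquidimIdeal (Ideal.span (Set.range F)) (d + t)) (hdn : d ≤ n) (i : ℕ) (h1 : 1 ≤ i) (hi : i ≤ n) :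
    ∃ g : MvPolynomial {l : Fin n // (l : ℕ) < i} (MvPolynomial ((Fin n × Fin n) ⊕ Fin t) ℂ), g ≠ 0 ∧
      ∀ N η, RankCond F d η → ∀ z ∈ Kset F d i N η, eval (fun l : {l : Fin n // (l : ℕ) < i} => N.mulVec z l)
        (MvPolynomial.map (eval (Sum.elim (fun q : Fin n × Fin n => N q.1 q.2) η)) g) = 0 := by
  classical
  haveI : Finite {P // P ∈ (Ideal.span (Set.range F)).minimalPrimes} :=
    (Ideal.finite_minimalPrimes_of_isNoetherianRing _ _).to_subtype
  by_cases hid : i ≤ d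
  · refine cover_rel hi (ι := {P // P ∈ (Ideal.span (Set.range F)).minimalPrimes} × {k : Fin n // (k : ℕ) < i} × (Fin (n - d) → Fin s))
      (fun c => chartS c.1.1 c.2.1.1 i (n - d)) (fun c => chN F c.1.1 c.2.1.1 i (n - d) c.2.2)
      (fun c => chY c.1.1 c.2.1.1 i (n - d)) (fun c => chZ c.1.1 c.2.1.1 i (n - d)) ?_ _ _ ?_
    · intro c
      rw [dim_chart c.1.1 c.2.1.1 i d c.2.1.2 hid hdn (hE _ c.1.2)]
      exact_mod_cast (by omega : n * n + t + i - 1 < n * n + t + i)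
    · intro N η hη z hz
      obtain ⟨P, k, J, hP, hk, -, -, ψ, h⟩ := chart_cover F d i hid hdn N η hη z hz
      exact ⟨(⟨P, hP⟩, ⟨k, hk⟩, J), ψ, h⟩
  · refine cover_rel hi (ι := {P // P ∈ (Ideal.span (Set.range F)).minimalPrimes})
      (fun c => MvPolynomial (Fin n × Fin n) (MvPolynomial (Fin n ⊕ Fin t) ℂ ⧸ c.1)) (fun c a b => X (a, b))
      (fun c l => C (Ideal.Quotient.mk c.1 (X (Sum.inr l)))) (fun c l => C (Ideal.Quotient.mk c.1 (X (Sum.inl l)))) ?_ _ _ ?_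
    · intro c
      have hP := hE _ c.2
      rw [MvPolynomial.ringKrullDim_of_isNoetherianRing, hP]
      have : Nat.card (Fin n × Fin n) = n * n := by simp
      rw [this]
      change ((d + t : ℕ) : WithBot ℕ∞) + ((n * n : ℕ) : WithBot ℕ∞) < _
      exact_mod_cast (by omega : d + t + n * n < n * n + t + i)
    · intro N η hη z hz
      have hle : Ideal.span (Set.range F) ≤ mPt (Sum.elim z η) := by
        rw [Ideal.span_le]
        rintro _ ⟨j, rfl⟩
        exact (mem_mPt _ _).2 (hz.1 j)
      obtain ⟨P, hP, hPle⟩ := Ideal.exists_minimalPrimes_le hle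
      let ψ0 : (MvPolynomial (Fin n ⊕ Fin t) ℂ ⧸ P) →ₐ[ℂ] ℂ := Ideal.Quotient.liftₐ P (aeval (Sum.elim z η)) (fun a ha => by
        rw [aeval_eq_eval]; exact (mem_mPt _ _).1 (hPle ha))
      have h0 : ∀ p, ψ0 (Ideal.Quotient.mk P p) = eval (Sum.elim z η) p := fun p => by
        simp [ψ0, aeval_eq_eval]
      refine ⟨⟨P, hP⟩, aevalTower ψ0 (fun q => N q.1 q.2), fun a b => by simp, fun l => by simp [h0], fun l => by simp [h0]⟩


def coordAlg {n : ℕ} (K : Set (Fin n → ℂ)) (N : Matrix (Fin n) (Fin n) ℂ) (c : ℕ) : Subalgebra ℂ (K → ℂ) :=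
  Algebra.adjoin ℂ {h : K → ℂ | ∃ l : Fin n, (l : ℕ) < c ∧ h = fun z => N.mulVec z.1 l}

def IntC {n : ℕ} (K : Set (Fin n → ℂ)) (N : Matrix (Fin n) (Fin n) ℂ) (c : ℕ) : Prop :=
  ∀ m, IsIntegral (coordAlg K N c) (fun z : K => z.1 m)

theorem isIntegral_trans_sub {A : Type*} [CommRing A] [Algebra ℂ A] (S S' : Subalgebra ℂ A)
    (h : ∀ x ∈ S', IsIntegral S x) (a : A) (ha : IsIntegral S' a) : IsIntegral S a := by
  have h1 : IsIntegral (integralClosure S A) a := by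
    refine IsIntegral.map_of_comp_eq (R := S') (T := integralClosure S A)
      ((Subring.inclusion (R := A) (S := S'.toSubring) (T := (integralClosure S A).toSubring) (fun x hx => h x hx))) (RingHom.id A) ?_ ha
    rfl
  exact isIntegral_trans a h1

theorem IntC.sub {n : ℕ} {K K' : Set (Fin n → ℂ)} {N : Matrix (Fin n) (Fin n) ℂ} {c : ℕ} (h : IntC K' N c) (hK : K ⊆ K') :
    IntC K N c := by
  intro m
  let ρ : (K' → ℂ) →ₐ[ℂ] (K → ℂ) := Pi.algHom ℂ _ fun z => Pi.evalAlgHom ℂ (fun _ : K' => ℂ) ⟨z.1, hK z.2⟩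
  have hρ : ∀ x ∈ coordAlg K' N c, ρ x ∈ coordAlg K N c := by
    intro x hx
    have : coordAlg K' N c ≤ (coordAlg K N c).comap ρ := by
      apply Algebra.adjoin_le
      rintro _ ⟨l, hl, rfl⟩
      exact Algebra.subset_adjoin ⟨l, hl, rfl⟩
    exact this hx
  refine IsIntegral.map_of_comp_eq (R := coordAlg K' N c) (T := coordAlg K N c)
    (((ρ.comp (coordAlg K' N c).val).codRestrict (coordAlg K N c) (fun x => hρ x x.2)).toRingHom) ρ.toRingHom ?_ (h m)
  rfl

theorem exists_top {L B : Type} [Finite L] [Finite B] (g : MvPolynomial L (MvPolynomial B ℂ)) (hg : g ≠ 0) (i0 : L) :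
    ∃ (u : L → ℂ) (h : MvPolynomial B ℂ), u i0 ≠ 0 ∧ h ≠ 0 ∧ ∀ β, eval β h =
      eval u (homogeneousComponent g.totalDegree (MvPolynomial.map (eval β) g)) := by
  set D := g.totalDegree
  have hmap : ∀ β : B → ℂ, homogeneousComponent D (MvPolynomial.map (eval β) g) =
      MvPolynomial.map (eval β) (homogeneousComponent D g) := by
    intro β
    ext m
    rw [coeff_homogeneousComponent, coeff_map, coeff_map, coeff_homogeneousComponent]
    split_ifs <;> simp
  have hgD : homogeneousComponent D g ≠ 0 := by
    obtain ⟨m, hm, hmD⟩ := Finset.exists_mem_eq_sup g.support (by simpa using hg) (fun m => m.sum fun _ e => e)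
    intro h0
    have := congrArg (coeff m) h0
    have hdeg : Finsupp.degree m = D := hmD.symm
    rw [coeff_homogeneousComponent, if_pos hdeg, coeff_zero] at this
    exact (mem_support_iff.1 hm) this
  have h1 : homogeneousComponent D g * X i0 ≠ 0 := mul_ne_zero hgD (X_ne_zero _)
  obtain ⟨β, hβ⟩ : ∃ β : B → ℂ, MvPolynomial.map (eval β) (homogeneousComponent D g * X i0) ≠ 0 := by
    obtain ⟨m, hm⟩ := exists_coeff_ne_zero h1
    by_contra! hcon
    apply hm
    apply MvPolynomial.funext
    intro β
    rw [← coeff_map, hcon]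
    simp
  obtain ⟨u, hu⟩ : ∃ u : L → ℂ, eval u (MvPolynomial.map (eval β) (homogeneousComponent D g * X i0)) ≠ 0 := by
    by_contra! hcon
    exact hβ (MvPolynomial.funext fun u => by rw [hcon, map_zero])
  have hev : ∀ β : B → ℂ, eval β (eval (fun l => (C (u l) : MvPolynomial B ℂ)) (homogeneousComponent D g)) =
      eval u (MvPolynomial.map (eval β) (homogeneousComponent D g)) := by
    intro β
    generalize homogeneousComponent D g = q
    induction q using MvPolynomial.induction_on with
    | C a => simp
    | add p q hp hq => simp only [map_add, hp, hq]
    | mul_X p i hp => rw [map_mul, map_mul, map_mul, map_mul, hp]; simp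
  refine ⟨u, eval (fun l => C (u l)) (homogeneousComponent D g), ?_, ?_, ?_⟩
  · intro h
    apply hu
    simp [h]
  · intro h
    have := hev β
    rw [h, map_zero] at this
    apply hu
    rw [map_mul, map_mul, ← this, zero_mul]
  · intro β
    rw [hev, hmap]

theorem int_top {n t s d : ℕ} (F : Fin s → MvPolynomial (Fin n ⊕ Fin t) ℂ) (i : ℕ) :
    Gen (fun N η => RankCond F d η → IntC (Kset F d i N η) N n) := by
  refine Gen.det.mono fun N η hN _ m => ?_
  have : (fun z : Kset F d i N η => z.1 m) ∈ coordAlg (Kset F d i N η) N n := by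
    have e : (fun z : Kset F d i N η => z.1 m) = ∑ l, N⁻¹ m l • (fun z : Kset F d i N η => N.mulVec z.1 l) := by
      funext z
      rw [Finset.sum_apply]
      have : N⁻¹.mulVec (N.mulVec z.1) = z.1 := by
        rw [Matrix.mulVec_mulVec, Matrix.nonsing_inv_mul _ (isUnit_iff_ne_zero.2 hN), Matrix.one_mulVec]
      conv_lhs => rw [← this]
      rfl
    rw [e]
    refine Subalgebra.sum_mem _ fun l _ => Subalgebra.smul_mem _ ?_ _
    exact Algebra.subset_adjoin ⟨l, l.2, rfl⟩
  exact isIntegral_algebraMap (R := coordAlg (Kset F d i N η) N n) (A := Kset F d i N η → ℂ) (x := (⟨_, this⟩ : coordAlg (Kset F d i N η) N n))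

theorem int_step {n t s d : ℕ} (F : Fin s → MvPolynomial (Fin n ⊕ Fin t) ℂ)
    (hE : EquidimIdeal (Ideal.span (Set.range F)) (d + t)) (hdn : d ≤ n) (i0 : Fin n)
    (h : Gen (fun N η => RankCond F d η → IntC (Kset F d (i0 + 1 + 1) N η) N (i0 + 1))) :
    Gen (fun N η => RankCond F d η → IntC (Kset F d (i0 + 1) N η) N i0) := by
  classical
  obtain ⟨g, hg0, hg⟩ := exists_rel F hE hdn (i0 + 1) (by omega) (by omega)
  obtain ⟨u, p, hu0, hp0, hp⟩ := exists_top g hg0 ⟨i0, by simp⟩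
  set ui := u ⟨i0, by simp⟩ with hui
  let w : Fin n → ℂ := fun a => if h : (a : ℕ) < i0 then u ⟨a, by omega⟩ / ui else 0
  let e : Fin n → ℂ := Pi.single i0 1
  have hwe : dotProduct e w = 0 := by simp [e, w]
  refine Gen.shear (1 - Matrix.vecMulVec w e) (1 + Matrix.vecMulVec w e) ?_ ?_
  · rw [sub_mul, one_mul, mul_add, mul_one, Matrix.vecMulVec_mul_vecMulVec, hwe]
    simp
  have hG2 : Gen (fun N η => eval (Sum.elim (fun q => N q.1 q.2) η) p ≠ 0) := ⟨p, hp0, fun N η h => h⟩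
  refine (h.and hG2).mono ?_
  rintro N η ⟨hI, hN⟩ hR
  set M0 := (1 - Matrix.vecMulVec w e) with hM0
  have hsub : Kset F d (i0 + 1) (M0 * N) η ⊆ Kset F d (i0 + 1) N η := by
    apply Kset_shear F d (i0 + 1) N M0 (1 + Matrix.vecMulVec w e)
    · rw [hM0, sub_mul, one_mul, mul_add, mul_one, Matrix.vecMulVec_mul_vecMulVec, hwe]
      simp
    · intro a b ha hb
      have hab : a ≠ b := by rintro rfl; omega
      have hb0 : b ≠ i0 := by rintro rfl; omega
      simp [M0, Matrix.vecMulVec, e, hab, hb0]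
  have hI' : IntC (Kset F d (i0 + 1) (M0 * N) η) N (i0 + 1) :=
    (hI hR).sub (hsub.trans (Kset_succ F d (i0 + 1) N η))
  set K := Kset F d (i0 + 1) (M0 * N) η
  let x : Fin n → K → ℂ := fun l z => N.mulVec z.1 l
  have hMx : ∀ (z : Fin n → ℂ) l, (M0 * N).mulVec z l = N.mulVec z l - w l * N.mulVec z i0 := by
    intro z l
    rw [← Matrix.mulVec_mulVec, hM0, Matrix.sub_mulVec, Matrix.one_mulVec, Matrix.vecMulVec_mulVec]
    simp [e, mul_comm]
  let S := coordAlg K (M0 * N) i0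
  let T : K → ℂ := ui⁻¹ • x i0
  let b : {l : Fin n // (l : ℕ) < i0 + 1} → K → ℂ := fun l => if (l.1 : ℕ) < i0 then fun z => (M0 * N).mulVec z.1 l else 0
  have hxb : ∀ l : {l : Fin n // (l : ℕ) < i0 + 1}, x l = b l + u l • T := by
    rintro ⟨l, hl⟩
    funext z
    by_cases hli : (l : ℕ) < i0
    · simp only [b, if_pos hli, x, T, Pi.add_apply, Pi.smul_apply, hMx, w, dif_pos hli, smul_eq_mul]
      ring
    · have : l = i0 := Fin.ext (by omega)
      subst this
      simp only [b, if_neg hli, x, T, Pi.add_apply, Pi.smul_apply, smul_eq_mul]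
      simp [← hui, hu0]
  have hb : ∀ l, b l ∈ S := by
    intro l
    simp only [b]
    split_ifs with h
    · exact Algebra.subset_adjoin ⟨l, h, rfl⟩
    · exact Subalgebra.zero_mem _
  have hT : IsIntegral S T := by
    refine isIntegral_of_top S b hb T u (MvPolynomial.map (eval (Sum.elim (fun q => N q.1 q.2) η)) g) g.totalDegree ?_ ?_ ?_
    · exact Finset.sup_mono (support_map_subset _ _)
    · rw [← hp]; exact hN
    · simp_rw [← hxb]
      funext z
      have := hg N η hR z.1 (hsub z.2)
      rw [Pi.zero_apply, ← this, ← aeval_eq_eval]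
      change (Pi.evalAlgHom ℂ (fun _ : K => ℂ) z).comp (aeval _) _ = _
      refine DFunLike.congr_fun ?_ _
      ext v
      simp [x]
  intro m
  refine isIntegral_trans_sub S (coordAlg K N (i0 + 1)) ?_ _ (hI' m)
  intro a ha
  have hle : coordAlg K N (i0 + 1) ≤ ((integralClosure S (K → ℂ)).restrictScalars ℂ) := by
    apply Algebra.adjoin_le
    rintro _ ⟨l, hl, rfl⟩
    change IsIntegral S (x l)
    rw [hxb ⟨l, hl⟩]
    refine IsIntegral.add (isIntegral_algebraMap (R := S) (x := ⟨_, hb _⟩)) ?_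
    exact hT.smul (u ⟨l, hl⟩)
  exact hle ha

theorem int_all {n t s d : ℕ} (F : Fin s → MvPolynomial (Fin n ⊕ Fin t) ℂ)
    (hE : EquidimIdeal (Ideal.span (Set.range F)) (d + t)) (hdn : d ≤ n) (j : ℕ) (hj : j ≤ n) :
    Gen (fun N η => RankCond F d η → IntC (Kset F d (n - j + 1) N η) N (n - j)) := by
  induction j with
  | zero => exact int_top F _
  | succ j ih =>
    have := ih (by omega)
    have e : n - j = (n - (j + 1)) + 1 := by omega
    rw [e] at this
    exact int_step F hE hdn ⟨n - (j + 1), by omega⟩ this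


/-- a chart is good if the selected gradients are independent at some point -/
def GoodChart {n t s r : ℕ} (F : Fin s → MvPolynomial (Fin n ⊕ Fin t) ℂ) (P : Ideal (MvPolynomial (Fin n ⊕ Fin t) ℂ))
    (J : Fin r → Fin s) : Prop :=
  ∃ p, P ≤ mPt p ∧ LinearIndependent ℂ (fun j => gx F p (J j))

def chM {n t s : ℕ} (F : Fin s → MvPolynomial (Fin n ⊕ Fin t) ℂ) (P : Ideal (MvPolynomial (Fin n ⊕ Fin t) ℂ))
    (k : Fin n) (i r : ℕ) (J : Fin r → Fin s) : {l : Fin n // l ≠ k ∧ (l : ℕ) < i} ⊕ Fin r → Fin n → chartS P k i r :=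
  Sum.elim (fun l m => - X (Sum.inl (⟨l, l.2.1⟩, m))) (fun j m => C (Ideal.Quotient.mk P (pderiv (Sum.inl m) (F (J j)))))

theorem exists_extend {n r : ℕ} {L : Type} [Fintype L] (v : Fin r → Fin n → ℂ) (hv : LinearIndependent ℂ v) (hL : Fintype.card L + r ≤ n) :
    ∃ w : L → Fin n → ℂ, LinearIndependent ℂ (Sum.elim w v) := by
  classical
  let U := Submodule.span ℂ (Set.range v)
  have hU : Module.finrank ℂ U = r := by rw [finrank_span_eq_card hv]; simp
  have hq : Module.finrank ℂ ((Fin n → ℂ) ⧸ U) = n - r := by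
    have := Submodule.finrank_quotient_add_finrank U
    rw [hU, Module.finrank_fin_fun] at this
    omega
  let b := Module.finBasisOfFinrankEq ℂ _ hq
  obtain ⟨e⟩ : Nonempty (L ↪ Fin (n - r)) := Function.Embedding.nonempty_of_card_le (by simp; omega)
  have hb := b.linearIndependent.comp e e.injective
  choose w hw using fun l => Submodule.mkQ_surjective U (b (e l))
  refine ⟨w, ?_⟩
  have h1 := LinearIndependent.sumElim_of_quotient (M' := U) (f := fun j => ⟨v j, Submodule.subset_span ⟨j, rfl⟩⟩)
    (by exact LinearIndependent.of_comp U.subtype hv) w (by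
      have : (Submodule.Quotient.mk (p := U)) ∘ w = b ∘ e := funext hw
      rw [this]; exact hb)
  have h2 := h1.comp (Sum.swap : L ⊕ Fin r → _) Sum.swap_leftInverse.injective
  have e : Sum.elim w v = Sum.elim (fun x => v x) w ∘ Sum.swap := by
    funext x
    rcases x with x | x <;> rfl
  rw [e]
  exact h2

theorem det_ne_of_eval {A ρ : Type*} [CommRing A] [Algebra ℂ A] [Fintype ρ] [DecidableEq ρ] (ψ : A →ₐ[ℂ] ℂ) (M : Matrix ρ ρ A)
    (h : (Matrix.of fun a b => ψ (M a b)).det ≠ 0) : M.det ≠ 0 := by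
  intro h0
  apply h
  have := congrArg ψ h0
  rw [map_zero, AlgHom.map_det] at this
  exact this

theorem chart_minor {n t s d : ℕ} (F : Fin s → MvPolynomial (Fin n ⊕ Fin t) ℂ) (P : Ideal (MvPolynomial (Fin n ⊕ Fin t) ℂ))
    (k : Fin n) (i : ℕ) (hki : (k : ℕ) < i) (hid : i ≤ d) (hdn : d ≤ n) (J : Fin (n - d) → Fin s) (hG : GoodChart F P J) :
    ∃ c : {l : Fin n // l ≠ k ∧ (l : ℕ) < i} ⊕ Fin (n - d) → Fin n,
      (Matrix.of fun a b => chM F P k i (n - d) J a (c b)).det ≠ 0 := by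
  classical
  obtain ⟨p, hp, hJ⟩ := hG
  have hcard : Fintype.card {l : Fin n // l ≠ k ∧ (l : ℕ) < i} + (n - d) ≤ n := by
    have : Fintype.card {l : Fin n // l ≠ k ∧ (l : ℕ) < i} ≤ i := by
      have e : Fintype.card {l : Fin n // (l : ℕ) < i} = i := by
        rw [Fintype.card_congr (Fin.castLEquiv (hid.trans hdn)).symm]; simp
      conv_rhs => rw [← e]
      exact Fintype.card_subtype_mono _ _ (fun l hl => hl.2) 
    omega
  obtain ⟨w, hw⟩ := exists_extend (L := {l : Fin n // l ≠ k ∧ (l : ℕ) < i}) _ hJ hcard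
  obtain ⟨c, hc⟩ := exists_minor _ hw
  refine ⟨c, ?_⟩
  let ψ0 : (MvPolynomial (Fin n ⊕ Fin t) ℂ ⧸ P) →ₐ[ℂ] ℂ := Ideal.Quotient.liftₐ P (aeval p) (fun a ha => by
    rw [aeval_eq_eval]; exact (mem_mPt _ _).1 (hp ha))
  have h0' : ∀ q, ψ0 (Ideal.Quotient.mk P q) = eval p q := fun q => by
    simp [ψ0, aeval_eq_eval]
  let ψ : chartS P k i (n - d) →ₐ[ℂ] ℂ := aevalTower ψ0 (Sum.elim
    (fun q => if h : (q.1 : Fin n) ≠ k ∧ ((q.1 : Fin n) : ℕ) < i then - w ⟨q.1, h⟩ q.2 else 0) 0)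
  refine det_ne_of_eval ψ _ ?_
  have e : (Matrix.of fun a b => ψ ((Matrix.of (fun a b => chM F P k i (n - d) J a (c b))) a b)) =
      Matrix.of fun a b => Sum.elim w (fun j => gx F p (J j)) a (c b) := by
    funext a b
    rcases a with ⟨a, ha⟩ | a
    · have h1 : ψ (- X (Sum.inl (⟨a, ha.1⟩, c b))) = w ⟨a, ha⟩ (c b) := by
        rw [map_neg]
        simp [ψ, ha]
      exact h1
    · have h1 : ψ (C (Ideal.Quotient.mk P (pderiv (Sum.inl (c b)) (F (J a))))) = gx F p (J a) (c b) := by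
        simp [ψ, h0', gx]
      exact h1
  rw [e]
  exact hc

theorem cramer_alg {A ρ κ : Type*} [CommRing A] [Algebra ℂ A] [Fintype ρ] [DecidableEq ρ] (R : Subalgebra ℂ A)
    (M : ρ → κ → A) (hM : ∀ a m, M a m ∈ R) (w : ρ → A) (v : κ → A) (hv : ∀ m, v m ∈ R)
    (hw : ∀ m, ∑ a, w a * M a m = v m) (c : ρ → κ) (hc : (Matrix.of fun a b => M a (c b)).det ≠ 0) (a : ρ) :
    IsAlgebraic R (w a) := by
  set M' : Matrix ρ ρ A := Matrix.of fun a b => M a (c b) with hM'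
  let MR : Matrix ρ ρ R := Matrix.of fun a b => ⟨M a (c b), hM _ _⟩
  have hMM : M' = R.val.mapMatrix MR := rfl
  have hw : Matrix.vecMul w M' = fun b => v (c b) := funext fun b => hw (c b)
  have hdet : M'.det ∈ R := by
    rw [hMM, ← AlgHom.map_det]; exact (MR.det).2
  have hδ : ∀ a, M'.det * w a ∈ R := by
    intro a
    have h1 : Matrix.vecMul (Matrix.vecMul w M') M'.adjugate = M'.det • w := by
      rw [Matrix.vecMul_vecMul, Matrix.mul_adjugate, Matrix.vecMul_smul, Matrix.vecMul_one]
    have h2 := congrFun h1 a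
    rw [Pi.smul_apply, smul_eq_mul] at h2
    rw [← h2, hw, Matrix.vecMul, dotProduct]
    refine R.sum_mem fun b _ => R.mul_mem (hv _) ?_
    rw [hMM, ← AlgHom.map_adjugate]
    exact (MR.adjugate b a).2
  refine ⟨Polynomial.C ⟨M'.det, hdet⟩ * Polynomial.X - Polynomial.C ⟨_, hδ a⟩, fun h => ?_, ?_⟩
  · have := congrArg (fun p => Polynomial.coeff p 1) h
    simp [Polynomial.coeff_C] at this
    exact hc (congrArg Subtype.val this)
  · simp [Algebra.algebraMap_eq_smul_one, Subalgebra.smul_def]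

theorem alg_of_gen {A : Type*} [CommRing A] [IsDomain A] [Algebra ℂ A] (R : Subalgebra ℂ A) (G : Set A)
    (hG : Algebra.adjoin ℂ G = ⊤) (h : ∀ g ∈ G, IsAlgebraic R g) : Algebra.IsAlgebraic R A := by
  constructor
  intro x
  have hx : x ∈ Algebra.adjoin ℂ G := by rw [hG]; trivial
  induction hx using Algebra.adjoin_induction with
  | mem x hx => exact h x hx
  | algebraMap r => exact isAlgebraic_algebraMap (R := R) (A := A) (⟨_, R.algebraMap_mem r⟩ : R)
  | add x y _ _ hx hy => exact hx.add hy
  | mul x y _ _ hx hy => exact hx.mul hy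

def DimLB {n : ℕ} (K : Set (Fin n → ℂ)) (m : ℕ) : Prop :=
  ∃ h : Fin m → MvPolynomial (Fin n) ℂ, ∀ q : MvPolynomial (Fin m) ℂ,
    (∀ z ∈ K, eval (fun a => eval z (h a)) q = 0) → q = 0

theorem exists_sub_indep {A B Z : Type} [CommRing A] [IsDomain A] [Algebra ℂ A] [Finite B] [Finite Z] (a : B → A) (z : Z → A) (m : ℕ)
    (htr : Algebra.trdeg ℂ A = ((Nat.card B + m : ℕ) : Cardinal))
    (ha : AlgebraicIndependent ℂ a) (R : Subalgebra ℂ A) (hR : R = Algebra.adjoin ℂ (Set.range a ∪ Set.range z))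
    (halg : Algebra.IsAlgebraic R A) :
    ∃ e : Fin m → Z, AlgebraicIndependent ℂ (Sum.elim (fun q => z (e q)) a) := by
  classical
  subst hR
  obtain ⟨u, hsu, hut, hu⟩ := exists_isTranscendenceBasis_between (R := ℂ) (Set.range a) (Set.range a ∪ Set.range z)
    Set.subset_union_left (AlgebraicIndependent.to_subtype_range ha)
  have hcard := hu.cardinalMk_eq_trdeg
  rw [htr] at hcard
  have hufin : u.Finite := ((Set.finite_range a).union (Set.finite_range z)).subset hut
  haveI := hufin.fintype
  have hucard : u.ncard = Nat.card B + m := by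
    rw [Set.ncard_eq_toFinset_card' , Set.toFinset_card]
    rw [Cardinal.mk_fintype] at hcard
    exact_mod_cast hcard
  have hsc : (Set.range a).ncard = Nat.card B := by
    rw [← Set.image_univ, Set.ncard_image_of_injective _ (AlgebraicIndependent.injective ha), Set.ncard_univ]
  have hdiff : (u \ Set.range a).ncard = m := by
    rw [Set.ncard_diff hsu (Set.finite_range a), hucard, hsc]; omega
  have hdf : (u \ Set.range a).Finite := hufin.subset Set.diff_subset
  obtain ⟨E⟩ : Nonempty (Fin m ≃ ↥(u \ Set.range a)) := by
    haveI := hdf.fintype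
    refine ⟨(Fintype.equivFinOfCardEq ?_).symm⟩
    rw [← hdiff, Set.ncard_eq_toFinset_card', Set.toFinset_card]
  have hE : ∀ q, ∃ j, z j = (E q : A) := by
    intro q
    rcases hut (E q).2.1 with h | h
    · exact absurd h (E q).2.2
    · exact h
  choose e he using hE
  refine ⟨e, ?_⟩
  let κ : Fin m ⊕ B → u := Sum.elim (fun q => ⟨E q, (E q).2.1⟩) (fun b => ⟨a b, hsu ⟨b, rfl⟩⟩)
  have hκ : Function.Injective κ := by
    rintro (x | x) (y | y) hxy
    · have := congrArg Subtype.val hxy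
      exact congrArg _ (E.injective (Subtype.ext this))
    · have := congrArg Subtype.val hxy
      exact absurd ⟨y, this.symm⟩ (E x).2.2
    · have := congrArg Subtype.val hxy
      exact absurd ⟨x, this⟩ (E y).2.2
    · have := congrArg Subtype.val hxy
      exact congrArg _ ((AlgebraicIndependent.injective ha) this)
  have := hu.1.comp κ hκ
  convert this using 1
  funext x
  rcases x with x | x
  · exact he x
  · rfl

theorem LB_of_indep {n t m : ℕ} {A : Type} [CommRing A] [IsDomain A] [Algebra ℂ A] [Algebra.FiniteType ℂ A]
    (cN : Fin n → Fin n → A) (cY : Fin t → A) (cZ : Fin n → A) (e : Fin m → Fin n)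
    (hind : AlgebraicIndependent ℂ (Sum.elim (fun q => cZ (e q)) (Sum.elim (fun q : Fin n × Fin n => cN q.1 q.2) cY)))
    (K : Matrix (Fin n) (Fin n) ℂ → (Fin t → ℂ) → Set (Fin n → ℂ))
    (hpt : ∀ ψ : A →ₐ[ℂ] ℂ, (fun m => ψ (cZ m)) ∈ K (Matrix.of fun a b => ψ (cN a b)) (fun l => ψ (cY l))) :
    Gen (fun N η => DimLB (K N η) m) := by
  obtain ⟨h, hh0, hh⟩ := exists_generic_lift (aeval _) hind
  have h1 : sumAlgEquiv ℂ _ _ h ≠ 0 := by rwa [Ne, EmbeddingLike.map_eq_zero_iff]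
  obtain ⟨m0, hm0⟩ := exists_coeff_ne_zero h1
  refine ⟨_, hm0, fun N η hN => ⟨fun q => X (e q), fun q hq => ?_⟩⟩
  set hN' := MvPolynomial.map (eval (Sum.elim (fun q : Fin n × Fin n => N q.1 q.2) η)) (sumAlgEquiv ℂ _ _ h) with hNdef
  have hN0 : hN' ≠ 0 := by
    intro h0
    apply hN
    rw [← coeff_map, ← hNdef, h0, coeff_zero]
  have : q * hN' = 0 := by
    apply MvPolynomial.funext
    intro ζ
    rw [map_mul, map_zero]
    by_cases hζ : eval ζ hN' = 0
    · rw [hζ, mul_zero]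
    · rw [hNdef, eval_sumAlgEquiv] at hζ
      obtain ⟨ψ, hψ⟩ := hh _ hζ
      have h2 := hpt ψ
      have e1 : (Matrix.of fun a b => ψ (cN a b)) = N := by
        ext a b
        have := hψ (Sum.inr (Sum.inl (a, b)))
        simpa using this
      have e2 : (fun l => ψ (cY l)) = η := by
        ext l
        have := hψ (Sum.inr (Sum.inr l))
        simpa using this
      rw [e1, e2] at h2
      have h3 := hq _ h2
      have e3 : (fun a => eval (fun m => ψ (cZ m)) (X (e a) : MvPolynomial (Fin n) ℂ)) = ζ := by
        ext a
        have := hψ (Sum.inl a)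
        simpa using this
      rw [e3] at h3
      rw [h3, zero_mul]
  rcases mul_eq_zero.1 this with h | h
  · exact h
  · exact absurd h hN0

theorem LB_abs {n t i : ℕ} (h1 : 1 ≤ i) {A : Type} [CommRing A] [IsDomain A] [Algebra ℂ A] [Algebra.FiniteType ℂ A]
    (cN : Fin n → Fin n → A) (cY : Fin t → A) (cZ : Fin n → A)
    (hdim : ringKrullDim A = ((n * n + t + i - 1 : ℕ) : WithBot ℕ∞))
    (hinj : Function.Injective (aeval (Sum.elim (fun q : Fin n × Fin n => cN q.1 q.2) cY) : MvPolynomial ((Fin n × Fin n) ⊕ Fin t) ℂ →ₐ[ℂ] A))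
    {ρ : Type} [Fintype ρ] [DecidableEq ρ] (M : ρ → Fin n → A) (w : ρ → A)
    (hM : ∀ R : Subalgebra ℂ A, (∀ a b, cN a b ∈ R) → (∀ l, cY l ∈ R) → (∀ l, cZ l ∈ R) → ∀ a m, M a m ∈ R)
    (htop : ∀ R : Subalgebra ℂ A, (∀ a b, cN a b ∈ R) → (∀ l, cY l ∈ R) → (∀ l, cZ l ∈ R) → (∀ a, w a ∈ R) → R = ⊤)
    (k : Fin n) (hw : ∀ m, ∑ a, w a * M a m = cN k m) (c : ρ → Fin n) (hc : (Matrix.of fun a b => M a (c b)).det ≠ 0)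
    (K : Matrix (Fin n) (Fin n) ℂ → (Fin t → ℂ) → Set (Fin n → ℂ))
    (hpt : ∀ ψ : A →ₐ[ℂ] ℂ, (fun m => ψ (cZ m)) ∈ K (Matrix.of fun a b => ψ (cN a b)) (fun l => ψ (cY l))) :
    Gen (fun N η => DimLB (K N η) (i - 1)) := by
  set a : (Fin n × Fin n) ⊕ Fin t → A := Sum.elim (fun q : Fin n × Fin n => cN q.1 q.2) cY with ha
  set R := Algebra.adjoin ℂ (Set.range a ∪ Set.range cZ) with hR
  have hN : ∀ p q, cN p q ∈ R := fun p q => Algebra.subset_adjoin (Or.inl ⟨Sum.inl (p, q), rfl⟩)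
  have hY : ∀ l, cY l ∈ R := fun l => Algebra.subset_adjoin (Or.inl ⟨Sum.inr l, rfl⟩)
  have hZ : ∀ l, cZ l ∈ R := fun l => Algebra.subset_adjoin (Or.inr ⟨l, rfl⟩)
  have halg : Algebra.IsAlgebraic R A := by
    refine alg_of_gen R ((R : Set A) ∪ Set.range w) ?_ ?_
    · have hle : R ≤ Algebra.adjoin ℂ ((R : Set A) ∪ Set.range w) := fun x hx => Algebra.subset_adjoin (Or.inl hx)
      exact htop _ (fun p q => hle (hN p q)) (fun l => hle (hY l)) (fun l => hle (hZ l))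
        (fun a => Algebra.subset_adjoin (Or.inr ⟨a, rfl⟩))
    · rintro g (hg | ⟨x, rfl⟩)
      · exact isAlgebraic_algebraMap (R := R) (A := A) (⟨_, hg⟩ : R)
      · exact cramer_alg R M (hM R hN hY hZ) w _ (fun m => hN k m) hw c hc x
  obtain ⟨m, hm, htr⟩ := dim_eq_trdeg ℂ A
  have hm' : m = n * n + t + i - 1 := by
    rw [hdim] at hm
    exact_mod_cast hm.symm
  have hcardB : Nat.card ((Fin n × Fin n) ⊕ Fin t) = n * n + t := by simp
  obtain ⟨e, he⟩ := exists_sub_indep a cZ (i - 1) (by rw [htr, hcardB, hm']; congr 1; omega) hinj R rfl halg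
  exact LB_of_indep cN cY cZ e he K hpt


theorem ch_C_mem {n t : ℕ} (P : Ideal (MvPolynomial (Fin n ⊕ Fin t) ℂ)) (k : Fin n) (i r : ℕ)
    (R : Subalgebra ℂ (chartS P k i r)) (hY : ∀ l, chY P k i r l ∈ R) (hZ : ∀ l, chZ P k i r l ∈ R)
    (p : MvPolynomial (Fin n ⊕ Fin t) ℂ) : C (Ideal.Quotient.mk P p) ∈ R := by
  induction p using MvPolynomial.induction_on with
  | C a =>
    have := R.algebraMap_mem a
    exact this
  | add p q hp hq => rw [map_add, map_add]; exact R.add_mem hp hq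
  | mul_X p v hp =>
    rw [map_mul, map_mul]
    refine R.mul_mem hp ?_
    rcases v with v | v
    · exact hZ v
    · exact hY v

theorem chN_inl_mem {n t s : ℕ} (F : Fin s → MvPolynomial (Fin n ⊕ Fin t) ℂ) (P : Ideal (MvPolynomial (Fin n ⊕ Fin t) ℂ)) (k : Fin n) (i r : ℕ)
    (J : Fin r → Fin s)
    (R : Subalgebra ℂ (chartS P k i r)) (hN : ∀ a b, chN F P k i r J a b ∈ R) (q : {l : Fin n // l ≠ k} × Fin n) :
    (X (Sum.inl q) : chartS P k i r) ∈ R := by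
  have := hN q.1 q.2
  rw [chN, dif_pos q.1.2] at this
  exact this

theorem neg_mem_abs {A : Type*} [CommRing A] [Algebra ℂ A] (R : Subalgebra ℂ A) {x : A} (h : x ∈ R) : -x ∈ R := R.neg_mem h

theorem sum_abs {A ι κ : Type*} [CommRing A] [Fintype ι] [Fintype κ] (x y : ι → A) (u v : κ → A) :
    ∑ a, x a * -y a + ∑ a, u a * v a = ∑ a, u a * v a - ∑ a, x a * y a := by
  simp only [mul_neg, Finset.sum_neg_distrib]
  rw [neg_add_eq_sub]

set_option maxHeartbeats 1000000 in
theorem chart_LB {n t s d : ℕ} (F : Fin s → MvPolynomial (Fin n ⊕ Fin t) ℂ) (P : Ideal (MvPolynomial (Fin n ⊕ Fin t) ℂ))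
    [P.IsPrime] (hFP : ∀ j, F j ∈ P)
    (hP : ringKrullDim (MvPolynomial (Fin n ⊕ Fin t) ℂ ⧸ P) = ((d + t : ℕ) : WithBot ℕ∞))
    (k : Fin n) (i : ℕ) (hki : (k : ℕ) < i) (hid : i ≤ d) (hdn : d ≤ n) (J : Fin (n - d) → Fin s) (hG : GoodChart F P J)
    (hinj : Function.Injective (aeval (Sum.elim (fun q : Fin n × Fin n => chN F P k i (n - d) J q.1 q.2) (chY P k i (n - d))) :
      MvPolynomial ((Fin n × Fin n) ⊕ Fin t) ℂ →ₐ[ℂ] chartS P k i (n - d))) :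
    Gen (fun N η => DimLB (Kset F d i N η) (i - 1)) := by
  classical
  obtain ⟨c, hc⟩ := chart_minor F P k i hki hid hdn J hG
  refine LB_abs (by omega) (chN F P k i (n - d) J) (chY P k i (n - d)) (chZ P k i (n - d)) (dim_chart P k i d hki hid hdn hP) hinj
    (chM F P k i (n - d) J) (fun a => X (Sum.inr a)) ?_ ?_ k ?_ c hc _ (fun ψ => chart_pt F P hFP k d i _ hki J ψ)
  · intro R hN hY hZ a m
    rcases a with a | a
    · have h := chN_inl_mem F P k i _ J R hN (⟨a, a.2.1⟩, m)
      exact neg_mem_abs (A := chartS P k i (n - d)) R h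
    · exact ch_C_mem P k i _ R hY hZ _
  · intro R hN hY hZ hw
    rw [eq_top_iff]
    rintro p -
    induction p using MvPolynomial.induction_on with
    | C a =>
      obtain ⟨a, rfl⟩ := Ideal.Quotient.mk_surjective a
      exact ch_C_mem P k i _ R hY hZ _
    | add p q hp hq => exact R.add_mem hp hq
    | mul_X p v hp =>
      refine R.mul_mem hp ?_
      rcases v with v | v
      · exact chN_inl_mem F P k i _ J R hN v
      · exact hw v
  · intro m
    rw [Fintype.sum_sum_type, chN, dif_neg (by simp)]
    exact sum_abs _ _ _ _

theorem LB_le {n t s d : ℕ} (F : Fin s → MvPolynomial (Fin n ⊕ Fin t) ℂ) (hdn : d ≤ n)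
    (hE : EquidimIdeal (Ideal.span (Set.range F)) (d + t)) (i : ℕ) (hi : i ≤ d) :
    Gen (fun N η => RankCond F d η → Kset F d i N η = ∅ ∨ DimLB (Kset F d i N η) (i - 1)) := by
  classical
  by_cases hex : ∃ (P : Ideal (MvPolynomial (Fin n ⊕ Fin t) ℂ)) (k : Fin n) (J : Fin (n - d) → Fin s),
      P ∈ (Ideal.span (Set.range F)).minimalPrimes ∧ (k : ℕ) < i ∧ GoodChart F P J ∧
      Function.Injective (aeval (Sum.elim (fun q : Fin n × Fin n => chN F P k i (n - d) J q.1 q.2) (chY P k i (n - d))) :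
      MvPolynomial ((Fin n × Fin n) ⊕ Fin t) ℂ →ₐ[ℂ] chartS P k i (n - d))
  · obtain ⟨P, k, J, hP, hki, hG, hinj⟩ := hex
    haveI : P.IsPrime := hP.1.1
    refine (chart_LB F P (fun j => hP.1.2 (Ideal.subset_span ⟨j, rfl⟩)) (hE P hP) k i hki hi hdn J hG hinj).mono ?_
    intro N η h _
    exact Or.inr h
  · push Not at hex
    have hfin : (Ideal.span (Set.range F)).minimalPrimes.Finite := Ideal.finite_minimalPrimes_of_isNoetherianRing _ _
    let T : Finset (Ideal (MvPolynomial (Fin n ⊕ Fin t) ℂ) × Fin n × (Fin (n - d) → Fin s)) :=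
      hfin.toFinset ×ˢ Finset.univ
    have := Gen.finite (n := n) (t := t) T (Q := fun c N η => (c.2.1 : ℕ) < i → GoodChart F c.1 c.2.2 →
        ∀ ψ : chartS c.1 c.2.1 i (n - d) →ₐ[ℂ] ℂ, (∀ a b, ψ (chN F c.1 c.2.1 i (n - d) c.2.2 a b) = N a b) →
          (∀ l, ψ (chY c.1 c.2.1 i (n - d) l) = η l) → False) (by
      rintro ⟨P, k, J⟩ hT
      have hP : P ∈ (Ideal.span (Set.range F)).minimalPrimes := by simpa [T] using hT
      by_cases hki : (k : ℕ) < i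
      swap
      · exact ⟨1, one_ne_zero, fun N η _ h => absurd h hki⟩
      by_cases hG : GoodChart F P J
      swap
      · exact ⟨1, one_ne_zero, fun N η _ _ h => absurd h hG⟩
      have h := hex P k J hP hki hG
      rw [injective_iff_map_eq_zero] at h
      push Not at h
      obtain ⟨q, hq, hq0⟩ := h
      refine ⟨q, hq0, fun N η hN _ _ ψ h1 h2 => hN ?_⟩
      have h3 := congrArg ψ hq
      rw [map_zero, ← AlgHom.comp_apply, MvPolynomial.comp_aeval, aeval_eq_eval] at h3
      convert h3 using 2
      congr 1
      funext v
      rcases v with v | v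
      · exact (h1 v.1 v.2).symm
      · exact (h2 v).symm)
    refine this.mono ?_
    intro N η h hR
    left
    rw [Set.eq_empty_iff_forall_notMem]
    intro z hz
    obtain ⟨P, k, J, hP, hki, hPm, hlin, ψ, h1, h2, h3⟩ := chart_cover F d i hi hdn N η hR z hz
    exact h (P, k, J) (by simpa [T] using hP) hki ⟨_, hPm, hlin⟩ ψ (by simpa using h1) (by simpa using h2)


theorem Kset_top {n t s d : ℕ} (F : Fin s → MvPolynomial (Fin n ⊕ Fin t) ℂ) (N : Matrix (Fin n) (Fin n) ℂ) (η : Fin t → ℂ) :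
    Kset F d (d + 1) N η = zLocus (Set.range fun j => specY η (F j)) := by
  ext z
  rw [mem_zLocus_range]
  simp only [eval_specY]
  constructor
  · intro h; exact h.1
  · intro h; exact ⟨h, fun h => by omega⟩

theorem LB_top {n t s d : ℕ} (F : Fin s → MvPolynomial (Fin n ⊕ Fin t) ℂ)
    (hE : EquidimIdeal (Ideal.span (Set.range F)) (d + t)) (N : Matrix (Fin n) (Fin n) ℂ) (η : Fin t → ℂ) (hR : RankCond F d η) :
    Kset F d (d + 1) N η = ∅ ∨ DimLB (Kset F d (d + 1) N η) d := by
  obtain ⟨hrad, hG⟩ := goodSpec_of_rank F hE η hR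
  rw [Kset_top]
  rcases hG with hG | ⟨hG, -⟩
  · exact Or.inl hG
  by_cases hne : zLocus (Set.range fun j => specY η (F j)) = ∅
  · exact Or.inl hne
  right
  have hv := vIdeal_zLocus_of_radical _ hrad
  set I := Ideal.span (Set.range fun j => specY η (F j)) with hI
  obtain ⟨z, hz⟩ := Set.nonempty_iff_ne_empty.2 hne
  have hI1 : I ≤ mPt z := by
    rw [← hv]
    intro p hp
    exact (mem_mPt _ _).2 (hp z hz)
  have hprime : (mPt z).IsPrime := inferInstance
  obtain ⟨P, hP, -⟩ := Ideal.exists_minimalPrimes_le hI1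
  haveI : P.IsPrime := hP.1.1
  obtain ⟨m, g, hg, -, hm⟩ := exists_noether ℂ (MvPolynomial (Fin n) ℂ ⧸ P)
  have hmd : m = d := by
    have := hG P hP
    have h2 := hm.symm.trans this
    change (m : WithBot ℕ∞) = (d : WithBot ℕ∞) at h2
    exact_mod_cast h2
  subst hmd
  choose h hh using fun a => Ideal.Quotient.mk_surjective (I := P) (g (X a))
  refine ⟨h, fun q hq => ?_⟩
  have h1 : aeval h q ∈ I := by
    rw [← hv]
    intro x hx
    rw [← hq x hx]
    rw [← aeval_eq_eval, ← aeval_eq_eval]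
    change ((aeval x).comp (aeval h)) q = _
    rw [comp_aeval]
  have h2 := hP.1.2 h1
  rw [← Ideal.Quotient.eq_zero_iff_mem] at h2
  apply hg
  rw [map_zero, ← h2]
  change g q = ((Ideal.Quotient.mkₐ ℂ P).comp (aeval h)) q
  refine DFunLike.congr_fun ?_ _
  ext a
  simp [hh]


def sA {n : ℕ} (A : Matrix (Fin n) (Fin n) ℂ) : MvPolynomial (Fin n) ℂ →ₐ[ℂ] MvPolynomial (Fin n) ℂ :=
  aeval (fun j => ∑ k, C (A j k) * X k)

theorem eval_sA {n : ℕ} (A : Matrix (Fin n) (Fin n) ℂ) (x : Fin n → ℂ) (p : MvPolynomial (Fin n) ℂ) :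
    eval x (sA A p) = eval (A.mulVec x) p := by
  rw [← aeval_eq_eval, ← aeval_eq_eval]
  change ((aeval x).comp (sA A)) p = _
  refine DFunLike.congr_fun ?_ _
  ext a
  simp [sA, Matrix.mulVec, dotProduct, aeval_eq_eval]

theorem specY_chgX {n t : ℕ} (A : Matrix (Fin n) (Fin n) ℂ) (η : Fin t → ℂ) (p : MvPolynomial (Fin n ⊕ Fin t) ℂ) :
    specY η (chgX A p) = sA A (specY η p) := by
  apply MvPolynomial.funext
  intro x
  rw [eval_sA, eval_specY, eval_specY]
  have hC : ∀ a, chgX A (C a : MvPolynomial (Fin n ⊕ Fin t) ℂ) = C a := fun a => by simp [chgX]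
  have hXl : ∀ a, chgX A (X (Sum.inl a) : MvPolynomial (Fin n ⊕ Fin t) ℂ) = ∑ k, C (A a k) * X (Sum.inl k) := fun a => by simp [chgX]
  have hXr : ∀ a, chgX A (X (Sum.inr a) : MvPolynomial (Fin n ⊕ Fin t) ℂ) = X (Sum.inr a) := fun a => by simp [chgX]
  have hadd : ∀ p q : MvPolynomial (Fin n ⊕ Fin t) ℂ, chgX A (p + q) = chgX A p + chgX A q := fun p q => by simp [chgX]
  have hmul : ∀ p q : MvPolynomial (Fin n ⊕ Fin t) ℂ, chgX A (p * q) = chgX A p * chgX A q := fun p q => by simp [chgX]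
  induction p using MvPolynomial.induction_on with
  | C a => rw [hC, eval_C, eval_C]
  | add p q hp hq => rw [hadd, map_add, map_add, hp, hq]
  | mul_X p v hp =>
    rw [hmul, map_mul, map_mul, hp]
    congr 1
    rcases v with v | v
    · rw [hXl, map_sum]
      simp [Matrix.mulVec, dotProduct]
    · rw [hXr]
      simp

theorem sA_inv {n : ℕ} (A N : Matrix (Fin n) (Fin n) ℂ) (h : N * A = 1) (p : MvPolynomial (Fin n) ℂ) :
    sA A (sA N p) = p := by
  apply MvPolynomial.funext
  intro x
  rw [eval_sA, eval_sA, Matrix.mulVec_mulVec, h, Matrix.one_mulVec]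

theorem polyDiff_sA {n : ℕ} (A : Matrix (Fin n) (Fin n) ℂ) (x v : Fin n → ℂ) (p : MvPolynomial (Fin n) ℂ) :
    polyDiff x (sA A p) v = polyDiff (A.mulVec x) p (A.mulVec v) := by
  have hadd : ∀ (y w : Fin n → ℂ) p q, polyDiff y (p + q) w = polyDiff y p w + polyDiff y q w := by
    intro y w p q
    simp only [polyDiff, map_add, mul_add, Finset.sum_add_distrib]
  have hmul : ∀ (y w : Fin n → ℂ) p q, polyDiff y (p * q) w = eval y p * polyDiff y q w + eval y q * polyDiff y p w := by
    intro y w p q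
    simp only [polyDiff, Derivation.leibniz, smul_eq_mul, map_add, map_mul, Finset.mul_sum]
    rw [← Finset.sum_add_distrib]
    refine Finset.sum_congr rfl fun k _ => ?_
    ring
  have hC : ∀ (y w : Fin n → ℂ) a, polyDiff y (C a) w = 0 := by
    intro y w a; simp [polyDiff]
  have hX : ∀ (y w : Fin n → ℂ) a, polyDiff y (X a) w = w a := by
    intro y w a; simp [polyDiff, pderiv_X, Pi.single_apply, apply_ite, Finset.sum_ite_eq]
  have hsum : ∀ (y w : Fin n → ℂ) (f : Fin n → MvPolynomial (Fin n) ℂ), polyDiff y (∑ k, f k) w = ∑ k, polyDiff y (f k) w := by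
    intro y w f
    simp only [polyDiff, map_sum, Finset.mul_sum]
    exact Finset.sum_comm
  induction p using MvPolynomial.induction_on with
  | C a =>
    have : sA A (C a) = C a := by simp [sA]
    rw [this, hC, hC]
  | add p q hp hq => rw [map_add, hadd, hadd, hp, hq]
  | mul_X p k hp =>
    have h1 : sA A (X k) = ∑ l, C (A k l) * X l := by simp [sA]
    have h2 : polyDiff x (sA A (X k)) v = A.mulVec v k := by
      rw [h1, hsum]
      simp only [hmul, hX, hC, eval_C, mul_zero, add_zero]
      rfl
    rw [map_mul, hmul, hmul, hp, eval_sA, eval_sA, h2, hX (A.mulVec x)]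

theorem zLocus_sA {n s : ℕ} (A : Matrix (Fin n) (Fin n) ℂ) (g : Fin s → MvPolynomial (Fin n) ℂ) :
    zLocus (Set.range fun j => sA A (g j)) = {x | A.mulVec x ∈ zLocus (Set.range g)} := by
  ext x
  rw [mem_zLocus_range, Set.mem_setOf_eq, mem_zLocus_range]
  simp only [eval_sA]

theorem vIdeal_sA {n s : ℕ} (A N : Matrix (Fin n) (Fin n) ℂ) (h1 : A * N = 1) (h2 : N * A = 1) (g : Fin s → MvPolynomial (Fin n) ℂ)
    (hr : (Ideal.span (Set.range g)).IsRadical) :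
    vIdeal (zLocus (Set.range fun j => sA A (g j))) = Ideal.span (Set.range fun j => sA A (g j)) := by
  have hv := vIdeal_zLocus_of_radical g hr
  apply le_antisymm
  · intro p hp
    have h3 : sA N p ∈ vIdeal (zLocus (Set.range g)) := by
      intro z hz
      rw [eval_sA]
      refine hp _ ?_
      rw [zLocus_sA, Set.mem_setOf_eq, Matrix.mulVec_mulVec, h1, Matrix.one_mulVec]
      exact hz
    rw [hv] at h3
    have h4 := Ideal.mem_map_of_mem (sA A) h3
    rw [sA_inv A N h2, Ideal.map_span, ← Set.range_comp] at h4
    exact h4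
  · rw [Ideal.span_le]
    rintro _ ⟨j, rfl⟩ x hx
    rw [mem_zLocus_range] at hx
    exact hx j

theorem mem_tangent_sA {n t s d : ℕ} (F : Fin s → MvPolynomial (Fin n ⊕ Fin t) ℂ)
    (hE : EquidimIdeal (Ideal.span (Set.range F)) (d + t)) (η : Fin t → ℂ) (hR : RankCond F d η)
    (A N : Matrix (Fin n) (Fin n) ℂ) (h1 : A * N = 1) (h2 : N * A = 1) (x : Fin n → ℂ)
    (hx : ∀ j, eval (Sum.elim (A.mulVec x) η) (F j) = 0) (v : Fin n → ℂ) :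
    v ∈ tangentAt (zLocus (Set.range fun j => sA A (specY η (F j)))) x ↔
      ∀ j, ∑ k, A.mulVec v k * gx F (Sum.elim (A.mulVec x) η) j k = 0 := by
  rw [mem_tangentAt_iff (vIdeal_sA A N h1 h2 _ (fiber_radical F hE η hR)) (fun j => by rw [eval_sA, eval_specY, hx])]
  simp only [polyDiff_sA]
  simp only [polyDiff, pderiv_specY, eval_specY]
  rfl

theorem finrank_tangent_sA {n t s d : ℕ} (F : Fin s → MvPolynomial (Fin n ⊕ Fin t) ℂ)
    (hE : EquidimIdeal (Ideal.span (Set.range F)) (d + t)) (η : Fin t → ℂ) (hR : RankCond F d η)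
    (A N : Matrix (Fin n) (Fin n) ℂ) (h1 : A * N = 1) (h2 : N * A = 1) (x : Fin n → ℂ)
    (hx : ∀ j, eval (Sum.elim (A.mulVec x) η) (F j) = 0) :
    Module.finrank ℂ (tangentAt (zLocus (Set.range fun j => sA A (specY η (F j)))) x) = d := by
  set T := tangentAt (zLocus (Set.range fun j => sA A (specY η (F j)))) x with hT
  let e := Matrix.toLin'OfInv h2 h1
  have h3 := finrank_ker_add (gx F (Sum.elim (A.mulVec x) η)) (T.map e.toLinearMap) (by
    intro v
    constructor
    · rintro ⟨w, hw, rfl⟩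
      exact (mem_tangent_sA F hE η hR A N h1 h2 x hx w).1 hw
    · intro h
      refine ⟨N.mulVec v, ?_, ?_⟩
      · refine (mem_tangent_sA F hE η hR A N h1 h2 x hx _).2 ?_
        rw [Matrix.mulVec_mulVec, h1, Matrix.one_mulVec]
        exact h
      · change A.mulVec (N.mulVec v) = v
        rw [Matrix.mulVec_mulVec, h1, Matrix.one_mulVec])
  rw [LinearEquiv.finrank_map_eq] at h3
  have := hR _ hx
  omega

theorem polyDiff_projPoly {n i : ℕ} (hi : i ≤ n) (x v : Fin n → ℂ) (k : Fin i) :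
    polyDiff x (projPoly n i k) v = v (Fin.castLE hi k) := by
  have : projPoly n i k = X (Fin.castLE hi k) := by
    rw [projPoly, dif_pos (k.2.trans_le hi)]
    rfl
  rw [this]
  simp [polyDiff, pderiv_X, Pi.single_apply, apply_ite, Finset.sum_ite_eq]

theorem crit_lin {n s i : ℕ} (hi : i ≤ n) (g : Fin s → Fin n → ℂ) (A N : Matrix (Fin n) (Fin n) ℂ) (h1 : A * N = 1) (h2 : N * A = 1)
    (T : Submodule ℂ (Fin n → ℂ)) (hT : ∀ v, v ∈ T ↔ ∀ j, ∑ k, A.mulVec v k * g j k = 0) :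
    (¬ Function.Surjective (fun v : T => fun k : Fin i => v.1 (Fin.castLE hi k))) ↔
      ∃ v : Fin n → ℂ, v ≠ 0 ∧ (∀ l : Fin n, i ≤ (l : ℕ) → v l = 0) ∧ Matrix.vecMul v N ∈ Submodule.span ℂ (Set.range g) := by
  classical
  constructor
  · intro h
    let L : T →ₗ[ℂ] (Fin i → ℂ) := (LinearMap.funLeft ℂ ℂ (Fin.castLE hi)).comp T.subtype
    have hL : LinearMap.range L < ⊤ := by
      rw [lt_top_iff_ne_top]
      intro h0
      exact h (LinearMap.range_eq_top.1 h0)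
    obtain ⟨f, hf0, hf⟩ := Submodule.exists_le_ker_of_lt_top _ hL
    let u : Fin i → ℂ := (dotProductEquiv ℂ (Fin i)).symm f
    have hu : ∀ w, f w = u ⬝ᵥ w := by
      intro w
      have : dotProductEquiv ℂ (Fin i) u = f := LinearEquiv.apply_symm_apply _ _
      rw [← this]; rfl
    let v : Fin n → ℂ := fun l => if h : (l : ℕ) < i then u ⟨l, h⟩ else 0
    have hvw : ∀ w : Fin n → ℂ, v ⬝ᵥ w = u ⬝ᵥ (fun k => w (Fin.castLE hi k)) := by
      intro w
      simp only [dotProduct]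
      symm
      rw [← Finset.sum_subset (Finset.subset_univ (Finset.univ.map (Fin.castLEEmb hi)))]
      · rw [Finset.sum_map]
        refine Finset.sum_congr rfl fun k _ => ?_
        simp [v]
      · intro l _ hl
        have : ¬ (l : ℕ) < i := by
          intro h
          apply hl
          simp only [Finset.mem_map, Finset.mem_univ, true_and]
          exact ⟨⟨l, h⟩, rfl⟩
        simp [v, this]
    refine ⟨v, ?_, ?_, ?_⟩
    · intro hv
      apply hf0
      ext w
      have : u = 0 := by
        funext k
        have := congrFun hv (Fin.castLE hi k)
        simpa [v] using this
      simp [hu, this]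
    · intro l hl
      simp [v, not_lt.2 hl]
    · have h3 := mem_span_of_iInf_ker_le_ker (ι := Fin s) (L := fun j => dotProductEquiv ℂ (Fin n) (g j))
        (K := dotProductEquiv ℂ (Fin n) (Matrix.vecMul v N)) (by
          intro w hw
          simp only [Submodule.mem_iInf, LinearMap.mem_ker] at hw
          rw [LinearMap.mem_ker]
          change (Matrix.vecMul v N) ⬝ᵥ w = 0
          rw [← Matrix.dotProduct_mulVec, hvw]
          have hwT : N.mulVec w ∈ T := by
            rw [hT]
            intro j
            rw [Matrix.mulVec_mulVec, h1, Matrix.one_mulVec]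
            have := hw j
            change g j ⬝ᵥ w = 0 at this
            rw [dotProduct_comm] at this
            exact this
          have := hf ⟨⟨_, hwT⟩, rfl⟩
          rw [LinearMap.mem_ker, hu] at this
          exact this)
      have e : Set.range (fun j => dotProductEquiv ℂ (Fin n) (g j)) = (dotProductEquiv ℂ (Fin n)).toLinearMap '' Set.range g := by
        rw [← Set.range_comp]; rfl
      rw [e, Submodule.span_image] at h3
      obtain ⟨y, hy, hy2⟩ := h3
      rw [← (dotProductEquiv ℂ (Fin n)).injective hy2]
      exact hy
  · rintro ⟨v, hv, hl, hs⟩ hsurj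
    obtain ⟨k, hk⟩ : ∃ k, v k ≠ 0 := by
      by_contra! h
      exact hv (funext h)
    have hki : (k : ℕ) < i := by
      by_contra h
      exact hk (hl k (not_lt.1 h))
    obtain ⟨⟨w, hw⟩, hwk⟩ := hsurj (Pi.single ⟨k, hki⟩ 1)
    rw [hT] at hw
    have h3 : ∀ y ∈ Submodule.span ℂ (Set.range g), y ⬝ᵥ A.mulVec w = 0 := by
      intro y hy
      induction hy using Submodule.span_induction with
      | mem y hy =>
        obtain ⟨j, rfl⟩ := hy
        rw [dotProduct_comm]
        exact hw j
      | zero => simp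
      | add a b _ _ ha hb => rw [add_dotProduct, ha, hb, add_zero]
      | smul c a _ ha => rw [smul_dotProduct, ha, smul_zero]
    have h4 := h3 _ hs
    rw [← Matrix.dotProduct_mulVec, Matrix.mulVec_mulVec, h2, Matrix.one_mulVec, dotProduct,
      Finset.sum_eq_single k] at h4
    · have := congrFun hwk ⟨k, hki⟩
      simp at this
      rw [this, mul_one] at h4
      exact hk h4
    · intro b _ hb
      by_cases hbi : (b : ℕ) < i
      · have := congrFun hwk ⟨b, hbi⟩
        have hne : (⟨b, hbi⟩ : Fin i) ≠ ⟨k, hki⟩ := by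
          intro h; apply hb; ext; simpa using h
        simp [Pi.single_apply, hne] at this
        rw [this, mul_zero]
      · rw [hl b (not_lt.1 hbi), zero_mul]
    · simp

theorem critProj_eq {n t s d : ℕ} (F : Fin s → MvPolynomial (Fin n ⊕ Fin t) ℂ) (hdn : d ≤ n)
    (hE : EquidimIdeal (Ideal.span (Set.range F)) (d + t)) (η : Fin t → ℂ) (hR : RankCond F d η)
    (A N : Matrix (Fin n) (Fin n) ℂ) (h1 : A * N = 1) (h2 : N * A = 1) (i : ℕ) (hi : i ≤ d + 1) :
    critProj (zLocus (Set.range fun j => sA A (specY η (F j)))) d i = {x | A.mulVec x ∈ Kset F d i N η} := by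
  have hmem : ∀ x, x ∈ zLocus (Set.range fun j => sA A (specY η (F j))) ↔ ∀ j, eval (Sum.elim (A.mulVec x) η) (F j) = 0 := by
    intro x
    rw [mem_zLocus_range]
    simp only [eval_sA, eval_specY]
  rw [critProj]
  split_ifs with hid
  · subst hid
    ext x
    rw [Set.mem_setOf_eq, Kset_top, zLocus_sA]
    rfl
  · have hid' : i ≤ d := by omega
    have hin : i ≤ n := by omega
    ext x
    rw [critMap, Set.mem_setOf_eq, Set.mem_setOf_eq, hmem, Kset, Set.mem_setOf_eq]
    refine and_congr_right fun hx => ?_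
    have h3 := crit_lin hin (gx F (Sum.elim (A.mulVec x) η)) A N h1 h2 _ (mem_tangent_sA F hE η hR A N h1 h2 x hx)
    simp only [polyDiff_projPoly hin]
    rw [h3]
    have h4 : x ∉ singLocus (zLocus (Set.range fun j => sA A (specY η (F j)))) d := by
      rintro ⟨-, h⟩
      exact h (finrank_tangent_sA F hE η hR A N h1 h2 x hx)
    simp only [h4, not_false_eq_true, true_and, hid', forall_true_left]


theorem pull_int {n c : ℕ} {K : Set (Fin n → ℂ)} (A N : Matrix (Fin n) (Fin n) ℂ) (h2 : N * A = 1) (h : IntC K N c) :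
    IntC {x | A.mulVec x ∈ K} 1 c := by
  set K' : Set (Fin n → ℂ) := {x | A.mulVec x ∈ K} with hK'
  let ρ : (K → ℂ) →ₐ[ℂ] (K' → ℂ) := Pi.algHom ℂ _ fun z => Pi.evalAlgHom ℂ (fun _ : K => ℂ) ⟨A.mulVec z.1, z.2⟩
  have hρ : ∀ x ∈ coordAlg K N c, ρ x ∈ coordAlg K' 1 c := by
    intro x hx
    have : coordAlg K N c ≤ (coordAlg K' 1 c).comap ρ := by
      apply Algebra.adjoin_le
      rintro _ ⟨l, hl, rfl⟩
      refine Algebra.subset_adjoin ⟨l, hl, ?_⟩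
      funext z
      change N.mulVec (A.mulVec z.1) l = (1 : Matrix (Fin n) (Fin n) ℂ).mulVec z.1 l
      rw [Matrix.mulVec_mulVec, h2]
    exact this hx
  have h3 : ∀ m, IsIntegral (coordAlg K' 1 c) (fun z : K' => A.mulVec z.1 m) := by
    intro m
    have := h m
    refine IsIntegral.map_of_comp_eq (R := coordAlg K N c) (T := coordAlg K' 1 c)
      ((ρ.comp (coordAlg K N c).val).codRestrict _ (fun x => hρ _ x.2)).toRingHom ρ.toRingHom ?_ this
    rfl
  intro m
  have e : (fun z : K' => z.1 m) = ∑ l, algebraMap (coordAlg K' 1 c) (K' → ℂ) (algebraMap ℂ (coordAlg K' 1 c) (N m l)) * (fun z : K' => A.mulVec z.1 l) := by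
    funext z
    rw [Finset.sum_apply]
    have : z.1 m = N.mulVec (A.mulVec z.1) m := by rw [Matrix.mulVec_mulVec, h2, Matrix.one_mulVec]
    rw [this]
    rfl
  rw [e]
  exact IsIntegral.sum _ fun l _ => IsIntegral.mul isIntegral_algebraMap (h3 l)

theorem bound_of_int {n c : ℕ} {K : Set (Fin n → ℂ)} (h : IntC K 1 c) (R : ℝ) (m : Fin n) :
    ∃ B : ℝ, ∀ x ∈ K, (∀ l : Fin n, (l : ℕ) < c → ‖x l‖ ≤ R) → ‖x m‖ ≤ B := by
  have hb : ∀ f ∈ coordAlg K 1 c, ∃ b : NNReal, ∀ x : K, (∀ l : Fin n, (l : ℕ) < c → ‖x.1 l‖ ≤ R) → ‖f x‖₊ ≤ b := by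
    intro f hf
    induction hf using Algebra.adjoin_induction with
    | mem f hf =>
      obtain ⟨l, hl, rfl⟩ := hf
      refine ⟨R.toNNReal, fun x hx => ?_⟩
      change ‖(1 : Matrix (Fin n) (Fin n) ℂ).mulVec x.1 l‖₊ ≤ _
      rw [Matrix.one_mulVec]
      exact NNReal.le_toNNReal_of_coe_le (hx l hl)
    | algebraMap r => exact ⟨‖r‖₊, fun x _ => le_rfl⟩
    | add f g _ _ hf hg =>
      obtain ⟨a, ha⟩ := hf
      obtain ⟨b, hb⟩ := hg
      exact ⟨a + b, fun x hx => (nnnorm_add_le _ _).trans (add_le_add (ha x hx) (hb x hx))⟩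
    | mul f g _ _ hf hg =>
      obtain ⟨a, ha⟩ := hf
      obtain ⟨b, hb⟩ := hg
      refine ⟨a * b, fun x hx => (nnnorm_mul_le _ _).trans (mul_le_mul' (ha x hx) (hb x hx))⟩
  obtain ⟨p, hp, hp0⟩ := h m
  choose b hb using fun k => hb _ (p.coeff k).2
  refine ⟨((∑ k ∈ Finset.range p.natDegree, b k) + 1 : NNReal), fun x hx hxl => ?_⟩
  let ev : coordAlg K 1 c →+* ℂ := (Pi.evalRingHom (fun _ : K => ℂ) ⟨x, hx⟩).comp (algebraMap (coordAlg K 1 c) (K → ℂ))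
  have hmon : (p.map ev).Monic := hp.map _
  have hroot : (p.map ev).IsRoot (x m) := by
    rw [Polynomial.IsRoot.def, Polynomial.eval_map]
    have := congrArg (Pi.evalRingHom (fun _ : K => ℂ) ⟨x, hx⟩) hp0
    rw [Polynomial.hom_eval₂, map_zero] at this
    exact this
  have h1 := Polynomial.IsRoot.norm_lt_cauchyBound hmon.ne_zero hroot
  have h2 : (p.map ev).cauchyBound ≤ (∑ k ∈ Finset.range p.natDegree, b k) + 1 := by
    rw [Polynomial.cauchyBound, hmon.leadingCoeff, nnnorm_one, div_one, hp.natDegree_map]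
    refine add_le_add (Finset.sup_le fun k hk => ?_) le_rfl
    rw [Polynomial.coeff_map]
    exact (hb k ⟨x, hx⟩ hxl).trans (Finset.single_le_sum (f := b) (fun _ _ => bot_le) hk)
  have h3 := h1.le.trans h2
  exact_mod_cast h3

theorem proper_of_int {n c : ℕ} {K : Set (Fin n → ℂ)} (hc : c ≤ n) (hcl : IsClosed K) (h : IntC K 1 c) :
    ProperOn (projMap n c) K := by
  rintro β -
  refine ⟨Metric.ball β 1, Metric.isOpen_ball, Metric.mem_ball_self one_pos, ?_⟩
  choose B hB using fun m => bound_of_int h (‖β‖ + 1) m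
  have hcont : Continuous (projMap n c) := by
    refine continuous_pi fun k => ?_
    simp only [projMap]
    split_ifs <;> fun_prop
  refine Metric.isCompact_of_isClosed_isBounded ?_ ?_
  · exact hcl.inter (isClosed_closure.preimage hcont)
  · refine (Metric.isBounded_closedBall (x := (0 : Fin n → ℂ)) (r := ∑ m, |B m|)).subset ?_
    rintro x ⟨hxK, hx⟩
    have hx1 : projMap n c x ∈ Metric.closedBall β 1 := Metric.closure_ball_subset_closedBall hx
    rw [mem_closedBall_iff_norm] at hx1
    have hx2 : ‖projMap n c x‖ ≤ ‖β‖ + 1 := by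
      have := norm_le_norm_add_norm_sub' (projMap n c x) β
      linarith
    rw [mem_closedBall_zero_iff, pi_norm_le_iff_of_nonneg (Finset.sum_nonneg fun _ _ => abs_nonneg _)]
    intro m
    have h1 := hB m x hxK (fun l hl => by
      have := (norm_le_pi_norm (projMap n c x) ⟨l, hl⟩).trans hx2
      simpa [projMap] using this)
    exact (h1.trans (le_abs_self _)).trans (Finset.single_le_sum (f := fun m => |B m|) (fun _ _ => abs_nonneg _) (Finset.mem_univ m))

theorem dim_le_of_int {n c : ℕ} {K : Set (Fin n → ℂ)} (hc : c ≤ n) (h : IntC K 1 c) :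
    ringKrullDim (MvPolynomial (Fin n) ℂ ⧸ vIdeal K) ≤ (c : WithBot ℕ∞) := by
  let ev : MvPolynomial (Fin n) ℂ →ₐ[ℂ] (K → ℂ) := aeval (fun m => fun z : K => z.1 m)
  have hev : ∀ p (z : K), ev p z = eval z.1 p := by
    intro p z
    rw [← aeval_eq_eval]
    change ((Pi.evalAlgHom ℂ (fun _ : K => ℂ) z).comp ev) p = _
    refine DFunLike.congr_fun ?_ _
    ext v
    simp [ev]
  let ι : (MvPolynomial (Fin n) ℂ ⧸ vIdeal K) →ₐ[ℂ] (K → ℂ) := Ideal.Quotient.liftₐ (vIdeal K) ev (fun a ha => by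
    funext z
    rw [hev]
    exact ha z.1 z.2)
  have hιmk : ∀ p, ι (Ideal.Quotient.mk _ p) = ev p := fun p => rfl
  have hι : Function.Injective ι := by
    rw [injective_iff_map_eq_zero]
    intro a ha
    obtain ⟨a, rfl⟩ := Ideal.Quotient.mk_surjective a
    rw [Ideal.Quotient.eq_zero_iff_mem]
    intro z hz
    have := congrFun ha ⟨z, hz⟩
    rw [hιmk, hev] at this
    exact this
  let φ : MvPolynomial (Fin c) ℂ →ₐ[ℂ] (MvPolynomial (Fin n) ℂ ⧸ vIdeal K) :=
    aeval (fun k => Ideal.Quotient.mk _ (X (Fin.castLE hc k)))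
  have hφX : ∀ k, ι (φ (X k)) = fun z : K => z.1 (Fin.castLE hc k) := by
    intro k
    simp only [φ, aeval_X, hιmk, ev]
  have hrange : coordAlg K 1 c ≤ (ι.comp φ).range := by
    apply Algebra.adjoin_le
    rintro _ ⟨l, hl, rfl⟩
    refine ⟨X ⟨l, hl⟩, ?_⟩
    change ι (φ (X _)) = _
    rw [hφX]
    funext z
    rw [Matrix.one_mulVec]
    rfl
  have hmem : ∀ x, (ι.comp φ) x ∈ coordAlg K 1 c := by
    intro x
    induction x using MvPolynomial.induction_on with
    | C a =>
      have : (ι.comp φ) (C a) = algebraMap ℂ _ a := (ι.comp φ).commutes a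
      rw [this]
      exact Subalgebra.algebraMap_mem _ _
    | add p q hp hq => rw [map_add]; exact Subalgebra.add_mem _ hp hq
    | mul_X p k hp =>
      rw [map_mul]
      refine Subalgebra.mul_mem _ hp ?_
      change ι (φ (X k)) ∈ _
      rw [hφX]
      refine Algebra.subset_adjoin ⟨Fin.castLE hc k, k.2, ?_⟩
      funext z
      rw [Matrix.one_mulVec]
  let θ : MvPolynomial (Fin c) ℂ →ₐ[ℂ] coordAlg K 1 c := (ι.comp φ).codRestrict _ hmem
  have hθ : Function.Surjective θ := by
    rintro ⟨x, hx⟩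
    obtain ⟨y, hy⟩ := hrange hx
    exact ⟨y, Subtype.ext hy⟩
  letI : Algebra (MvPolynomial (Fin c) ℂ) (MvPolynomial (Fin n) ℂ ⧸ vIdeal K) := φ.toRingHom.toAlgebra
  have hX : ∀ m, IsIntegral (MvPolynomial (Fin c) ℂ) (Ideal.Quotient.mk (vIdeal K) (X m)) := by
    intro m
    obtain ⟨p, hp, hp0⟩ := h m
    have hl : p ∈ Polynomial.lifts θ.toRingHom := by
      rw [Polynomial.lifts_iff_coeff_lifts]
      intro k
      exact hθ _
    obtain ⟨q, hq, -, hqm⟩ := Polynomial.lifts_and_natDegree_eq_and_monic hl hp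
    refine ⟨q, hqm, ?_⟩
    apply hι
    rw [map_zero, ← hp0, ← hq, Polynomial.eval₂_map]
    change ι.toRingHom _ = _
    rw [Polynomial.hom_eval₂]
    have : ι.toRingHom (Ideal.Quotient.mk (vIdeal K) (X m)) = fun z : K => z.1 m := by
      change ev (X m) = _
      simp [ev]
    rw [this]
    rfl
  haveI : Algebra.IsIntegral (MvPolynomial (Fin c) ℂ) (MvPolynomial (Fin n) ℂ ⧸ vIdeal K) := by
    constructor
    intro x
    obtain ⟨p, rfl⟩ := Ideal.Quotient.mk_surjective x
    induction p using MvPolynomial.induction_on with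
    | C a =>
      have : Ideal.Quotient.mk (vIdeal K) (C a) = φ (C a) := (φ.commutes a).symm
      rw [this]
      exact isIntegral_algebraMap (R := MvPolynomial (Fin c) ℂ) (A := MvPolynomial (Fin n) ℂ ⧸ vIdeal K) (x := C a)
    | add p q hp hq => rw [map_add]; exact hp.add hq
    | mul_X p k hp => rw [map_mul]; exact hp.mul (hX k)
  refine (dim_le_of_integral (MvPolynomial (Fin c) ℂ) _).trans ?_
  rw [dim_mvPoly, Nat.card_fin]

theorem dim_ge_of_LB {n c : ℕ} {K : Set (Fin n → ℂ)} (A N : Matrix (Fin n) (Fin n) ℂ) (h1 : A * N = 1) (h : DimLB K c) :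
    (c : WithBot ℕ∞) ≤ ringKrullDim (MvPolynomial (Fin n) ℂ ⧸ vIdeal {x | A.mulVec x ∈ K}) := by
  obtain ⟨g, hg⟩ := h
  let φ : MvPolynomial (Fin c) ℂ →ₐ[ℂ] (MvPolynomial (Fin n) ℂ ⧸ vIdeal {x | A.mulVec x ∈ K}) :=
    (Ideal.Quotient.mkₐ ℂ _).comp (aeval (fun k => sA A (g k)))
  have hφ : Function.Injective φ := by
    rw [injective_iff_map_eq_zero]
    intro q hq
    have hq : aeval (fun k => sA A (g k)) q ∈ vIdeal {x | A.mulVec x ∈ K} := Ideal.Quotient.eq_zero_iff_mem.1 hq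
    apply hg
    intro z hz
    have h3 := hq (N.mulVec z) (by rw [Set.mem_setOf_eq, Matrix.mulVec_mulVec, h1, Matrix.one_mulVec]; exact hz)
    rw [← h3, ← aeval_eq_eval, ← aeval_eq_eval]
    change _ = ((aeval (N.mulVec z)).comp (aeval _)) q
    rw [comp_aeval]
    congr 2
    funext a
    change _ = eval (N.mulVec z) (sA A (g a))
    rw [eval_sA, Matrix.mulVec_mulVec, h1, Matrix.one_mulVec]
    rfl
  have := card_le_of_inj φ hφ
  rwa [Nat.card_fin] at this

theorem mem_span_iff_minors {n s r : ℕ} (g : Fin s → Fin n → ℂ) (hr : Module.finrank ℂ (Submodule.span ℂ (Set.range g)) = r) (y : Fin n → ℂ) :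
    y ∈ Submodule.span ℂ (Set.range g) ↔ ∀ (J : Fin (r + 1) → Option (Fin s)) (c : Fin (r + 1) → Fin n),
      (Matrix.of fun a b => (Option.elim (J a) y g : Fin n → ℂ) (c b)).det = 0 := by
  let G : Option (Fin s) → Fin n → ℂ := fun o => Option.elim o y g
  have hG : Set.range G = insert y (Set.range g) := by
    ext w
    constructor
    · rintro ⟨o, rfl⟩
      cases o with
      | none => exact Or.inl rfl
      | some j => exact Or.inr ⟨j, rfl⟩
    · rintro (rfl | ⟨j, rfl⟩)
      · exact ⟨none, rfl⟩
      · exact ⟨some j, rfl⟩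
  have hle : Submodule.span ℂ (Set.range g) ≤ Submodule.span ℂ (Set.range G) := by
    rw [hG]; exact Submodule.span_mono (Set.subset_insert _ _)
  constructor
  · intro hy J c
    by_contra hne
    have := finrank_ge_of_minor G J c hne
    rw [hG, Submodule.span_insert_eq_span hy, hr] at this
    omega
  · intro h
    by_contra hy
    have hlt : Submodule.span ℂ (Set.range g) < Submodule.span ℂ (Set.range G) := by
      refine lt_of_le_of_ne hle fun he => hy ?_
      rw [he, hG]
      exact Submodule.subset_span (Set.mem_insert _ _)
    have h2 := Submodule.finrank_lt_finrank_of_lt hlt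
    rw [hr] at h2
    obtain ⟨J, c, hJ⟩ := exists_minor_of_finrank (r := r + 1) G h2
    exact hJ (h J c)

theorem Kset_closed {n t s d : ℕ} (F : Fin s → MvPolynomial (Fin n ⊕ Fin t) ℂ) (i : ℕ) (N : Matrix (Fin n) (Fin n) ℂ) (η : Fin t → ℂ)
    (hR : RankCond F d η) : IsClosed (Kset F d i N η) := by
  have hev : ∀ p : MvPolynomial (Fin n ⊕ Fin t) ℂ, Continuous fun z : Fin n → ℂ => eval (Sum.elim z η) p := by
    intro p
    have : Continuous fun z : Fin n → ℂ => (Sum.elim z η : Fin n ⊕ Fin t → ℂ) := by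
      refine continuous_pi fun k => ?_
      rcases k with k | k
      · exact continuous_apply k
      · exact continuous_const
    exact (MvPolynomial.continuous_eval p).comp this
  have hV : IsClosed {z : Fin n → ℂ | ∀ j, eval (Sum.elim z η) (F j) = 0} := by
    rw [Set.setOf_forall]
    exact isClosed_iInter fun j => isClosed_eq (hev _) continuous_const
  by_cases hid : i ≤ d
  swap
  · have : Kset F d i N η = {z : Fin n → ℂ | ∀ j, eval (Sum.elim z η) (F j) = 0} := by
      ext z
      exact ⟨fun h => h.1, fun h => ⟨h, fun h' => absurd h' hid⟩⟩
    rw [this]; exact hV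
  let S := Metric.sphere (0 : Fin n → ℂ) 1
  haveI : CompactSpace S := isCompact_iff_compactSpace.1 (isCompact_sphere _ _)
  let W : Set (S × (Fin n → ℂ)) := {q | (∀ j, eval (Sum.elim q.2 η) (F j) = 0) ∧ (∀ l : Fin n, i ≤ (l : ℕ) → q.1.1 l = 0) ∧
    ∀ (J : Fin (n - d + 1) → Option (Fin s)) (c : Fin (n - d + 1) → Fin n),
      (Matrix.of fun a b => (Option.elim (J a) (Matrix.vecMul q.1.1 N) (gx F (Sum.elim q.2 η)) : Fin n → ℂ) (c b)).det = 0}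
  have hW : IsClosed W := by
    have hco : ∀ l : Fin n, Continuous fun q : S × (Fin n → ℂ) => q.1.1 l := fun l =>
      (continuous_apply l).comp (continuous_subtype_val.comp continuous_fst)
    have hB : IsClosed {q : S × (Fin n → ℂ) | ∀ l : Fin n, i ≤ (l : ℕ) → q.1.1 l = 0} := by
      simp only [Set.setOf_forall]
      exact isClosed_iInter fun l => isClosed_iInter fun _ => isClosed_eq (hco l) continuous_const
    have hC : IsClosed {q : S × (Fin n → ℂ) | ∀ (J : Fin (n - d + 1) → Option (Fin s)) (c : Fin (n - d + 1) → Fin n),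
      (Matrix.of fun a b => (Option.elim (J a) (Matrix.vecMul q.1.1 N) (gx F (Sum.elim q.2 η)) : Fin n → ℂ) (c b)).det = 0} := by
      simp only [Set.setOf_forall]
      refine isClosed_iInter fun J => isClosed_iInter fun c => isClosed_eq ?_ continuous_const
      refine Continuous.matrix_det ?_
      refine continuous_matrix fun a b => ?_
      simp only [Matrix.of_apply]
      cases J a with
      | none =>
        simp only [Option.elim, Matrix.vecMul, dotProduct]
        exact continuous_finsetSum _ fun l _ => (hco l).mul continuous_const
      | some j => exact (hev _).comp continuous_snd
    exact (hV.preimage continuous_snd).inter (hB.inter hC)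
  have hKW : Kset F d i N η = Prod.snd '' W := by
    ext z
    constructor
    · rintro ⟨h0, h1⟩
      obtain ⟨v, hv, hl, hs⟩ := h1 hid
      have hrk := hR z h0
      have hv' : (‖v‖ : ℂ) ≠ 0 := by simpa using hv
      refine ⟨(⟨(‖v‖ : ℂ)⁻¹ • v, ?_⟩, z), ⟨h0, ?_, ?_⟩, rfl⟩
      · rw [mem_sphere_zero_iff_norm, norm_smul, norm_inv]
        simp [hv]
      · intro l h
        simp [hl l h]
      · refine (mem_span_iff_minors _ (r := n - d) (by
          change Module.finrank ℂ (Submodule.span ℂ (Set.range (gx F (Sum.elim z η)))) = n - d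
          omega) _).1 ?_
        rw [Matrix.smul_vecMul]
        exact Submodule.smul_mem _ _ hs
    · rintro ⟨⟨⟨v, hv⟩, z'⟩, ⟨h0, hl, hm⟩, rfl⟩
      refine ⟨h0, fun _ => ⟨v, ?_, hl, ?_⟩⟩
      · rintro rfl
        simp [S] at hv
      · have hrk := hR z' h0
        exact (mem_span_iff_minors _ (r := n - d) (by
          change Module.finrank ℂ (Submodule.span ℂ (Set.range (gx F (Sum.elim z' η)))) = n - d
          omega) _).2 hm
  rw [hKW]
  exact isClosedMap_snd_of_compactSpace _ hW


/-- The generic matrix. -/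
def genMat (n : ℕ) : Matrix (Fin n) (Fin n) (MvPolynomial (Fin n × Fin n) ℂ) := Matrix.of fun i j => X (i, j)

theorem eval_genMat {n : ℕ} (A : Matrix (Fin n) (Fin n) ℂ) :
    (eval (fun q : Fin n × Fin n => A q.1 q.2)).mapMatrix (genMat n) = A := by
  ext i j
  simp [genMat]

theorem eval_genMat_det {n : ℕ} (A : Matrix (Fin n) (Fin n) ℂ) :
    eval (fun q : Fin n × Fin n => A q.1 q.2) (genMat n).det = A.det := by
  rw [RingHom.map_det, eval_genMat]

theorem eval_genMat_adj {n : ℕ} (A : Matrix (Fin n) (Fin n) ℂ) (i j : Fin n) :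
    eval (fun q : Fin n × Fin n => A q.1 q.2) ((genMat n).adjugate i j) = A.adjugate i j := by
  have := RingHom.map_adjugate (eval (fun q : Fin n × Fin n => A q.1 q.2)) (genMat n)
  rw [eval_genMat] at this
  rw [← this]
  rfl

theorem inv_poly {n : ℕ} (p : MvPolynomial (Fin n × Fin n) ℂ) :
    ∃ (q : MvPolynomial (Fin n × Fin n) ℂ) (D : ℕ), ∀ A : Matrix (Fin n) (Fin n) ℂ, A.det ≠ 0 →
      eval (fun z : Fin n × Fin n => A z.1 z.2) q = A.det ^ D * eval (fun z : Fin n × Fin n => A⁻¹ z.1 z.2) p := by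
  induction p using MvPolynomial.induction_on with
  | C a => exact ⟨C a, 0, fun A _ => by simp⟩
  | add p p' hp hp' =>
    obtain ⟨q, D, h⟩ := hp
    obtain ⟨q', D', h'⟩ := hp'
    refine ⟨q * (genMat n).det ^ D' + q' * (genMat n).det ^ D, D + D', fun A hA => ?_⟩
    rw [map_add, map_mul, map_mul, map_pow, map_pow, eval_genMat_det, h A hA, h' A hA, map_add]
    ring
  | mul_X p k hp =>
    obtain ⟨q, D, h⟩ := hp
    refine ⟨q * (genMat n).adjugate k.1 k.2, D + 1, fun A hA => ?_⟩
    rw [map_mul, eval_genMat_adj, h A hA, map_mul, eval_X, Matrix.inv_def, Matrix.smul_apply, Ring.inverse_eq_inv', smul_eq_mul]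
    field_simp
    ring

theorem d_le_n {n t s d : ℕ} (f : Fin s → MvPolynomial (Fin n ⊕ Fin t) ℚ) (hA : AssumpA f d) : d ≤ n := by
  obtain ⟨-, ⟨z, hz⟩, hE, -⟩ := hA
  have hne : vIdeal (VC f) ≠ ⊤ := by
    intro h
    have : (1 : MvPolynomial (Fin n ⊕ Fin t) ℂ) ∈ vIdeal (VC f) := by rw [h]; trivial
    have := this z hz
    simp at this
  obtain ⟨P, hP⟩ := Ideal.nonempty_minimalPrimes hne
  have h1 := hE P hP
  have h2 := ringKrullDim_quotient_le P
  rw [h1, dim_mvPoly] at h2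
  have h3 : ((d + t : ℕ) : WithBot ℕ∞) ≤ ((Nat.card (Fin n ⊕ Fin t) : ℕ) : WithBot ℕ∞) := h2
  have h4 : d + t ≤ Nat.card (Fin n ⊕ Fin t) := by exact_mod_cast h3
  rw [Nat.card_sum, Nat.card_fin, Nat.card_fin] at h4
  omega

theorem total_gen {n t s d : ℕ} (F : Fin s → MvPolynomial (Fin n ⊕ Fin t) ℂ) (hdn : d ≤ n)
    (hE : EquidimIdeal (Ideal.span (Set.range F)) (d + t))
    (hI : vIdeal (zLocus (Set.range F)) = Ideal.span (Set.range F))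
    (hS : setDim (singLocus (zLocus (Set.range F)) (d + t)) < (t : WithBot (WithTop ℕ))) :
    Gen (fun N η => N.det ≠ 0 ∧ RankCond F d η ∧ ∀ i, 1 ≤ i → i ≤ d + 1 →
      IntC (Kset F d i N η) N (i - 1) ∧ (Kset F d i N η = ∅ ∨ DimLB (Kset F d i N η) (i - 1))) := by
  obtain ⟨q, hq, hqR⟩ := rank_generic F hdn hI hS
  have h1 := Gen.finite (n := n) (t := t) (Finset.range (n + 1))
    (Q := fun j N η => RankCond F d η → IntC (Kset F d (n - j + 1) N η) N (n - j))
    (fun j hj => int_all F hE hdn j (by rw [Finset.mem_range] at hj; omega))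
  have h2 := Gen.finite (n := n) (t := t) (Finset.range (d + 1))
    (Q := fun i N η => RankCond F d η → Kset F d i N η = ∅ ∨ DimLB (Kset F d i N η) (i - 1))
    (fun j hj => LB_le F hdn hE j (by rw [Finset.mem_range] at hj; omega))
  refine ((Gen.det.and (Gen.of_y q hq hqR)).and (h1.and h2)).mono ?_
  rintro N η ⟨⟨hd, hR⟩, h1, h2⟩
  refine ⟨hd, hR, fun i hi1 hi2 => ⟨?_, ?_⟩⟩
  · have := h1 (n + 1 - i) (by rw [Finset.mem_range]; omega) hR
    have e : n - (n + 1 - i) = i - 1 := by omega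
    have e2 : i - 1 + 1 = i := by omega
    rw [e, e2] at this
    exact this
  · rcases Nat.lt_or_ge i (d + 1) with h | h
    · exact h2 i (by rw [Finset.mem_range]; omega) hR
    · obtain rfl : i = d + 1 := by omega
      exact LB_top F hE N η hR

theorem crit_concl {n t s d : ℕ} (F : Fin s → MvPolynomial (Fin n ⊕ Fin t) ℂ) (hdn : d ≤ n)
    (hE : EquidimIdeal (Ideal.span (Set.range F)) (d + t)) (η : Fin t → ℂ) (hR : RankCond F d η)
    (A N : Matrix (Fin n) (Fin n) ℂ) (h1 : A * N = 1) (h2 : N * A = 1) (i : ℕ) (hi : i ≤ d + 1)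
    (hIC : IntC (Kset F d i N η) N (i - 1))
    (hlb : Kset F d i N η = ∅ ∨ DimLB (Kset F d i N η) (i - 1)) :
    ProperOn (projMap n (i - 1)) (critProj (zLocus (Set.range fun j => specY η (chgX A (F j)))) d i) ∧
      (critProj (zLocus (Set.range fun j => specY η (chgX A (F j)))) d i = ∅ ∨
        setDim (critProj (zLocus (Set.range fun j => specY η (chgX A (F j)))) d i) = ((i - 1 : ℕ) : WithBot (WithTop ℕ))) := by
  simp only [specY_chgX]
  rw [critProj_eq F hdn hE η hR A N h1 h2 i hi]
  have hIC' := pull_int A N h2 hIC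
  have hc : i - 1 ≤ n := by omega
  refine ⟨proper_of_int hc ?_ hIC', ?_⟩
  · refine (Kset_closed F i N η hR).preimage ?_
    exact Continuous.matrix_mulVec continuous_const continuous_id
  · rcases hlb with h | h
    · left
      rw [h]
      rfl
    · right
      exact le_antisymm (dim_le_of_int hc hIC') (dim_ge_of_LB A N h1 h)


/-- under Assumptions A and B there is a dense Zariski open set `𝒪` of
change-of-variable matrices such that for rational `A ∈ 𝒪`, there is a dense Zariski
open `𝒴_A ⊆ ℂ^t` contained in the set `ℬ` of Lemma (B-param) over which the generic
properness and dimension properties of the critical loci of `V(f^A(η,·))` hold. -/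
theorem statement_7 (n t s d : ℕ) (f : Fin s → MvPolynomial (Fin n ⊕ Fin t) ℚ)
    (hA : AssumpA f d) (hB : AssumpB f) :
    ∃ 𝒪 : Set (Matrix (Fin n) (Fin n) ℂ),
      IsZariskiOpenMat 𝒪 ∧ 𝒪.Nonempty ∧ (∀ A ∈ 𝒪, IsUnit A.det) ∧
      ∀ B : Matrix (Fin n) (Fin n) ℚ, B.map (fun q => (q : ℂ)) ∈ 𝒪 →
        ∃ 𝒴 : Set (Fin t → ℂ), IsZariskiOpen 𝒴 ∧ 𝒴.Nonempty ∧
          (∀ η ∈ 𝒴, GoodSpec (fun i => specY η (toC (f i))) d) ∧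
          ∀ η ∈ 𝒴, ∀ i : ℕ, 1 ≤ i → i ≤ d + 1 →
            ∀ Vη : Set (Fin n → ℂ),
              Vη = zLocus (Set.range fun i' =>
                specY η (chgX (B.map (fun q => (q : ℂ))) (toC (f i')))) →
              ProperOn (projMap n (i - 1)) (critProj Vη d i) ∧
              (critProj Vη d i = ∅ ∨
                setDim (critProj Vη d i) = ((i - 1 : ℕ) : WithBot (WithTop ℕ))) := by
  obtain ⟨hrad, hne, hE0, hS⟩ := id hA
  have hdn := d_le_n f hA
  have hI := vIdeal_VC f hrad
  have hE : EquidimIdeal (Ideal.span (Set.range fun i => toC (f i))) (d + t) := hI ▸ hE0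
  obtain ⟨G, hG0, hG⟩ := total_gen (fun i => toC (f i)) hdn hE hI hS
  let pη : (Fin t → ℂ) → MvPolynomial (Fin n × Fin n) ℂ := fun η =>
    MvPolynomial.map (eval η) (sumAlgEquiv ℂ (Fin n × Fin n) (Fin t) G)
  have hpη : ∀ η x, eval x (pη η) = eval (Sum.elim x η) G := fun η x => eval_sumAlgEquiv x η G
  choose q D hq using fun η => inv_poly (pη η)
  have hmem : ∀ A : Matrix (Fin n) (Fin n) ℂ, (∃ p ∈ Set.range fun η => (genMat n).det * q η,
      eval (fun z : Fin n × Fin n => A z.1 z.2) p ≠ 0) ↔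
      A.det ≠ 0 ∧ ∃ η : Fin t → ℂ, eval (Sum.elim (fun z : Fin n × Fin n => A⁻¹ z.1 z.2) η) G ≠ 0 := by
    intro A
    constructor
    · rintro ⟨_, ⟨η, rfl⟩, h⟩
      rw [map_mul, eval_genMat_det] at h
      have hd := left_ne_zero_of_mul h
      have h2 := right_ne_zero_of_mul h
      rw [hq η A hd, hpη] at h2
      exact ⟨hd, η, right_ne_zero_of_mul h2⟩
    · rintro ⟨hd, η, h⟩
      refine ⟨_, ⟨η, rfl⟩, ?_⟩
      rw [map_mul, eval_genMat_det, hq η A hd, hpη]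
      exact mul_ne_zero hd (mul_ne_zero (pow_ne_zero _ hd) h)
  refine ⟨{A | ∃ p ∈ Set.range fun η => (genMat n).det * q η, eval (fun z : Fin n × Fin n => A z.1 z.2) p ≠ 0},
    ⟨_, rfl⟩, ?_, fun A hAm => isUnit_iff_ne_zero.2 ((hmem A).1 hAm).1, ?_⟩
  · obtain ⟨w, hw⟩ : ∃ w, eval w G ≠ 0 := by
      by_contra hcon
      push Not at hcon
      exact hG0 (MvPolynomial.funext fun x => by rw [hcon x, map_zero])
    let N : Matrix (Fin n) (Fin n) ℂ := Matrix.of fun a b => w (Sum.inl (a, b))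
    have hw' : w = Sum.elim (fun z : Fin n × Fin n => N z.1 z.2) (fun l => w (Sum.inr l)) := by
      funext k
      rcases k with k | k <;> rfl
    rw [hw'] at hw
    have hN : IsUnit N.det := isUnit_iff_ne_zero.2 (hG _ _ hw).1
    refine ⟨N⁻¹, (hmem _).2 ⟨?_, fun l => w (Sum.inr l), ?_⟩⟩
    · exact (Matrix.isUnit_nonsing_inv_det N hN).ne_zero
    · rw [Matrix.nonsing_inv_nonsing_inv N hN]
      exact hw
  · intro B hBm
    obtain ⟨hd, η₀, hη₀⟩ := (hmem _).1 hBm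
    generalize B.map (fun q => (q : ℂ)) = A at hd hη₀
    have hdu : IsUnit A.det := isUnit_iff_ne_zero.2 hd
    let H : MvPolynomial (Fin t) ℂ := aeval (Sum.elim (fun z : Fin n × Fin n => C (A⁻¹ z.1 z.2)) X) G
    have hH : ∀ η, eval η H = eval (Sum.elim (fun z : Fin n × Fin n => A⁻¹ z.1 z.2) η) G := by
      intro η
      rw [← aeval_eq_eval, ← aeval_eq_eval]
      change ((aeval η).comp (aeval _)) G = _
      refine DFunLike.congr_fun ?_ _
      ext v
      rcases v with v | v <;> simp
    refine ⟨{η | ∃ p ∈ ({H} : Set (MvPolynomial (Fin t) ℂ)), eval η p ≠ 0}, ⟨_, rfl⟩,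
      ⟨η₀, H, rfl, by rw [hH]; exact hη₀⟩, ?_, ?_⟩
    · rintro η ⟨_, rfl, h⟩
      rw [hH] at h
      exact goodSpec_of_rank _ hE η (hG _ _ h).2.1
    · rintro η ⟨_, rfl, h⟩ i hi1 hi2 Vη rfl
      rw [hH] at h
      obtain ⟨-, hR, h3⟩ := hG _ _ h
      obtain ⟨h4, h5⟩ := h3 i hi1 hi2
      exact crit_concl _ hdn hE η hR A A⁻¹ (Matrix.mul_nonsing_inv A hdu) (Matrix.nonsing_inv_mul A hdu) i hi2 h4 h5

end
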